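/- arXiv:2603.23139 — 3 statements merged into one kernel-verified Lean document; each statement's English description precedes it below -/
import Mathlib

section
/- Let G be a subcubic simple graph. Then every proper edge-precoloring of at most four edges of the Cartesian product G □ K₂ can be extended to a proper edge-coloring of G □ K₂ with 5 colors. -/
open SimpleGraph

/-- A (partial) edge-coloring `C` is proper on the edge set `E₀`:
any two distinct edges of `E₀` sharing an endpoint get different colors. -/
def ProperOn {V : Type*} (E₀ : Set (Sym2 V)) (C : Sym2 V → ℕ) : Prop :=
  ∀ e ∈ E₀, ∀ f ∈ E₀, e ≠ f → (∃ v, v ∈ e ∧ v ∈ f) → C e ≠ C f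

/-- `G` admits a proper edge-coloring using (at most) `t` colors. -/
def HasProperEdgeColoring {V : Type*} (G : SimpleGraph V) (t : ℕ) : Prop :=
  ∃ C : Sym2 V → ℕ, (∀ e ∈ G.edgeSet, C e < t) ∧ ProperOn G.edgeSet C

/-- The chromatic index `χ'(G)`. -/
noncomputable def chromIndex {V : Type*} (G : SimpleGraph V) : ℕ :=
  sInf {t | HasProperEdgeColoring G t}

/-- Every proper edge-precoloring of at most `k` edges of `G` extends to a
proper edge-coloring of `G` with `t` colors. -/
def PrecoloringExtendable {V : Type*} (G : SimpleGraph V) (k t : ℕ) : Prop :=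
  ∀ E₀ : Set (Sym2 V), E₀ ⊆ G.edgeSet → E₀.ncard ≤ k →
    ∀ c₀ : Sym2 V → ℕ, (∀ e ∈ E₀, c₀ e < t) → ProperOn E₀ c₀ →
      ∃ C : Sym2 V → ℕ, (∀ e ∈ G.edgeSet, C e < t) ∧ ProperOn G.edgeSet C ∧
        ∀ e ∈ E₀, C e = c₀ e

set_option linter.unusedSectionVars false

/-- The edges of `K` incident with `v`. -/
def inc {V : Type*} [DecidableEq V] (K : Finset (Sym2 V)) (v : V) : Finset (Sym2 V) :=
  K.filter (v ∈ ·)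

/-- The edges of `K`, other than `e`, sharing an endpoint with `e`. -/
def nbrs {V : Type*} [Fintype V] [DecidableEq V] (K : Finset (Sym2 V)) (e : Sym2 V) :
    Finset (Sym2 V) :=
  K.filter (fun f => f ≠ e ∧ ∃ v, v ∈ e ∧ v ∈ f)

/-- The vertices covered by the edge set `K`. -/
def supp {V : Type*} [Fintype V] [DecidableEq V] (K : Finset (Sym2 V)) : Finset V :=
  Finset.univ.filter (fun v => ∃ e ∈ K, v ∈ e)

/-- The colors of the palette `P` that are forbidden at no endpoint of `e`. -/
def avail {V : Type*} [Fintype V] [DecidableEq V] (P : Finset ℕ) (B : V → Finset ℕ)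
    (e : Sym2 V) : Finset ℕ :=
  P.filter (fun c => ∀ v ∈ e, c ∉ B v)

/-- `K` has a proper edge-coloring from the lists `L`. -/
def ListColorable {V : Type*} (L : Sym2 V → Finset ℕ) (K : Finset (Sym2 V)) : Prop :=
  ∃ C : Sym2 V → ℕ, (∀ e ∈ K, C e ∈ L e) ∧ ProperOn (K : Set (Sym2 V)) C

section Basic

variable {V : Type*} [Fintype V] [DecidableEq V]

lemma mem_inc {K : Finset (Sym2 V)} {v : V} {e : Sym2 V} : e ∈ inc K v ↔ e ∈ K ∧ v ∈ e := by
  simp [inc]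

lemma mem_nbrs {K : Finset (Sym2 V)} {e f : Sym2 V} :
    f ∈ nbrs K e ↔ f ∈ K ∧ f ≠ e ∧ ∃ v, v ∈ e ∧ v ∈ f := by
  simp [nbrs]

lemma mem_supp {K : Finset (Sym2 V)} {v : V} : v ∈ supp K ↔ ∃ e ∈ K, v ∈ e := by
  simp [supp]

lemma mem_avail {P : Finset ℕ} {B : V → Finset ℕ} {e : Sym2 V} {c : ℕ} :
    c ∈ avail P B e ↔ c ∈ P ∧ ∀ v ∈ e, c ∉ B v := by
  simp [avail]

lemma inc_mono {K K' : Finset (Sym2 V)} (h : K ⊆ K') (v : V) : inc K v ⊆ inc K' v :=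
  Finset.filter_subset_filter _ h

lemma supp_mono {K K' : Finset (Sym2 V)} (h : K ⊆ K') : supp K ⊆ supp K' := by
  intro v hv
  obtain ⟨e, he, hve⟩ := mem_supp.1 hv
  exact mem_supp.2 ⟨e, h he, hve⟩

lemma inc_pos {K : Finset (Sym2 V)} {v : V} (hv : v ∈ supp K) : 1 ≤ (inc K v).card := by
  obtain ⟨e, he, hve⟩ := mem_supp.1 hv
  exact Finset.card_pos.2 ⟨e, mem_inc.2 ⟨he, hve⟩⟩

/-- Greedy list coloring: if every nonempty subset has an edge with more colors than neighbours,
then the edge set is colorable. -/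
lemma greedy (L : Sym2 V → Finset ℕ) (E : Finset (Sym2 V))
    (h : ∀ K ⊆ E, K.Nonempty → ∃ e ∈ K, (nbrs K e).card < (L e).card) : ListColorable L E := by
  induction hn : E.card generalizing E with
  | zero =>
    rw [Finset.card_eq_zero] at hn
    subst hn
    exact ⟨fun _ => 0, by simp, by simp [ProperOn]⟩
  | succ n ih =>
    have hne : E.Nonempty := Finset.card_pos.1 (by omega)
    obtain ⟨e, he, hlt⟩ := h E subset_rfl hne
    obtain ⟨C, hC, hp⟩ := ih (E.erase e)
      (fun K hK => h K (hK.trans (Finset.erase_subset _ _)))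
      (by rw [Finset.card_erase_of_mem he]; omega)
    have : ∃ x ∈ L e, x ∉ (nbrs E e).image C := by
      by_contra! hcon
      have := Finset.card_le_card (show L e ⊆ (nbrs E e).image C from hcon)
      have := Finset.card_image_le (s := nbrs E e) (f := C)
      omega
    obtain ⟨x, hx, hxn⟩ := this
    have key : ∀ f ∈ E, f ≠ e → (∃ v, v ∈ e ∧ v ∈ f) → x ≠ C f := by
      intro f hf hfe hv hxf
      exact hxn (Finset.mem_image.2 ⟨f, mem_nbrs.2 ⟨hf, hfe, hv⟩, hxf.symm⟩)
    refine ⟨fun f => if f = e then x else C f, ?_, ?_⟩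
    · intro f hf
      by_cases hfe : f = e
      · simpa [hfe] using hx
      · simpa [hfe] using hC f (Finset.mem_erase.2 ⟨hfe, hf⟩)
    · intro f hf g hg hfg ⟨v, hvf, hvg⟩
      simp only [Finset.mem_coe] at hf hg
      by_cases hfe : f = e
      · subst hfe
        simpa [hfg.symm] using key g hg hfg.symm ⟨v, hvf, hvg⟩
      · by_cases hge : g = e
        · subst hge
          simpa [hfe] using (key f hf hfg ⟨v, hvg, hvf⟩).symm
        · simpa [hfe, hge] using hp f (by simp [hfe, hf]) g (by simp [hge, hg]) hfg ⟨v, hvf, hvg⟩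

lemma card_filter_mem (e : Sym2 V) (he : ¬ e.IsDiag) :
    (Finset.univ.filter (· ∈ e)).card = 2 := by
  rw [← Sym2.card_toFinset_of_not_isDiag e he]
  congr 1
  ext v
  simp

/-- Summing degrees over a vertex set counts each edge by its number of endpoints there. -/
lemma sum_inc (K : Finset (Sym2 V)) (W : Finset V) :
    ∑ v ∈ W, (inc K v).card = ∑ e ∈ K, (W.filter (· ∈ e)).card := by
  simp only [inc]
  exact Finset.sum_card_bipartiteAbove_eq_sum_card_bipartiteBelow (s := W) (t := K)
    (fun v e => v ∈ e)

lemma sum_inc_supp (K : Finset (Sym2 V)) (hK : ∀ e ∈ K, ¬ e.IsDiag) :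
    ∑ v ∈ supp K, (inc K v).card = 2 * K.card := by
  rw [sum_inc, mul_comm, ← smul_eq_mul, ← Finset.sum_const]
  refine Finset.sum_congr rfl fun e he => ?_
  rw [← card_filter_mem e (hK e he)]
  congr 1
  ext v
  simp only [Finset.mem_filter, mem_supp, Finset.mem_univ, true_and, and_iff_right_iff_imp]
  exact fun hv => ⟨e, he, hv⟩

lemma card_nbrs {K : Finset (Sym2 V)} {x y : V} (hxy : x ≠ y) (he : s(x, y) ∈ K) :
    (nbrs K s(x, y)).card + 2 = (inc K x).card + (inc K y).card := by
  have h : nbrs K s(x, y) = (inc K x).erase s(x, y) ∪ (inc K y).erase s(x, y) := by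
    ext f
    simp only [mem_nbrs, Finset.mem_union, Finset.mem_erase, mem_inc, Sym2.mem_iff]
    constructor
    · rintro ⟨h1, h2, v, rfl | rfl, h3⟩
      · exact Or.inl ⟨h2, h1, h3⟩
      · exact Or.inr ⟨h2, h1, h3⟩
    · rintro (⟨h1, h2, h3⟩ | ⟨h1, h2, h3⟩)
      · exact ⟨h2, h1, _, Or.inl rfl, h3⟩
      · exact ⟨h2, h1, _, Or.inr rfl, h3⟩
  have hd : Disjoint ((inc K x).erase s(x, y)) ((inc K y).erase s(x, y)) := by
    rw [Finset.disjoint_left]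
    intro f hf hf'
    simp only [Finset.mem_erase, mem_inc] at hf hf'
    exact hf.1 ((Sym2.mem_and_mem_iff hxy).1 ⟨hf.2.2, hf'.2.2⟩)
  have hx : s(x, y) ∈ inc K x := mem_inc.2 ⟨he, by simp⟩
  have hy : s(x, y) ∈ inc K y := mem_inc.2 ⟨he, by simp⟩
  have := Finset.card_pos.2 ⟨_, hx⟩
  have := Finset.card_pos.2 ⟨_, hy⟩
  rw [h, Finset.card_union_of_disjoint hd, Finset.card_erase_of_mem hx, Finset.card_erase_of_mem hy]
  omega

lemma ne_of_not_isDiag {x y : V} (h : ¬ s(x, y).IsDiag) : x ≠ y := by simpa using h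

/-- An edge set in which every nonempty subset has a leaf is a forest, so it has fewer edges than
vertices. -/
lemma card_lt_card_supp (K : Finset (Sym2 V)) (hd : ∀ e ∈ K, ¬ e.IsDiag) (hK : K.Nonempty)
    (h : ∀ K' ⊆ K, K'.Nonempty → ∃ v, (inc K' v).card = 1) : K.card < (supp K).card := by
  induction hn : K.card generalizing K with
  | zero => simp [Finset.card_eq_zero] at hn; simp [hn] at hK
  | succ n ih =>
    obtain ⟨v, hv⟩ := h K subset_rfl hK
    obtain ⟨e, he⟩ := Finset.card_eq_one.1 hv
    have heK : e ∈ K ∧ v ∈ e := mem_inc.1 (he ▸ Finset.mem_singleton_self e)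
    rcases (K.erase e).eq_empty_or_nonempty with h0 | h0
    · have h1 : n = 0 := by
        have := Finset.card_erase_of_mem heK.1
        rw [h0, hn] at this
        simpa using this.symm
      have : (Finset.univ.filter (· ∈ e)) ⊆ supp K := by
        intro w hw
        exact mem_supp.2 ⟨e, heK.1, by simpa using hw⟩
      have := Finset.card_le_card this
      rw [card_filter_mem e (hd e heK.1)] at this
      omega
    · have := ih (K.erase e) (fun f hf => hd f (Finset.mem_of_mem_erase hf)) h0
        (fun K' hK' => h K' (hK'.trans (Finset.erase_subset _ _)))
        (by rw [Finset.card_erase_of_mem heK.1]; omega)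
      have hsub : supp (K.erase e) ⊆ (supp K).erase v := by
        intro w hw
        refine Finset.mem_erase.2 ⟨?_, supp_mono (Finset.erase_subset _ _) hw⟩
        rintro rfl
        obtain ⟨f, hf, hwf⟩ := mem_supp.1 hw
        have : f ∈ inc K w := mem_inc.2 ⟨Finset.mem_of_mem_erase hf, hwf⟩
        rw [he, Finset.mem_singleton] at this
        exact (Finset.mem_erase.1 hf).1 this
      have h2 := Finset.card_le_card hsub
      rw [Finset.card_erase_of_mem (mem_supp.2 ⟨e, heK⟩)] at h2
      omega

lemma card_avail_add (P : Finset ℕ) (B : V → Finset ℕ) (x y : V) :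
    P.card ≤ (avail P B s(x, y)).card + (B x ∪ B y).card := by
  have : P ⊆ avail P B s(x, y) ∪ (B x ∪ B y) := by
    intro c hc
    by_cases h : c ∈ B x ∪ B y
    · exact Finset.mem_union_right _ h
    · refine Finset.mem_union_left _ (mem_avail.2 ⟨hc, ?_⟩)
      intro v hv
      simp only [Finset.mem_union, not_or] at h
      rcases Sym2.mem_iff.1 hv with rfl | rfl
      · exact h.1
      · exact h.2
  exact (Finset.card_le_card this).trans (Finset.card_union_le _ _)

end Basic

section Cycle

variable {V : Type*} [Fintype V] [DecidableEq V]

lemma exists_tight_of_not_listColorable {L : Sym2 V → Finset ℕ} {E : Finset (Sym2 V)}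
    (h : ¬ ListColorable L E) :
    ∃ K ⊆ E, K.Nonempty ∧ ∀ e ∈ K, (L e).card ≤ (nbrs K e).card := by
  by_contra! hcon
  exact h (greedy L E hcon)

/-- Extending a proper coloring to one more edge. -/
lemma ListColorable.insert_edge {L : Sym2 V → Finset ℕ} {K : Finset (Sym2 V)} {e : Sym2 V}
    {C : Sym2 V → ℕ} {x : ℕ} (hC : ∀ f ∈ K.erase e, C f ∈ L f)
    (hp : ProperOn (K.erase e : Set (Sym2 V)) C) (hx : x ∈ L e)
    (hxC : ∀ f ∈ K, f ≠ e → (∃ v, v ∈ e ∧ v ∈ f) → x ≠ C f) : ListColorable L K := by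
  refine ⟨fun f => if f = e then x else C f, ?_, ?_⟩
  · intro f hf
    by_cases hfe : f = e
    · simpa [hfe] using hx
    · simpa [hfe] using hC f (Finset.mem_erase.2 ⟨hfe, hf⟩)
  · intro f hf g hg hfg ⟨v, hvf, hvg⟩
    simp only [Finset.mem_coe] at hf hg
    by_cases hfe : f = e
    · subst hfe
      simpa [hfg.symm] using hxC g hg hfg.symm ⟨v, hvf, hvg⟩
    · by_cases hge : g = e
      · subst hge
        simpa [hfe] using (hxC f hf hfg ⟨v, hvg, hvf⟩).symm
      · simpa [hfe, hge] using hp f (by simp [hfe, hf]) g (by simp [hge, hg]) hfg ⟨v, hvf, hvg⟩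

lemma inc_eq_pair {C : Finset (Sym2 V)} {v : V} (h2 : (inc C v).card = 2) {e f : Sym2 V}
    (he : e ∈ C) (hf : f ∈ C) (hve : v ∈ e) (hvf : v ∈ f) (hef : e ≠ f) : inc C v = {e, f} := by
  symm
  apply Finset.eq_of_subset_of_card_le
  · intro g hg
    simp only [Finset.mem_insert, Finset.mem_singleton] at hg
    rcases hg with rfl | rfl
    · exact mem_inc.2 ⟨he, hve⟩
    · exact mem_inc.2 ⟨hf, hvf⟩
  · rw [h2, Finset.card_pair hef]

/-- A cycle with lists of size two is colorable if two consecutive lists differ. -/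
lemma listColorable_cycle_of_ne {L : Sym2 V → Finset ℕ} {C : Finset (Sym2 V)}
    (hd : ∀ e ∈ C, ¬ e.IsDiag)
    (hmin : ∀ K ⊆ C, K.Nonempty → K ≠ C → ∃ v, (inc K v).card = 1)
    (h2 : ∀ v ∈ supp C, (inc C v).card = 2) (hL : ∀ e ∈ C, 2 ≤ (L e).card)
    {p q : V} (he : s(p, q) ∈ C) {f : Sym2 V} (hf : f ∈ C) (hfe : f ≠ s(p, q)) (hpf : p ∈ f)
    {x : ℕ} (hx : x ∈ L s(p, q)) (hxf : x ∉ L f) : ListColorable L C := by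
  set L' : Sym2 V → Finset ℕ := fun g => if ∃ v, v ∈ s(p, q) ∧ v ∈ g then (L g).erase x else L g
    with hL'
  have hsub : ∀ g, L' g ⊆ L g := by
    intro g
    simp only [hL']
    split_ifs
    · exact Finset.erase_subset _ _
    · exact subset_rfl
  have hcol : ListColorable L' (C.erase s(p, q)) := by
    apply greedy
    intro K hK hKne
    by_contra! hcon
    have hKC : K ⊆ C := hK.trans (Finset.erase_subset _ _)
    have heK : s(p, q) ∉ K := fun h => (Finset.mem_erase.1 (hK h)).1 rfl
    have hlt := card_lt_card_supp K (fun e he => hd e (hKC he)) hKne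
      (fun K' hK' hne => hmin K' (hK'.trans hKC) hne (fun h => heK (hK' (h ▸ he))))
    have hdeg : ∀ v ∈ supp K, v ≠ q → 2 ≤ (inc K v).card := by
      intro v hv hvq
      by_contra! hlt
      have h1 := inc_pos hv
      obtain ⟨g, hg, hvg⟩ := mem_supp.1 hv
      obtain ⟨w, rfl⟩ := hvg
      have hvw := ne_of_not_isDiag (hd _ (hKC hg))
      have hn := card_nbrs hvw hg
      have hw : (inc K w).card ≤ 2 :=
        (Finset.card_le_card (inc_mono hKC w)).trans
          (h2 w (mem_supp.2 ⟨_, hKC hg, by simp⟩)).le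
      have hc := hcon _ hg
      have hl := hL _ (hKC hg)
      have hge : s(v, w) ≠ s(p, q) := fun h => heK (h ▸ hg)
      by_cases ht : ∃ u, u ∈ s(p, q) ∧ u ∈ s(v, w)
      · have hLg : L' s(v, w) = (L s(v, w)).erase x := by simp only [hL']; rw [if_pos ht]
        have hle := Finset.pred_card_le_card_erase (s := L s(v, w)) (a := x)
        obtain ⟨u, hu, hug⟩ := ht
        rcases Sym2.mem_iff.1 hu with rfl | rfl
        · have := inc_eq_pair (h2 u (mem_supp.2 ⟨_, he, by simp⟩)) he hf (by simp) hpf hfe.symm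
          have hm : s(v, w) ∈ inc C u := mem_inc.2 ⟨hKC hg, hug⟩
          rw [this] at hm
          simp only [Finset.mem_insert, Finset.mem_singleton, hge, false_or] at hm
          rw [hLg, hm, Finset.erase_eq_of_notMem hxf, ← hm] at hc
          omega
        · have huw : u = w := by
            rcases Sym2.mem_iff.1 hug with h | h
            · exact absurd h.symm hvq
            · exact h
          subst huw
          have : inc K u ⊆ (inc C u).erase s(p, u) := by
            intro g hg
            exact Finset.mem_erase.2 ⟨fun h => heK (h ▸ (mem_inc.1 hg).1), inc_mono hKC u hg⟩
          have := Finset.card_le_card this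
          rw [Finset.card_erase_of_mem (mem_inc.2 ⟨he, by simp⟩),
            h2 u (mem_supp.2 ⟨_, he, by simp⟩)] at this
          rw [hLg] at hc
          omega
      · have hLg : L' s(v, w) = L s(v, w) := by simp only [hL']; rw [if_neg ht]
        rw [hLg] at hc
        omega
    have hsum := sum_inc_supp K (fun e he => hd e (hKC he))
    have h3 : ∑ v ∈ (supp K).erase q, 2 ≤ ∑ v ∈ (supp K).erase q, (inc K v).card :=
      Finset.sum_le_sum fun v hv =>
        hdeg v (Finset.mem_of_mem_erase hv) (Finset.ne_of_mem_erase hv)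
    rw [Finset.sum_const, smul_eq_mul] at h3
    by_cases hq : q ∈ supp K
    · have h4 := Finset.add_sum_erase (supp K) (fun v => (inc K v).card) hq
      have h5 := inc_pos hq
      rw [Finset.card_erase_of_mem hq] at h3
      omega
    · rw [Finset.erase_eq_of_notMem hq] at h3
      omega
  obtain ⟨D, hD, hp⟩ := hcol
  refine ListColorable.insert_edge (fun g hg => hsub g (hD g hg)) (by simpa using hp) hx ?_
  intro g hg hge ht hxD
  have := hD g (Finset.mem_erase.2 ⟨hge, hg⟩)
  simp only [hL'] at this
  rw [if_pos ht] at this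
  exact (Finset.mem_erase.1 this).1 hxD.symm

lemma card_filter_eq_one_of_pair {ι : Type*} [DecidableEq ι] {g h : ι} {Λ : Finset ℕ}
    (hΛ : Λ.card = 2) {ψ : ι → ℕ} (hg : ψ g ∈ Λ) (hh : ψ h ∈ Λ) (hgh : ψ g ≠ ψ h) {c : ℕ}
    (hc : c ∈ Λ) : (({g, h} : Finset ι).filter (ψ · = c)).card = 1 := by
  have hΛ' : ({ψ g, ψ h} : Finset ℕ) = Λ := by
    apply Finset.eq_of_subset_of_card_le
    · intro a ha
      simp only [Finset.mem_insert, Finset.mem_singleton] at ha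
      rcases ha with rfl | rfl <;> assumption
    · rw [hΛ, Finset.card_pair hgh]
  rw [← hΛ'] at hc
  simp only [Finset.mem_insert, Finset.mem_singleton] at hc
  rw [Finset.card_eq_one]
  rcases hc with rfl | rfl
  · refine ⟨g, ?_⟩
    ext a
    simp only [Finset.mem_filter, Finset.mem_insert, Finset.mem_singleton]
    constructor
    · rintro ⟨rfl | rfl, h⟩
      · rfl
      · exact absurd h.symm hgh
    · rintro rfl
      simp
  · refine ⟨h, ?_⟩
    ext a
    simp only [Finset.mem_filter, Finset.mem_insert, Finset.mem_singleton]
    constructor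
    · rintro ⟨rfl | rfl, h⟩
      · exact absurd h hgh
      · rfl
    · rintro rfl
      simp

/-- Counting a color class of a two-colored path through the vertices of one class of a
bipartition of the cycle closing it up. -/
lemma card_color_class {C : Finset (Sym2 V)} (h2 : ∀ v ∈ supp C, (inc C v).card = 2)
    {Λ : Finset ℕ} (hΛ : Λ.card = 2) {e₀ : Sym2 V} (he₀ : e₀ ∈ C) {ψ : Sym2 V → ℕ}
    (hψ : ∀ f ∈ C.erase e₀, ψ f ∈ Λ) (hp : ProperOn (C.erase e₀ : Set (Sym2 V)) ψ)
    {A : Finset V} (hA : A ⊆ supp C) (hA1 : ∀ e ∈ C, (A.filter (· ∈ e)).card = 1)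
    {r : V} (hr : r ∈ A) (hre : r ∈ e₀) {f : Sym2 V} (hf : f ∈ C) (hfe : f ≠ e₀) (hrf : r ∈ f)
    {c : ℕ} (hc : c ∈ Λ) :
    2 * ((C.erase e₀).filter (ψ · = c)).card + 2 = C.card + 2 * (if ψ f = c then 1 else 0) := by
  have hC : C.card = 2 * A.card := by
    have h1 := sum_inc C A
    rw [Finset.sum_congr rfl (fun v hv => h2 v (hA hv)), Finset.sum_congr rfl hA1] at h1
    simp at h1
    omega
  have h1 := sum_inc ((C.erase e₀).filter (ψ · = c)) A
  rw [Finset.sum_congr rfl (fun e he => hA1 e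
    (Finset.mem_of_mem_erase (Finset.mem_of_mem_filter e he)))] at h1
  rw [← Finset.add_sum_erase A _ hr] at h1
  have h3 : ∀ v ∈ A.erase r, (inc ((C.erase e₀).filter (ψ · = c)) v).card = 1 := by
    intro v hv
    obtain ⟨hvr, hvA⟩ := Finset.mem_erase.1 hv
    have hve : v ∉ e₀ := by
      intro hve
      obtain ⟨a, ha⟩ := Finset.card_eq_one.1 (hA1 e₀ he₀)
      have h5 : v ∈ A.filter (· ∈ e₀) := Finset.mem_filter.2 ⟨hvA, hve⟩
      have h6 : r ∈ A.filter (· ∈ e₀) := Finset.mem_filter.2 ⟨hr, hre⟩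
      rw [ha, Finset.mem_singleton] at h5 h6
      exact hvr (h5.trans h6.symm)
    obtain ⟨g, h, hgh, hinc⟩ := Finset.card_eq_two.1 (h2 v (hA hvA))
    have hg : g ∈ inc C v := by simp [hinc]
    have hh : h ∈ inc C v := by simp [hinc]
    rw [mem_inc] at hg hh
    have hg' : g ∈ C.erase e₀ := Finset.mem_erase.2 ⟨fun h => hve (h ▸ hg.2), hg.1⟩
    have hh' : h ∈ C.erase e₀ := Finset.mem_erase.2 ⟨fun h' => hve (h' ▸ hh.2), hh.1⟩
    rw [← card_filter_eq_one_of_pair hΛ (hψ g hg') (hψ h hh')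
      (hp g (by exact_mod_cast hg') h (by exact_mod_cast hh') hgh ⟨v, hg.2, hh.2⟩) hc, ← hinc]
    congr 1
    ext k
    simp only [mem_inc, Finset.mem_filter, Finset.mem_erase]
    constructor
    · rintro ⟨⟨⟨-, h1⟩, h2⟩, h3⟩
      exact ⟨⟨h1, h3⟩, h2⟩
    · rintro ⟨⟨h1, h3⟩, h2⟩
      exact ⟨⟨⟨fun h => hve (h ▸ h3), h1⟩, h2⟩, h3⟩
  have h4 : (inc ((C.erase e₀).filter (ψ · = c)) r).card = if ψ f = c then 1 else 0 := by
    have hinc := inc_eq_pair (h2 r (hA hr)) he₀ hf hre hrf hfe.symm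
    have key : ∀ k, k ∈ inc ((C.erase e₀).filter (ψ · = c)) r ↔ k = f ∧ ψ k = c := by
      intro k
      have := Finset.ext_iff.1 hinc k
      simp only [mem_inc, Finset.mem_filter, Finset.mem_erase, Finset.mem_insert,
        Finset.mem_singleton] at this ⊢
      constructor
      · rintro ⟨⟨⟨h1, h2⟩, h3⟩, h4⟩
        exact ⟨(this.1 ⟨h2, h4⟩).resolve_left h1, h3⟩
      · rintro ⟨rfl, h⟩
        exact ⟨⟨⟨hfe, hf⟩, h⟩, hrf⟩
    split_ifs with h
    · rw [Finset.card_eq_one]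
      refine ⟨f, ?_⟩
      ext k
      rw [key, Finset.mem_singleton]
      exact ⟨fun h => h.1, fun h' => ⟨h', h' ▸ h⟩⟩
    · rw [Finset.card_eq_zero, Finset.eq_empty_iff_forall_notMem]
      rintro k hk
      obtain ⟨rfl, hk⟩ := (key k).1 hk
      exact h hk
  rw [Finset.sum_congr rfl h3, h4] at h1
  simp only [Finset.sum_const, smul_eq_mul, mul_one, Finset.card_erase_of_mem hr] at h1
  have := Finset.card_pos.2 ⟨r, hr⟩
  omega

/-- A cycle, with at most one of four colors forbidden at each vertex, is edge-colorable. -/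
lemma listColorable_cycle {P : Finset ℕ} (hP : P.card = 4) {S : V → Finset ℕ}
    {C : Finset (Sym2 V)} (hd : ∀ e ∈ C, ¬ e.IsDiag) (hne : C.Nonempty)
    (hmin : ∀ K ⊆ C, K.Nonempty → K ≠ C → ∃ v, (inc K v).card = 1)
    (h2 : ∀ v ∈ supp C, (inc C v).card = 2) (hS : ∀ v ∈ supp C, (S v).card ≤ 1) :
    ListColorable (avail P S) C := by
  have hL : ∀ e ∈ C, 2 ≤ (avail P S e).card := by
    intro e he
    induction e with | _ x y
    have h1 := card_avail_add P S x y
    have h3 := Finset.card_union_le (S x) (S y)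
    have h4 := hS x (mem_supp.2 ⟨_, he, by simp⟩)
    have h5 := hS y (mem_supp.2 ⟨_, he, by simp⟩)
    omega
  by_cases hA : ∃ e ∈ C, ∃ f ∈ C, f ≠ e ∧ (∃ v, v ∈ e ∧ v ∈ f) ∧ ¬ avail P S e ⊆ avail P S f
  · obtain ⟨e, he, f, hf, hfe, ⟨p, ⟨q, rfl⟩, hpf⟩, hsub⟩ := hA
    obtain ⟨x, hx, hxf⟩ := Finset.not_subset.1 hsub
    exact listColorable_cycle_of_ne hd hmin h2 hL he hf hfe hpf hx hxf
  push Not at hA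
  obtain ⟨e₀, he₀⟩ := hne
  set Λ := avail P S e₀ with hΛ
  have hconst : ∀ e ∈ C, avail P S e = Λ := by
    have : C.filter (avail P S · = Λ) = C := by
      by_contra hcon
      obtain ⟨v, hv⟩ := hmin (C.filter (avail P S · = Λ)) (Finset.filter_subset _ _)
        ⟨e₀, Finset.mem_filter.2 ⟨he₀, rfl⟩⟩ hcon
      obtain ⟨e, he⟩ := Finset.card_eq_one.1 hv
      have heK : e ∈ inc (C.filter (avail P S · = Λ)) v := he ▸ Finset.mem_singleton_self e
      obtain ⟨heC, hve⟩ := mem_inc.1 heK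
      have h22 := h2 v (mem_supp.2 ⟨e, Finset.mem_of_mem_filter _ heC, hve⟩)
      obtain ⟨f, hf, hfe⟩ := Finset.exists_mem_ne (s := inc C v) (by omega) e
      obtain ⟨hfC, hvf⟩ := mem_inc.1 hf
      obtain ⟨heC, heΛ⟩ := Finset.mem_filter.1 heC
      have hfΛ : avail P S f = Λ := by
        rw [← heΛ]
        exact Finset.Subset.antisymm (hA f hfC e heC hfe.symm ⟨v, hvf, hve⟩)
          (hA e heC f hfC hfe ⟨v, hve, hvf⟩)
      have : f ∈ inc (C.filter (avail P S · = Λ)) v :=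
        mem_inc.2 ⟨Finset.mem_filter.2 ⟨hfC, hfΛ⟩, hvf⟩
      rw [he, Finset.mem_singleton] at this
      exact hfe this
    intro e he
    rw [← this] at he
    exact (Finset.mem_filter.1 he).2
  have hdeg : ∀ K ⊆ C, ∀ w, (inc K w).card ≤ 2 := by
    intro K hK w
    by_cases hw : w ∈ supp C
    · exact (Finset.card_le_card (inc_mono hK w)).trans (h2 w hw).le
    · have : inc K w = ∅ := by
        rw [Finset.eq_empty_iff_forall_notMem]
        intro e he
        exact hw (mem_supp.2 ⟨e, hK (mem_inc.1 he).1, (mem_inc.1 he).2⟩)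
      simp [this]
  rcases lt_or_ge 2 Λ.card with h3 | h3
  · apply greedy
    rintro K hK ⟨e, he⟩
    refine ⟨e, he, ?_⟩
    rw [hconst e (hK he)]
    induction e with | _ x y
    have := card_nbrs (ne_of_not_isDiag (hd _ (hK he))) he
    have := hdeg K hK x
    have := hdeg K hK y
    omega
  have hΛP : Λ ⊆ P := Finset.filter_subset _ _
  have hΛ2 : Λ.card = 2 := le_antisymm h3 (hL e₀ he₀)
  have hcol : ListColorable (fun _ => Λ) (C.erase e₀) := by
    apply greedy
    intro K hK hne
    have hKC := hK.trans (Finset.erase_subset _ _)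
    obtain ⟨v, hv⟩ := hmin K hKC hne
      (fun h => (Finset.mem_erase.1 (hK (h ▸ he₀))).1 rfl)
    obtain ⟨e, he⟩ := Finset.card_pos.1 (by omega : 0 < (inc K v).card)
    obtain ⟨heK, ⟨w, rfl⟩⟩ := mem_inc.1 he
    refine ⟨_, heK, ?_⟩
    have := card_nbrs (ne_of_not_isDiag (hd _ (hKC heK))) heK
    have := hdeg K hKC w
    omega
  obtain ⟨ψ, hψ, hp⟩ := hcol
  have hforb : ∀ x y, s(x, y) ∈ C → (S x).card = 1 ∧ (S y).card = 1 ∧ S x ∪ S y = P \ Λ := by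
    intro x y he
    have h1 := card_avail_add P S x y
    have h3 := Finset.card_union_le (S x) (S y)
    have h4 := hS x (mem_supp.2 ⟨_, he, by simp⟩)
    have h5 := hS y (mem_supp.2 ⟨_, he, by simp⟩)
    have h6 := hconst _ he
    rw [h6] at h1
    refine ⟨by omega, by omega, ?_⟩
    symm
    apply Finset.eq_of_subset_of_card_le
    · intro c hc
      rw [Finset.mem_sdiff, ← h6, mem_avail] at hc
      by_contra hcon
      rw [Finset.mem_union, not_or] at hcon
      apply hc.2
      refine ⟨hc.1, fun v hv => ?_⟩
      rcases Sym2.mem_iff.1 hv with rfl | rfl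
      exacts [hcon.1, hcon.2]
    · rw [Finset.card_sdiff_of_subset hΛP]
      omega
  have hcount : ∀ r ∈ e₀, ∀ f ∈ C, f ≠ e₀ → r ∈ f → ∀ c ∈ Λ,
      2 * ((C.erase e₀).filter (ψ · = c)).card + 2 = C.card + 2 * (if ψ f = c then 1 else 0) := by
    intro r hr f hf hfe hrf c hc
    obtain ⟨a, ha⟩ : ∃ a, S r = {a} := by
      obtain ⟨r', rfl⟩ := hr
      exact Finset.card_eq_one.1 (hforb _ _ he₀).1
    have hrs : r ∈ supp C := mem_supp.2 ⟨_, hf, hrf⟩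
    have haP : a ∈ P \ Λ := by
      obtain ⟨r', rfl⟩ := hr
      rw [← (hforb _ _ he₀).2.2, ha]
      simp
    refine card_color_class h2 hΛ2 he₀ hψ hp (A := (supp C).filter (a ∈ S ·))
      (Finset.filter_subset _ _) ?_ (Finset.mem_filter.2 ⟨hrs, by simp [ha]⟩) hr hf hfe hrf hc
    intro e he
    induction e with | _ x y
    obtain ⟨hx, hy, hu⟩ := hforb x y he
    have hxs : x ∈ supp C := mem_supp.2 ⟨_, he, by simp⟩
    have hys : y ∈ supp C := mem_supp.2 ⟨_, he, by simp⟩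
    have hxy : Disjoint (S x) (S y) := by
      rw [← Finset.card_union_eq_card_add_card, hu,
        Finset.card_sdiff_of_subset hΛP]
      omega
    rw [← hu, Finset.mem_union] at haP
    rw [Finset.card_eq_one]
    rcases haP with h | h
    · have h' := Finset.disjoint_left.1 hxy h
      refine ⟨x, ?_⟩
      ext v
      simp only [Finset.mem_filter, Sym2.mem_iff, Finset.mem_singleton]
      constructor
      · rintro ⟨⟨-, h1⟩, rfl | rfl⟩
        · rfl
        · exact absurd h1 h'
      · rintro rfl
        exact ⟨⟨hxs, h⟩, Or.inl rfl⟩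
    · have h' := Finset.disjoint_right.1 hxy h
      refine ⟨y, ?_⟩
      ext v
      simp only [Finset.mem_filter, Sym2.mem_iff, Finset.mem_singleton]
      constructor
      · rintro ⟨⟨-, h1⟩, rfl | rfl⟩
        · exact absurd h1 h'
        · rfl
      · rintro rfl
        exact ⟨⟨hys, h⟩, Or.inr rfl⟩
  have hsame : ∀ r ∈ e₀, ∀ f ∈ C, f ≠ e₀ → r ∈ f → ∀ r' ∈ e₀, ∀ f' ∈ C, f' ≠ e₀ → r' ∈ f' →
      ψ f' = ψ f := by
    intro r hr f hf hfe hrf r' hr' f' hf' hfe' hrf'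
    have hc := hψ f (Finset.mem_erase.2 ⟨hfe, hf⟩)
    have h1 := hcount r hr f hf hfe hrf _ hc
    have h2 := hcount r' hr' f' hf' hfe' hrf' _ hc
    by_contra hcon
    rw [if_pos rfl] at h1
    rw [if_neg hcon] at h2
    omega
  obtain ⟨f, hf, hfe, r, hr, hrf⟩ : ∃ f ∈ C, f ≠ e₀ ∧ ∃ r ∈ e₀, r ∈ f := by
    obtain ⟨r, hr⟩ : ∃ r, r ∈ e₀ := by
      induction e₀ with | _ x y
      exact ⟨x, by simp⟩
    have := h2 r (mem_supp.2 ⟨e₀, he₀, hr⟩)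
    obtain ⟨f, hf, hfe⟩ := Finset.exists_mem_ne (s := inc C r) (by omega) e₀
    exact ⟨f, (mem_inc.1 hf).1, hfe, r, hr, (mem_inc.1 hf).2⟩
  obtain ⟨x, hx, hxf⟩ := Finset.exists_mem_ne (s := Λ) (by omega) (ψ f)
  refine ListColorable.insert_edge (e := e₀) (C := ψ) (x := x) ?_ hp hx ?_
  · intro g hg
    rw [hconst g (Finset.mem_of_mem_erase hg)]
    exact hψ g hg
  · rintro g hg hge ⟨r', hr', hrg⟩ h
    exact hxf (h.trans (hsame r hr f hf hfe hrf r' hr' g hg hge hrg))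

end Cycle

section Tight

variable {V : Type*} [Fintype V] [DecidableEq V]

/-- Every edge of `K` has at most as many available colors as neighbours in `K`. -/
def Tight (P : Finset ℕ) (B : V → Finset ℕ) (K : Finset (Sym2 V)) : Prop :=
  ∀ e ∈ K, (avail P B e).card ≤ (nbrs K e).card

lemma Tight.edge {P : Finset ℕ} (hP : P.card = 4) {B : V → Finset ℕ} {E K : Finset (Sym2 V)}
    (hd : ∀ e ∈ E, ¬ e.IsDiag) (hdeg : ∀ v, (B v).card + (inc E v).card ≤ 3) (hKE : K ⊆ E)
    (hK : Tight P B K) {x y : V} (he : s(x, y) ∈ K) :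
    (B x).card + (inc K x).card = 3 ∧ inc K x = inc E x ∧ Disjoint (B x) (B y) := by
  have h1 := card_avail_add P B x y
  have h2 := Finset.card_union_le (B x) (B y)
  have h3 := hK _ he
  have h4 := card_nbrs (ne_of_not_isDiag (hd _ (hKE he))) he
  have h5 := Finset.card_le_card (inc_mono hKE x)
  have h6 := Finset.card_le_card (inc_mono hKE y)
  have h7 := hdeg x
  have h8 := hdeg y
  refine ⟨by omega, Finset.eq_of_subset_of_card_le (inc_mono hKE x) (by omega), ?_⟩
  rw [← Finset.card_union_eq_card_add_card]
  omega

lemma Tight.vertex {P : Finset ℕ} (hP : P.card = 4) {B : V → Finset ℕ} {E K : Finset (Sym2 V)}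
    (hd : ∀ e ∈ E, ¬ e.IsDiag) (hdeg : ∀ v, (B v).card + (inc E v).card ≤ 3) (hKE : K ⊆ E)
    (hK : Tight P B K) {x : V} (hx : x ∈ supp K) :
    (B x).card + (inc K x).card = 3 ∧ inc K x = inc E x := by
  obtain ⟨e, he, ⟨y, rfl⟩⟩ := mem_supp.1 hx
  have := hK.edge hP hd hdeg hKE he
  exact ⟨this.1, this.2.1⟩

lemma ListColorable.union {L : Sym2 V → Finset ℕ} {K K' : Finset (Sym2 V)}
    (h : ListColorable L K) (h' : ListColorable L K')
    (hd : ∀ e ∈ K, ∀ f ∈ K', ∀ v, v ∈ e → v ∉ f) : ListColorable L (K ∪ K') := by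
  obtain ⟨C, hC, hp⟩ := h
  obtain ⟨C', hC', hp'⟩ := h'
  refine ⟨fun e => if e ∈ K then C e else C' e, ?_, ?_⟩
  · intro e he
    by_cases hK : e ∈ K
    · simpa [hK] using hC e hK
    · simpa [hK] using hC' e ((Finset.mem_union.1 he).resolve_left hK)
  · intro e he f hf hef ⟨v, hve, hvf⟩
    simp only [Finset.mem_coe, Finset.mem_union] at he hf
    by_cases hK : e ∈ K <;> by_cases hK' : f ∈ K
    · simpa [hK, hK'] using hp e hK f hK' hef ⟨v, hve, hvf⟩
    · exact absurd hvf (hd e hK f (hf.resolve_left hK') v hve)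
    · exact absurd hve (hd f hK' e (he.resolve_left hK) v hvf)
    · simpa [hK, hK'] using
        hp' e (he.resolve_left hK) f (hf.resolve_left hK') hef ⟨v, hve, hvf⟩

/-- A vertex-closed uncolorable set all of whose tight subsets are improper. -/
lemma exists_minimal_tight {P : Finset ℕ} (hP : P.card = 4) {B : V → Finset ℕ}
    {E : Finset (Sym2 V)} (hd : ∀ e ∈ E, ¬ e.IsDiag)
    (hdeg : ∀ v, (B v).card + (inc E v).card ≤ 3) (h : ¬ ListColorable (avail P B) E) :
    ∃ K ⊆ E, ¬ ListColorable (avail P B) K ∧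
      ∀ K' ⊆ K, K'.Nonempty → Tight P B K' → K' = K := by
  let p : Finset (Sym2 V) → Prop := fun K => K ⊆ E ∧ (∀ v ∈ supp K, inc K v = inc E v) ∧
    ¬ ListColorable (avail P B) K
  obtain ⟨K, ⟨hKE, hcl, hK⟩, hmin⟩ :=
    WellFounded.has_min (wellFounded_lt (α := Finset (Sym2 V))) {K | p K}
      ⟨E, subset_rfl, fun _ _ => rfl, h⟩
  refine ⟨K, hKE, hK, fun K' hK'K hne ht => ?_⟩
  by_contra hK'
  have hK'E := hK'K.trans hKE
  have hcl' : ∀ v ∈ supp K', inc K' v = inc E v :=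
    fun v hv => (ht.vertex hP hd hdeg hK'E hv).2
  have hsep : ∀ e ∈ K', ∀ f ∈ K \ K', ∀ v, v ∈ e → v ∉ f := by
    intro e he f hf v hve hvf
    have h1 : f ∈ inc E v := mem_inc.2 ⟨hKE (Finset.mem_sdiff.1 hf).1, hvf⟩
    rw [← hcl' v (mem_supp.2 ⟨e, he, hve⟩)] at h1
    exact (Finset.mem_sdiff.1 hf).2 (mem_inc.1 h1).1
  have hc1 : ListColorable (avail P B) K' := by
    by_contra hcon
    exact hmin K' ⟨hK'E, hcl', hcon⟩ (hK'K.ssubset_of_ne hK')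
  have hc2 : ListColorable (avail P B) (K \ K') := by
    by_contra hcon
    refine hmin (K \ K') ⟨Finset.sdiff_subset.trans hKE, ?_, hcon⟩
      (Finset.sdiff_ssubset hK'K hne)
    intro v hv
    obtain ⟨f, hf, hvf⟩ := mem_supp.1 hv
    rw [← hcl v (mem_supp.2 ⟨f, (Finset.mem_sdiff.1 hf).1, hvf⟩)]
    apply Finset.Subset.antisymm (inc_mono Finset.sdiff_subset v)
    intro g hg
    refine mem_inc.2 ⟨Finset.mem_sdiff.2 ⟨(mem_inc.1 hg).1, fun hgK' => ?_⟩, (mem_inc.1 hg).2⟩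
    exact hsep g hgK' f hf v (mem_inc.1 hg).2 hvf
  apply hK
  rw [← Finset.union_sdiff_of_subset hK'K]
  exact hc1.union hc2 hsep

lemma exists_cycle {K : Finset (Sym2 V)} (hd : ∀ e ∈ K, ¬ e.IsDiag) (hne : K.Nonempty)
    (hcard : (supp K).card ≤ K.card) :
    ∃ C ⊆ K, C.Nonempty ∧ (∀ K' ⊆ C, K'.Nonempty → K' ≠ C → ∃ v, (inc K' v).card = 1) ∧
      ∀ v ∈ supp C, (inc C v).card = 2 := by
  obtain ⟨C, ⟨hCK, hC, hdeg⟩, hmin⟩ :=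
    WellFounded.has_min (wellFounded_lt (α := Finset (Sym2 V)))
      {C | C ⊆ K ∧ C.Nonempty ∧ ∀ v, (inc C v).card ≠ 1} (by
        by_contra hcon
        have := card_lt_card_supp K hd hne (fun K' hK' hne' => by
          by_contra! h
          exact hcon ⟨K', hK', hne', h⟩)
        omega)
  have hmin' : ∀ K' ⊆ C, K'.Nonempty → K' ≠ C → ∃ v, (inc K' v).card = 1 := by
    intro K' hK' hne' hneq
    by_contra! h
    exact hmin K' ⟨hK'.trans hCK, hne', h⟩ (hK'.ssubset_of_ne hneq)
  refine ⟨C, hCK, hC, hmin', fun v hv => ?_⟩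
  by_contra hcon
  have hle : ∀ w ∈ supp C, 2 ≤ (inc C w).card := by
    intro w hw
    have := inc_pos hw
    have := hdeg w
    omega
  have h3 : 3 ≤ (inc C v).card := by
    have := hle v hv
    omega
  obtain ⟨e, he, hve⟩ := mem_supp.1 hv
  have hlt := card_lt_card_supp (C.erase e) (fun f hf => hd f (hCK (Finset.mem_of_mem_erase hf)))
    (by
      rw [← Finset.card_pos, Finset.card_erase_of_mem he]
      have := Finset.card_le_card (Finset.filter_subset (v ∈ ·) C)
      change (inc C v).card ≤ _ at this
      omega)
    (fun K' hK' hne' => hmin' K' (hK'.trans (Finset.erase_subset _ _)) hne'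
      (fun h => (Finset.mem_erase.1 (hK' (h ▸ he))).1 rfl))
  have h4 := Finset.card_le_card (supp_mono (Finset.erase_subset e C))
  rw [Finset.card_erase_of_mem he] at hlt
  have hsum := sum_inc_supp C (fun f hf => hd f (hCK hf))
  have := Finset.sum_lt_sum hle ⟨v, hv, h3⟩
  rw [Finset.sum_const, smul_eq_mul] at this
  omega

/-- If the edge set `E` cannot be colored from the palette `P` of four colors, this is because of
a tight tree component. -/
lemma exists_tight {P : Finset ℕ} (hP : P.card = 4) {B : V → Finset ℕ}
    {E : Finset (Sym2 V)} (hd : ∀ e ∈ E, ¬ e.IsDiag)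
    (hdeg : ∀ v, (B v).card + (inc E v).card ≤ 3) (h : ¬ ListColorable (avail P B) E) :
    ∃ K ⊆ E, K.Nonempty ∧ ¬ ListColorable (avail P B) K ∧ Tight P B K ∧
      K.card < (supp K).card := by
  obtain ⟨K, hKE, hK, hmin⟩ := exists_minimal_tight hP hd hdeg h
  obtain ⟨K', hK', hne, (ht : Tight P B K')⟩ := exists_tight_of_not_listColorable hK
  obtain rfl := hmin K' hK' hne ht
  refine ⟨K', hKE, hne, hK, ht, ?_⟩
  by_contra! hcard
  have hdK : ∀ e ∈ K', ¬ e.IsDiag := fun e he => hd e (hKE he)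
  obtain ⟨C, hCK, hCne, hCmin, hC2⟩ := exists_cycle hdK hne hcard
  have hrest : ListColorable (avail P B) (K' \ C) := by
    by_contra hcon
    obtain ⟨T, hT, hTne, htT⟩ := exists_tight_of_not_listColorable hcon
    have hTK := hmin T (hT.trans Finset.sdiff_subset) hTne htT
    obtain ⟨e, he⟩ := hCne
    have : e ∈ T := hTK ▸ hCK he
    exact (Finset.mem_sdiff.1 (hT this)).2 he
  obtain ⟨D, hD, hDp⟩ := hrest
  have hcyc : ListColorable (avail P fun v => B v ∪ (inc (K' \ C) v).image D) C := by
    refine listColorable_cycle hP (fun e he => hdK e (hCK he)) hCne hCmin hC2 fun v hv => ?_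
    have h1 := (Tight.vertex hP hd hdeg hKE ht (supp_mono hCK hv)).1
    have h2 := hC2 v hv
    have h3 : (inc (K' \ C) v).card + (inc C v).card = (inc K' v).card := by
      rw [← Finset.card_union_of_disjoint]
      · congr 1
        ext e
        simp only [Finset.mem_union, mem_inc, Finset.mem_sdiff]
        constructor
        · rintro (h | h)
          exacts [⟨h.1.1, h.2⟩, ⟨hCK h.1, h.2⟩]
        · intro h
          by_cases hc : e ∈ C
          exacts [Or.inr ⟨hc, h.2⟩, Or.inl ⟨⟨h.1, hc⟩, h.2⟩]
      · rw [Finset.disjoint_left]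
        intro e he he'
        exact (Finset.mem_sdiff.1 (mem_inc.1 he).1).2 (mem_inc.1 he').1
    have h4 := Finset.card_union_le (B v) ((inc (K' \ C) v).image D)
    have h5 := Finset.card_image_le (s := inc (K' \ C) v) (f := D)
    omega
  obtain ⟨ψ, hψ, hψp⟩ := hcyc
  apply hK
  have hcross : ∀ e ∈ C, ∀ f ∈ K', f ∉ C → ∀ v, v ∈ e → v ∈ f → ψ e ≠ D f := by
    intro e he f hf hfC v hve hvf heq
    have := (mem_avail.1 (hψ e he)).2 v hve
    exact this (Finset.mem_union_right _ (Finset.mem_image.2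
      ⟨f, mem_inc.2 ⟨Finset.mem_sdiff.2 ⟨hf, hfC⟩, hvf⟩, heq.symm⟩))
  refine ⟨fun e => if e ∈ C then ψ e else D e, ?_, ?_⟩
  · intro e he
    by_cases heC : e ∈ C
    · have := mem_avail.1 (hψ e heC)
      simp only [heC, if_true]
      exact mem_avail.2 ⟨this.1, fun v hv hc => this.2 v hv (Finset.mem_union_left _ hc)⟩
    · simpa [heC] using hD e (Finset.mem_sdiff.2 ⟨he, heC⟩)
  · intro e he f hf hef ⟨v, hve, hvf⟩
    simp only [Finset.mem_coe] at he hf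
    by_cases heC : e ∈ C <;> by_cases hfC : f ∈ C
    · simpa [heC, hfC] using hψp e heC f hfC hef ⟨v, hve, hvf⟩
    · simpa [heC, hfC] using hcross e heC f hf hfC v hve hvf
    · simpa [heC, hfC] using (hcross f hfC e he heC v hvf hve).symm
    · simpa [heC, hfC] using hDp e (by simp [he, heC]) f (by simp [hf, hfC]) hef ⟨v, hve, hvf⟩

end Tight

section OneSided

variable {V : Type*} [Fintype V] [DecidableEq V]

/-- A precoloring `c₀` of the edges `F` of `A`, together with a color `m v` forbidden at each vertex
`v` of `S`, such that each vertex has at most three edges and forbidden colors in total. -/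
structure Precoloring (P : Finset ℕ) (A F : Finset (Sym2 V)) (c₀ : Sym2 V → ℕ) (S : Finset V)
    (m : V → ℕ) : Prop where
  card_palette : P.card = 4
  subset : F ⊆ A
  not_isDiag : ∀ e ∈ A, ¬ e.IsDiag
  degree : ∀ v, (inc A v).card + (if v ∈ S then 1 else 0) ≤ 3
  mem_palette : ∀ f ∈ F, c₀ f ∈ P
  proper : ProperOn (F : Set (Sym2 V)) c₀
  ne : ∀ f ∈ F, ∀ v ∈ S, v ∈ f → c₀ f ≠ m v

/-- The precoloring extends to the edge set `A`. -/
def Extends (P : Finset ℕ) (A F : Finset (Sym2 V)) (c₀ : Sym2 V → ℕ) (S : Finset V)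
    (m : V → ℕ) : Prop :=
  ∃ C : Sym2 V → ℕ, (∀ e ∈ A, C e ∈ P) ∧ ProperOn (A : Set (Sym2 V)) C ∧
    (∀ f ∈ F, C f = c₀ f) ∧ ∀ v ∈ S, ∀ e ∈ A, v ∈ e → C e ≠ m v

/-- The colors forbidden at `v`. -/
def forb (F : Finset (Sym2 V)) (c₀ : Sym2 V → ℕ) (S : Finset V) (m : V → ℕ) (v : V) :
    Finset ℕ :=
  (inc F v).image c₀ ∪ if v ∈ S then {m v} else ∅

variable {P : Finset ℕ} {A F : Finset (Sym2 V)} {c₀ : Sym2 V → ℕ} {S : Finset V} {m : V → ℕ}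

lemma apply_mem_forb {f : Sym2 V} (hf : f ∈ F) {v : V} (hv : v ∈ f) : c₀ f ∈ forb F c₀ S m v :=
  Finset.mem_union_left _ (Finset.mem_image_of_mem _ (mem_inc.2 ⟨hf, hv⟩))

lemma mem_forb_of_mem {v : V} (hv : v ∈ S) : m v ∈ forb F c₀ S m v :=
  Finset.mem_union_right _ (by simp [hv])

lemma card_forb_le (v : V) :
    (forb F c₀ S m v).card ≤ (inc F v).card + if v ∈ S then 1 else 0 := by
  refine (Finset.card_union_le _ _).trans (add_le_add Finset.card_image_le ?_)
  split_ifs <;> simp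

lemma card_inc_sdiff (h : F ⊆ A) (v : V) :
    (inc F v).card + (inc (A \ F) v).card = (inc A v).card := by
  rw [← Finset.card_union_of_disjoint]
  · congr 1
    ext e
    simp only [Finset.mem_union, mem_inc, Finset.mem_sdiff]
    constructor
    · rintro (h' | h')
      exacts [⟨h h'.1, h'.2⟩, ⟨h'.1.1, h'.2⟩]
    · intro h'
      by_cases hc : e ∈ F
      exacts [Or.inl ⟨hc, h'.2⟩, Or.inr ⟨⟨h'.1, hc⟩, h'.2⟩]
  · rw [Finset.disjoint_left]
    intro e he he'
    exact (Finset.mem_sdiff.1 (mem_inc.1 he').1).2 (mem_inc.1 he).1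

lemma Precoloring.forb_degree (h : Precoloring P A F c₀ S m) (v : V) :
    (forb F c₀ S m v).card + (inc (A \ F) v).card ≤ 3 := by
  have := h.degree v
  have := card_inc_sdiff h.subset v
  have := card_forb_le (F := F) (c₀ := c₀) (S := S) (m := m) v
  omega

lemma Precoloring.extends_of_listColorable (h : Precoloring P A F c₀ S m)
    (hc : ListColorable (avail P (forb F c₀ S m)) (A \ F)) : Extends P A F c₀ S m := by
  obtain ⟨C, hC, hp⟩ := hc
  have hcross : ∀ f ∈ F, ∀ e ∈ A, e ∉ F → ∀ v, v ∈ f → v ∈ e → C e ≠ c₀ f := by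
    intro f hf e he heF v hvf hve heq
    exact (mem_avail.1 (hC e (Finset.mem_sdiff.2 ⟨he, heF⟩))).2 v hve
      (heq ▸ apply_mem_forb hf hvf)
  refine ⟨fun e => if e ∈ F then c₀ e else C e, ?_, ?_, ?_, ?_⟩
  · intro e he
    by_cases heF : e ∈ F
    · simpa [heF] using h.mem_palette e heF
    · simpa [heF] using (mem_avail.1 (hC e (Finset.mem_sdiff.2 ⟨he, heF⟩))).1
  · intro e he f hf hef ⟨v, hve, hvf⟩
    simp only [Finset.mem_coe] at he hf
    by_cases heF : e ∈ F <;> by_cases hfF : f ∈ F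
    · simpa [heF, hfF] using h.proper e heF f hfF hef ⟨v, hve, hvf⟩
    · simpa [heF, hfF] using (hcross e heF f hf hfF v hve hvf).symm
    · simpa [heF, hfF] using hcross f hfF e he heF v hvf hve
    · simpa [heF, hfF] using hp e (by simp [he, heF]) f (by simp [hf, hfF]) hef ⟨v, hve, hvf⟩
  · intro f hf
    simp [hf]
  · intro v hv e he hve
    by_cases heF : e ∈ F
    · simpa [heF] using h.ne e heF v hv hve
    · simp only [heF, if_false]
      intro heq
      exact (mem_avail.1 (hC e (Finset.mem_sdiff.2 ⟨he, heF⟩))).2 v hve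
        (heq ▸ mem_forb_of_mem hv)

lemma Precoloring.exists_tight (h : Precoloring P A F c₀ S m) (hE : ¬ Extends P A F c₀ S m) :
    ∃ K ⊆ A \ F, K.Nonempty ∧ ¬ ListColorable (avail P (forb F c₀ S m)) K ∧
      Tight P (forb F c₀ S m) K ∧ K.card < (supp K).card :=
  _root_.exists_tight h.card_palette
    (fun e he => h.not_isDiag e (Finset.mem_sdiff.1 he).1) h.forb_degree
    (fun hc => hE (h.extends_of_listColorable hc))

/-- Every edge with both ends in `W` is the image of an off-diagonal pair. -/
lemma mem_offDiag_image {W : Finset V} {e : Sym2 V} (hd : ¬ e.IsDiag) (h : ∀ v ∈ e, v ∈ W) :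
    e ∈ W.offDiag.image (fun p => s(p.1, p.2)) := by
  induction e with | _ x y
  exact Finset.mem_image.2 ⟨(x, y), Finset.mem_offDiag.2
    ⟨h x (by simp), h y (by simp), ne_of_not_isDiag hd⟩, rfl⟩

lemma card_offDiag_image (W : Finset V) :
    (W.offDiag.image (fun p => s(p.1, p.2))).card = W.card.choose 2 :=
  Sym2.card_image_offDiag W

/-- The numerical consequences of a tight tree. -/
lemma Precoloring.count (h : Precoloring P A F c₀ S m) {K : Finset (Sym2 V)} (hK : K ⊆ A \ F)
    (ht : Tight P (forb F c₀ S m) K) :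
    ∑ v ∈ supp K, (forb F c₀ S m v).card + 2 * K.card = 3 * (supp K).card ∧
    ∑ v ∈ supp K, (forb F c₀ S m v).card ≤
      (S ∩ supp K).card + F.card + (F.filter (∀ v ∈ ·, v ∈ supp K)).card ∧
    K.card + (F.filter (∀ v ∈ ·, v ∈ supp K)).card ≤ (supp K).card.choose 2 := by
  have hd : ∀ e ∈ A \ F, ¬ e.IsDiag := fun e he => h.not_isDiag e (Finset.mem_sdiff.1 he).1
  refine ⟨?_, ?_, ?_⟩
  · rw [← sum_inc_supp K (fun e he => hd e (hK he)), ← Finset.sum_add_distrib,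
      Finset.sum_congr rfl
        (fun v hv => (ht.vertex h.card_palette hd h.forb_degree hK hv).1)]
    simp [mul_comm]
  · refine (Finset.sum_le_sum fun v _ => card_forb_le v).trans ?_
    rw [Finset.sum_add_distrib, sum_inc]
    have h1 : ∑ v ∈ supp K, (if v ∈ S then 1 else 0) = (S ∩ supp K).card := by
      rw [← Finset.card_filter, Finset.inter_comm, Finset.filter_mem_eq_inter]
    have h2 : ∑ e ∈ F, ((supp K).filter (· ∈ e)).card ≤
        ∑ e ∈ F, (1 + if ∀ v ∈ e, v ∈ supp K then 1 else 0) := by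
      refine Finset.sum_le_sum fun e he => ?_
      have h3 := card_filter_mem e (h.not_isDiag e (h.subset he))
      have hsub : (supp K).filter (· ∈ e) ⊆ Finset.univ.filter (· ∈ e) :=
        Finset.filter_subset_filter _ (Finset.subset_univ _)
      split_ifs with hin
      · exact (Finset.card_le_card hsub).trans h3.le
      · push Not at hin
        obtain ⟨v, hve, hv⟩ := hin
        have : (supp K).filter (· ∈ e) ⊂ Finset.univ.filter (· ∈ e) := by
          refine hsub.ssubset_of_ne fun heq => hv ?_
          have : v ∈ Finset.univ.filter (· ∈ e) := by simpa using hve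
          rw [← heq] at this
          exact (Finset.mem_filter.1 this).1
        have := Finset.card_lt_card this
        omega
    rw [Finset.sum_add_distrib, ← Finset.card_filter] at h2
    simp only [Finset.sum_const, smul_eq_mul, mul_one] at h2
    omega
  · rw [← card_offDiag_image, ← Finset.card_union_of_disjoint]
    · apply Finset.card_le_card
      intro e he
      rcases Finset.mem_union.1 he with he | he
      · exact mem_offDiag_image (hd e (hK he)) (fun v hv => mem_supp.2 ⟨e, he, hv⟩)
      · obtain ⟨he, hin⟩ := Finset.mem_filter.1 he
        exact mem_offDiag_image (h.not_isDiag e (h.subset he)) hin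
    · rw [Finset.disjoint_left]
      intro e he he'
      exact (Finset.mem_sdiff.1 (hK he)).2 (Finset.mem_filter.1 he').1

/-- A precoloring forbidding at most one color at each vertex extends. -/
lemma Precoloring.extends_of_card_forb_le_one (h : Precoloring P A F c₀ S m)
    (hf : ∀ v ∈ supp (A \ F), (forb F c₀ S m v).card ≤ 1) : Extends P A F c₀ S m := by
  by_contra hE
  obtain ⟨K, hK, hne, -, ht, hlt⟩ := h.exists_tight hE
  obtain ⟨h1, -, -⟩ := h.count hK ht
  have : ∑ v ∈ supp K, (forb F c₀ S m v).card ≤ ∑ v ∈ supp K, 1 :=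
    Finset.sum_le_sum fun v hv => hf v (supp_mono hK hv)
  simp only [Finset.sum_const, smul_eq_mul, mul_one] at this
  omega

/-- The only obstruction to extending a precoloring with at most one precolored edge. -/
lemma Precoloring.obstruction (h : Precoloring P A F c₀ S m) (hF : F.card ≤ 1)
    (hE : ¬ Extends P A F c₀ S m) :
    ∃ f K, F = {f} ∧ K ⊆ A \ F ∧ K.Nonempty ∧ supp K ⊆ S ∧ (∀ v ∈ f, v ∈ supp K) ∧
      K.card + 1 = (supp K).card ∧ ∀ x y, s(x, y) ∈ K → m x ≠ m y := by
  obtain ⟨K, hK, hne, -, ht, hlt⟩ := h.exists_tight hE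
  obtain ⟨h1, h2, -⟩ := h.count hK ht
  have h3 : (S ∩ supp K).card ≤ (supp K).card := Finset.card_le_card Finset.inter_subset_right
  have h4 := Finset.card_le_card (Finset.filter_subset (∀ v ∈ ·, v ∈ supp K) F)
  obtain ⟨f, hf⟩ := Finset.card_eq_one.1 (show F.card = 1 by omega)
  have hS : supp K ⊆ S := by
    have := Finset.eq_of_subset_of_card_le (Finset.inter_subset_right (s₁ := S) (s₂ := supp K))
      (by omega)
    rw [← this]
    exact Finset.inter_subset_left
  refine ⟨f, K, hf, hK, hne, hS, ?_, by omega, ?_⟩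
  · have : F.filter (∀ v ∈ ·, v ∈ supp K) = F :=
      Finset.eq_of_subset_of_card_le (Finset.filter_subset _ _) (by omega)
    have hfF : f ∈ F := by simp [hf]
    rw [← this] at hfF
    exact (Finset.mem_filter.1 hfF).2
  · intro x y hxy heq
    have hd := (ht.edge h.card_palette
      (fun e he => h.not_isDiag e (Finset.mem_sdiff.1 he).1) h.forb_degree hK hxy).2.2
    have hx : x ∈ S := hS (mem_supp.2 ⟨_, hxy, by simp⟩)
    have hy : y ∈ S := hS (mem_supp.2 ⟨_, hxy, by simp⟩)
    exact Finset.disjoint_left.1 hd (mem_forb_of_mem hx) (heq ▸ mem_forb_of_mem hy)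

lemma exists_compl_edge {W : Finset V} (hW : W.card = 4) {e : Sym2 V} (hd : ¬ e.IsDiag)
    (he : ∀ v ∈ e, v ∈ W) :
    ∃ e' : Sym2 V, ¬ e'.IsDiag ∧ (∀ v ∈ e', v ∈ W) ∧ ∀ v ∈ e', v ∉ e := by
  have h1 : W.filter (· ∈ e) = Finset.univ.filter (· ∈ e) := by
    ext v
    simpa using he v
  have h2 := Finset.card_filter_add_card_filter_not (s := W) (· ∈ e)
  rw [h1, card_filter_mem e hd, hW] at h2
  obtain ⟨x, y, hxy, hs⟩ := Finset.card_eq_two.1 (by omega : (W.filter (· ∉ e)).card = 2)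
  have key : ∀ v, v ∈ s(x, y) → v ∈ W ∧ v ∉ e := by
    intro v hv
    have : v ∈ W.filter (· ∉ e) := by
      rw [hs]
      simpa using hv
    exact Finset.mem_filter.1 this
  exact ⟨s(x, y), by simpa using hxy, fun v hv => (key v hv).1, fun v hv => (key v hv).2⟩

lemma eq_of_disjoint_edge {W : Finset V} (hW : W.card = 4) {e f g : Sym2 V} (hd : ¬ e.IsDiag)
    (he : ∀ v ∈ e, v ∈ W) (hdf : ¬ f.IsDiag) (hf : ∀ v ∈ f, v ∈ W) (hdg : ¬ g.IsDiag)
    (hg : ∀ v ∈ g, v ∈ W) (hef : ∀ v ∈ f, v ∉ e) (heg : ∀ v ∈ g, v ∉ e) : f = g := by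
  have h1 : W.filter (· ∈ e) = Finset.univ.filter (· ∈ e) := by
    ext v
    simpa using he v
  have h2 := Finset.card_filter_add_card_filter_not (s := W) (· ∈ e)
  rw [h1, card_filter_mem e hd, hW] at h2
  have key : ∀ k : Sym2 V, ¬ k.IsDiag → (∀ v ∈ k, v ∈ W) → (∀ v ∈ k, v ∉ e) →
      Finset.univ.filter (· ∈ k) = W.filter (· ∉ e) := by
    intro k hk hkW hke
    apply Finset.eq_of_subset_of_card_le
    · intro v hv
      have hv : v ∈ k := by simpa using hv
      exact Finset.mem_filter.2 ⟨hkW v hv, hke v hv⟩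
    · rw [card_filter_mem k hk]
      omega
  have h3 := (key f hdf hf hef).trans (key g hdg hg heg).symm
  apply Sym2.ext
  intro v
  have := Finset.ext_iff.1 h3 v
  simpa using this

/-- Three precolored edges of a complete graph on four vertices extend. -/
lemma listColorable_of_complete {P : Finset ℕ} (hP : P.card = 4) {K F : Finset (Sym2 V)}
    {c₀ : Sym2 V → ℕ} {W : Finset V} (hW : W.card = 4) (hF : F.card = 3) (hK : K.card = 3)
    (hKF : Disjoint K F) (hKd : ∀ e ∈ K, ¬ e.IsDiag) (hFd : ∀ e ∈ F, ¬ e.IsDiag)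
    (hKW : ∀ e ∈ K, ∀ v ∈ e, v ∈ W) (hFW : ∀ e ∈ F, ∀ v ∈ e, v ∈ W)
    (hc : ∀ f ∈ F, c₀ f ∈ P) (hp : ProperOn (F : Set (Sym2 V)) c₀) :
    ListColorable (avail P fun v => (inc F v).image c₀) K := by
  have hall : ∀ e : Sym2 V, ¬ e.IsDiag → (∀ v ∈ e, v ∈ W) → e ∈ K ∪ F := by
    have : K ∪ F = W.offDiag.image (fun p => s(p.1, p.2)) := by
      apply Finset.eq_of_subset_of_card_le
      · intro e he
        rcases Finset.mem_union.1 he with he | he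
        · exact mem_offDiag_image (hKd e he) (hKW e he)
        · exact mem_offDiag_image (hFd e he) (hFW e he)
      · rw [card_offDiag_image, hW, Finset.card_union_of_disjoint hKF, hF, hK]
        decide
    intro e hd he
    rw [this]
    exact mem_offDiag_image hd he
  obtain ⟨δ, hδP, hδ⟩ : ∃ δ ∈ P, δ ∉ F.image c₀ := by
    by_contra! hcon
    have := (Finset.card_le_card hcon).trans Finset.card_image_le
    omega
  have hex : ∀ e : Sym2 V, ∃ e' : Sym2 V, e ∈ K →
      ¬ e'.IsDiag ∧ (∀ v ∈ e', v ∈ W) ∧ ∀ v ∈ e', v ∉ e := by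
    intro e
    by_cases he : e ∈ K
    · obtain ⟨e', h⟩ := exists_compl_edge hW (hKd e he) (hKW e he)
      exact ⟨e', fun _ => h⟩
    · exact ⟨e, fun h => absurd h he⟩
  choose opp hopp using hex
  have hinj : ∀ e ∈ K, ∀ f ∈ K, opp e = opp f → e = f := by
    intro e he f hf heq
    obtain ⟨h1, h2, h3⟩ := hopp e he
    obtain ⟨-, -, h4⟩ := hopp f hf
    exact eq_of_disjoint_edge hW h1 h2 (hKd e he) (hKW e he) (hKd f hf) (hKW f hf)
      (fun v hv hv' => h3 v hv' hv) (fun v hv hv' => h4 v (heq ▸ hv') hv)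
  have hne : ∀ e ∈ K, opp e ≠ e := by
    intro e he heq
    have := (hopp e he).2.2
    rw [heq] at this
    induction e with | _ x y
    exact this x (by simp) (by simp)
  refine ⟨fun e => if opp e ∈ F then c₀ (opp e) else δ, ?_, ?_⟩
  · intro e he
    obtain ⟨h1, h2, h3⟩ := hopp e he
    refine mem_avail.2 ⟨?_, ?_⟩
    · beta_reduce
      split_ifs with h
      exacts [hc _ h, hδP]
    · intro v hv hmem
      obtain ⟨g, hg, hgc⟩ := Finset.mem_image.1 hmem
      obtain ⟨hgF, hvg⟩ := mem_inc.1 hg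
      beta_reduce at hgc
      split_ifs at hgc with h
      · have hgo : g ≠ opp e := fun heq => h3 v (heq ▸ hvg) hv
        have : ∃ w, w ∈ g ∧ w ∈ opp e := by
          by_contra! hcon
          have : g = e := eq_of_disjoint_edge hW h1 h2 (hFd g hgF) (hFW g hgF) (hKd e he)
            (hKW e he) hcon (fun v hv hv' => h3 v hv' hv)
          exact Finset.disjoint_left.1 hKF he (this ▸ hgF)
        exact hp g hgF _ h hgo this hgc
      · exact hδ (hgc ▸ Finset.mem_image_of_mem _ hgF)
  · intro e he f hf hef ⟨v, hve, hvf⟩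
    simp only [Finset.mem_coe] at he hf
    obtain ⟨h1, h2, h3⟩ := hopp e he
    obtain ⟨h4, h5, h6⟩ := hopp f hf
    have hne' : opp e ≠ opp f := fun h => hef (hinj e he f hf h)
    have hnf : opp e ≠ f := fun h => h3 v (h ▸ hvf) hve
    have hnf' : opp f ≠ e := fun h => h6 v (h ▸ hve) hvf
    by_cases hoe : opp e ∈ F <;> by_cases hof : opp f ∈ F
    · simp only [hoe, hof, if_true]
      refine hp _ hoe _ hof hne' ?_
      by_contra! hcon
      have : e = opp f := eq_of_disjoint_edge hW h1 h2 (hKd e he) (hKW e he) h4 h5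
        (fun v hv hv' => h3 v hv' hv) (fun v hv hv' => hcon v hv' hv)
      exact hnf' this.symm
    · simp only [hoe, hof, if_true, if_false]
      exact fun h => hδ (h ▸ Finset.mem_image_of_mem _ hoe)
    · simp only [hoe, hof, if_true, if_false]
      exact fun h => hδ (h ▸ Finset.mem_image_of_mem _ hof)
    · have h7 := (Finset.mem_union.1 (hall _ h1 h2)).resolve_right hoe
      have h8 := (Finset.mem_union.1 (hall _ h4 h5)).resolve_right hof
      have : ({e, f, opp e, opp f} : Finset (Sym2 V)) ⊆ K := by
        intro g hg
        simp only [Finset.mem_insert, Finset.mem_singleton] at hg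
        rcases hg with rfl | rfl | rfl | rfl <;> assumption
      have := Finset.card_le_card this
      rw [Finset.card_insert_of_notMem (by
          simp [hef, (hne e he).symm, hnf'.symm]),
        Finset.card_insert_of_notMem (by simp [hnf.symm, (hne f hf).symm]),
        Finset.card_pair hne'] at this
      omega

/-- A precoloring with at most three precolored edges and forbidden vertex colors extends. -/
lemma Precoloring.extends_of_card_le_three (h : Precoloring P A F c₀ S m)
    (hcard : F.card + S.card ≤ 3) : Extends P A F c₀ S m := by
  by_contra hE
  obtain ⟨K, hK, hne, hnc, ht, hlt⟩ := h.exists_tight hE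
  obtain ⟨h1, h2, h3⟩ := h.count hK ht
  have h4 : (S ∩ supp K).card ≤ S.card := Finset.card_le_card Finset.inter_subset_left
  have h5 := Finset.card_le_card (Finset.filter_subset (∀ v ∈ ·, v ∈ supp K) F)
  have h6 := Finset.card_pos.2 hne
  have hn4 : (supp K).card ≤ 4 := by omega
  have hn : (supp K).card = 4 := by
    generalize (supp K).card = n at *
    interval_cases n
    · omega
    · omega
    · have : Nat.choose 2 2 = 1 := rfl
      omega
    · have : Nat.choose 3 2 = 3 := rfl
      omega
    · rfl
  have hF : F.card = 3 := by omega
  have hS : S = ∅ := Finset.card_eq_zero.1 (by omega)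
  have hin : F.filter (∀ v ∈ ·, v ∈ supp K) = F :=
    Finset.eq_of_subset_of_card_le (Finset.filter_subset _ _) (by omega)
  apply hnc
  have := listColorable_of_complete (c₀ := c₀) h.card_palette hn hF (K := K) (by omega)
    (Finset.disjoint_left.2 fun e he => (Finset.mem_sdiff.1 (hK he)).2)
    (fun e he => h.not_isDiag e (Finset.mem_sdiff.1 (hK he)).1)
    (fun e he => h.not_isDiag e (h.subset he))
    (fun e he v hv => mem_supp.2 ⟨e, he, hv⟩)
    (fun e he => by rw [← hin] at he; exact (Finset.mem_filter.1 he).2)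
    h.mem_palette h.proper
  have hB : forb F c₀ S m = fun v => (inc F v).image c₀ := by
    funext v
    simp [forb, hS]
  rwa [hB]

end OneSided

section Glue

variable {V : Type*} [Fintype V] [DecidableEq V]

/-- A precoloring of the prism over the graph with edge set `E`: the edges `F₁`, `F₂` of the two
copies of `E` and the edges joining the two copies of each vertex in `R` are precolored. -/
structure PrismPrecoloring (E F₁ F₂ : Finset (Sym2 V)) (c₁ c₂ : Sym2 V → ℕ) (R : Finset V)
    (m : V → ℕ) : Prop where
  not_isDiag : ∀ e ∈ E, ¬ e.IsDiag
  degree_le : ∀ v, (inc E v).card ≤ 3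
  degree_eq : ∀ v ∈ R, (inc E v).card = 3
  subset₁ : F₁ ⊆ E
  subset₂ : F₂ ⊆ E
  lt₁ : ∀ f ∈ F₁, c₁ f < 5
  lt₂ : ∀ f ∈ F₂, c₂ f < 5
  lt : ∀ v ∈ R, m v < 5
  proper₁ : ProperOn (F₁ : Set (Sym2 V)) c₁
  proper₂ : ProperOn (F₂ : Set (Sym2 V)) c₂
  ne₁ : ∀ f ∈ F₁, ∀ v ∈ R, v ∈ f → c₁ f ≠ m v
  ne₂ : ∀ f ∈ F₂, ∀ v ∈ R, v ∈ f → c₂ f ≠ m v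

/-- The precoloring of the prism extends to a proper coloring with five colors. -/
def PrismExtends (E F₁ F₂ : Finset (Sym2 V)) (c₁ c₂ : Sym2 V → ℕ) (R : Finset V)
    (m : V → ℕ) : Prop :=
  ∃ (C₁ C₂ : Sym2 V → ℕ) (μ : V → ℕ), (∀ e ∈ E, C₁ e < 5) ∧ (∀ e ∈ E, C₂ e < 5) ∧
    (∀ v, μ v < 5) ∧ ProperOn (E : Set (Sym2 V)) C₁ ∧ ProperOn (E : Set (Sym2 V)) C₂ ∧
    (∀ e ∈ E, ∀ v ∈ e, C₁ e ≠ μ v ∧ C₂ e ≠ μ v) ∧ (∀ f ∈ F₁, C₁ f = c₁ f) ∧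
    (∀ f ∈ F₂, C₂ f = c₂ f) ∧ ∀ v ∈ R, μ v = m v

/-- The four colors other than the main color `c`. -/
def palette (c : ℕ) : Finset ℕ := (Finset.range 5).erase c

lemma mem_palette {c x : ℕ} : x ∈ palette c ↔ x ≠ c ∧ x < 5 := by simp [palette]

lemma card_palette {c : ℕ} (hc : c < 5) : (palette c).card = 4 := by
  rw [palette, Finset.card_erase_of_mem (by simpa using hc)]
  rfl

/-- Distinct edges of `N` are disjoint. -/
def Matching (N : Finset (Sym2 V)) : Prop :=
  ∀ e ∈ N, ∀ f ∈ N, ∀ v, v ∈ e → v ∈ f → e = f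

lemma Matching.card_inc {N : Finset (Sym2 V)} (h : Matching N) {v : V} (hv : v ∈ supp N) :
    (inc N v).card = 1 := by
  refine le_antisymm (Finset.card_le_one.2 fun e he f hf => ?_) (inc_pos hv)
  rw [mem_inc] at he hf
  exact h e he.1 f hf.1 v he.2 hf.2

lemma matching_empty : Matching (∅ : Finset (Sym2 V)) := by simp [Matching]

lemma supp_empty : supp (∅ : Finset (Sym2 V)) = ∅ := by simp [supp]

lemma mem_supp_insert {N : Finset (Sym2 V)} {a b v : V} :
    v ∈ supp (insert s(a, b) N) ↔ v = a ∨ v = b ∨ v ∈ supp N := by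
  simp only [mem_supp, Finset.mem_insert]
  constructor
  · rintro ⟨e, rfl | he, hv⟩
    · simpa using (Sym2.mem_iff.1 hv).imp_right Or.inl
    · exact Or.inr (Or.inr ⟨e, he, hv⟩)
  · rintro (rfl | rfl | ⟨e, he, hv⟩)
    exacts [⟨_, Or.inl rfl, by simp⟩, ⟨_, Or.inl rfl, by simp⟩, ⟨e, Or.inr he, hv⟩]

lemma Matching.insert {N : Finset (Sym2 V)} (h : Matching N) {a b : V} (ha : a ∉ supp N)
    (hb : b ∉ supp N) : Matching (insert s(a, b) N) := by
  have key : ∀ f ∈ N, ∀ v, v ∈ s(a, b) → v ∉ f := by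
    intro f hf v hv hvf
    rcases Sym2.mem_iff.1 hv with rfl | rfl
    exacts [ha (mem_supp.2 ⟨f, hf, hvf⟩), hb (mem_supp.2 ⟨f, hf, hvf⟩)]
  intro e he f hf v hve hvf
  rcases Finset.mem_insert.1 he with rfl | he <;> rcases Finset.mem_insert.1 hf with rfl | hf
  · rfl
  · exact absurd hvf (key f hf v hve)
  · exact absurd hve (key e he v hvf)
  · exact h e he f hf v hve hvf

variable {E F₁ F₂ N : Finset (Sym2 V)} {c₁ c₂ : Sym2 V → ℕ} {R S : Finset V} {m μ : V → ℕ}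
  {c : ℕ}

lemma PrismPrecoloring.symm (h : PrismPrecoloring E F₁ F₂ c₁ c₂ R m) :
    PrismPrecoloring E F₂ F₁ c₂ c₁ R m :=
  ⟨h.not_isDiag, h.degree_le, h.degree_eq, h.subset₂, h.subset₁, h.lt₂, h.lt₁, h.lt, h.proper₂,
    h.proper₁, h.ne₂, h.ne₁⟩

lemma PrismExtends.symm (h : PrismExtends E F₁ F₂ c₁ c₂ R m) :
    PrismExtends E F₂ F₁ c₂ c₁ R m := by
  obtain ⟨C₁, C₂, μ, h1, h2, h3, h4, h5, h6, h7, h8, h9⟩ := h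
  exact ⟨C₂, C₁, μ, h2, h1, h3, h5, h4, fun e he v hv => (h6 e he v hv).symm, h8, h7, h9⟩

lemma PrismPrecoloring.side (h : PrismPrecoloring E F₁ F₂ c₁ c₂ R m) (hc : c < 5)
    (hNE : N ⊆ E) (hN : Matching N) (hF : ∀ f ∈ F₁, c₁ f = c → f ∈ N) (hS : S ⊆ supp N)
    (hne : ∀ f ∈ F₁ \ N, ∀ v ∈ S, v ∈ f → c₁ f ≠ μ v) :
    Precoloring (palette c) (E \ N) (F₁ \ N) c₁ S μ where
  card_palette := card_palette hc
  subset := Finset.sdiff_subset_sdiff h.subset₁ subset_rfl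
  not_isDiag := fun e he => h.not_isDiag e (Finset.mem_sdiff.1 he).1
  degree := by
    intro v
    have h1 := card_inc_sdiff hNE v
    have h2 := h.degree_le v
    split_ifs with hv
    · have := hN.card_inc (hS hv)
      omega
    · omega
  mem_palette := fun f hf => by
    obtain ⟨hf, hfN⟩ := Finset.mem_sdiff.1 hf
    exact mem_palette.2 ⟨fun h => hfN (hF f hf h), h.lt₁ f hf⟩
  proper := fun e he f hf => h.proper₁ e (by simp at he; exact he.1) f (by simp at hf; exact hf.1)
  ne := hne

/-- Putting together the main color and colorings of the two sides. -/
lemma PrismPrecoloring.glue (h : PrismPrecoloring E F₁ F₂ c₁ c₂ R m) (hc : c < 5)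
    (hN : Matching N) (hF₁ : ∀ f ∈ F₁, f ∈ N → c₁ f = c)
    (hF₂ : ∀ f ∈ F₂, f ∈ N → c₂ f = c) (hμ : ∀ v ∈ supp N, μ v ∈ palette c)
    (hR : ∀ v ∈ R, v ∈ supp N → μ v = m v) (hR' : ∀ v ∈ R, v ∉ supp N → m v = c)
    (h₁ : Extends (palette c) (E \ N) (F₁ \ N) c₁ (supp N) μ)
    (h₂ : Extends (palette c) (E \ N) (F₂ \ N) c₂ (supp N) μ) :
    PrismExtends E F₁ F₂ c₁ c₂ R m := by
  have side : ∀ (F : Finset (Sym2 V)) (d : Sym2 V → ℕ), (∀ f ∈ F, f ∈ N → d f = c) →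
      Extends (palette c) (E \ N) (F \ N) d (supp N) μ →
      ∃ C : Sym2 V → ℕ, (∀ e ∈ E, C e < 5) ∧ ProperOn (E : Set (Sym2 V)) C ∧
        (∀ e ∈ E, ∀ v ∈ e, C e ≠ if v ∈ supp N then μ v else c) ∧ ∀ f ∈ F, f ∈ E → C f = d f := by
    rintro F d hF ⟨C, hC, hp, hCF, hCS⟩
    have hC' : ∀ e ∈ E, e ∉ N → C e ∈ palette c :=
      fun e he heN => hC e (Finset.mem_sdiff.2 ⟨he, heN⟩)
    refine ⟨fun e => if e ∈ N then c else C e, ?_, ?_, ?_, ?_⟩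
    · intro e he
      by_cases heN : e ∈ N
      · simpa [heN] using hc
      · simpa [heN] using (mem_palette.1 (hC' e he heN)).2
    · intro e he f hf hef ⟨v, hve, hvf⟩
      simp only [Finset.mem_coe] at he hf
      by_cases heN : e ∈ N <;> by_cases hfN : f ∈ N
      · exact absurd (hN e heN f hfN v hve hvf) hef
      · simpa [heN, hfN] using (mem_palette.1 (hC' f hf hfN)).1.symm
      · simpa [heN, hfN] using (mem_palette.1 (hC' e he heN)).1
      · simpa [heN, hfN] using hp e (by simp [he, heN]) f (by simp [hf, hfN]) hef ⟨v, hve, hvf⟩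
    · intro e he v hve
      by_cases heN : e ∈ N
      · have hv : v ∈ supp N := mem_supp.2 ⟨e, heN, hve⟩
        simpa [heN, hv] using (mem_palette.1 (hμ v hv)).1.symm
      · by_cases hv : v ∈ supp N
        · simpa [heN, hv] using hCS v hv e (Finset.mem_sdiff.2 ⟨he, heN⟩) hve
        · simpa [heN, hv] using (mem_palette.1 (hC' e he heN)).1
    · intro f hf hfE
      by_cases hfN : f ∈ N
      · simpa [hfN] using (hF f hf hfN).symm
      · simpa [hfN] using hCF f (Finset.mem_sdiff.2 ⟨hf, hfN⟩)
  obtain ⟨C₁, a1, a2, a3, a4⟩ := side F₁ c₁ hF₁ h₁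
  obtain ⟨C₂, b1, b2, b3, b4⟩ := side F₂ c₂ hF₂ h₂
  refine ⟨C₁, C₂, fun v => if v ∈ supp N then μ v else c, a1, b1, ?_, a2, b2,
    fun e he v hv => ⟨a3 e he v hv, b3 e he v hv⟩, fun f hf => a4 f hf (h.subset₁ hf),
    fun f hf => b4 f hf (h.subset₂ hf), ?_⟩
  · intro v
    by_cases hv : v ∈ supp N
    · simpa [hv] using (mem_palette.1 (hμ v hv)).2
    · simpa [hv] using hc
  · intro v hv
    by_cases hvN : v ∈ supp N
    · simpa [hvN] using hR v hv hvN
    · simpa [hvN] using (hR' v hv hvN).symm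

lemma card_inc_sdiff_matching (hdeg : ∀ v, (inc E v).card ≤ 3) (hNE : N ⊆ E)
    (hN : Matching N) {v : V} (hv : v ∈ supp N) : (inc (E \ N) v).card ≤ 2 := by
  have h1 := card_inc_sdiff hNE v
  have h2 := hN.card_inc hv
  have h3 := hdeg v
  omega

/-- If only one side is precolored, it suffices to color that side. -/
lemma PrismPrecoloring.glue_symm (h : PrismPrecoloring E F₁ ∅ c₁ c₂ R m) (hc : c < 5)
    (hNE : N ⊆ E) (hN : Matching N) (hF₁ : ∀ f ∈ F₁, f ∈ N ↔ c₁ f = c)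
    (hR : ∀ v ∈ R, v ∈ supp N ↔ m v ≠ c)
    (hext : Precoloring (palette c) (E \ N) (F₁ \ N) c₁ (R ∩ supp N) m →
      Extends (palette c) (E \ N) (F₁ \ N) c₁ (R ∩ supp N) m) :
    PrismExtends E F₁ ∅ c₁ c₂ R m := by
  obtain ⟨C, hC, hp, hCF, hCS⟩ := hext <|
    h.side hc hNE hN (fun f hf => (hF₁ f hf).2) Finset.inter_subset_right
      (fun f hf v hv => h.ne₁ f (Finset.mem_sdiff.1 hf).1 v (Finset.mem_inter.1 hv).1)
  have hex : ∀ v, ∃ x, v ∈ supp N → x ∈ palette c ∧ (∀ e ∈ E \ N, v ∈ e → C e ≠ x) ∧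
      (v ∈ R → x = m v) := by
    intro v
    by_cases hv : v ∈ supp N
    · by_cases hvR : v ∈ R
      · exact ⟨m v, fun _ => ⟨mem_palette.2 ⟨(hR v hvR).1 hv, h.lt v hvR⟩,
          fun e he hve => hCS v (Finset.mem_inter.2 ⟨hvR, hv⟩) e he hve, fun _ => rfl⟩⟩
      · obtain ⟨x, hx, hxC⟩ : ∃ x ∈ palette c, x ∉ (inc (E \ N) v).image C := by
          by_contra! hcon
          have h1 := (Finset.card_le_card hcon).trans Finset.card_image_le
          have h2 := card_inc_sdiff_matching h.degree_le hNE hN hv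
          rw [card_palette hc] at h1
          omega
        exact ⟨x, fun _ => ⟨hx, fun e he hve heq =>
          hxC (Finset.mem_image.2 ⟨e, mem_inc.2 ⟨he, hve⟩, heq⟩), fun h => absurd h hvR⟩⟩
    · exact ⟨0, fun h => absurd h hv⟩
  choose μ hμ using hex
  refine h.glue (μ := μ) hc hN (fun f hf => (hF₁ f hf).1) (by simp)
    (fun v hv => (hμ v hv).1) (fun v hvR hv => (hμ v hv).2.2 hvR)
    (fun v hvR hv => by by_contra hcon; exact hv ((hR v hvR).2 hcon))
    ⟨C, hC, hp, hCF, fun v hv e he hve => (hμ v hv).2.1 e he hve⟩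
    ⟨C, hC, hp, by simp, fun v hv e he hve => (hμ v hv).2.1 e he hve⟩

/-- Some color is unused. -/
lemma exists_unused (F₁ F₂ : Finset (Sym2 V)) (c₁ c₂ : Sym2 V → ℕ) (R : Finset V) (m : V → ℕ)
    (h : F₁.card + F₂.card + R.card ≤ 4) :
    ∃ c < 5, (∀ f ∈ F₁, c₁ f ≠ c) ∧ (∀ f ∈ F₂, c₂ f ≠ c) ∧ ∀ v ∈ R, m v ≠ c := by
  obtain ⟨c, hc, hc'⟩ : ∃ c ∈ Finset.range 5, c ∉ F₁.image c₁ ∪ F₂.image c₂ ∪ R.image m := by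
    by_contra! hcon
    have h1 := Finset.card_le_card hcon
    have h2 := Finset.card_union_le (F₁.image c₁ ∪ F₂.image c₂) (R.image m)
    have h3 := Finset.card_union_le (F₁.image c₁) (F₂.image c₂)
    have h4 := Finset.card_image_le (s := F₁) (f := c₁)
    have h5 := Finset.card_image_le (s := F₂) (f := c₂)
    have h6 := Finset.card_image_le (s := R) (f := m)
    simp only [Finset.card_range] at h1
    omega
  simp only [Finset.mem_union, Finset.mem_image, not_or, not_exists, not_and] at hc'
  exact ⟨c, by simpa using hc, hc'.1.1, hc'.1.2, hc'.2⟩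

end Glue

section OneSidedCases

variable {V : Type*} [Fintype V] [DecidableEq V]

lemma exists_edge_avoiding {E : Finset (Sym2 V)} {v : V} {X : Finset V}
    (h : X.card < (inc E v).card) : ∃ w ∉ X, s(v, w) ∈ E := by
  by_contra! hcon
  have : inc E v ⊆ X.image (fun w => s(v, w)) := by
    intro e he
    obtain ⟨he, ⟨w, rfl⟩⟩ := mem_inc.1 he
    refine Finset.mem_image_of_mem _ ?_
    by_contra hw
    exact hcon w hw he
  have := (Finset.card_le_card this).trans Finset.card_image_le
  omega

lemma card_inc_le (F : Finset (Sym2 V)) (v : V) : (inc F v).card ≤ F.card :=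
  Finset.card_le_card (Finset.filter_subset _ _)

variable {E F : Finset (Sym2 V)} {c₁ c₂ : Sym2 V → ℕ} {R : Finset V} {m : V → ℕ}

lemma matching_color_class (hp : ProperOn (F : Set (Sym2 V)) c₁) (a : ℕ) :
    Matching (F.filter (c₁ · = a)) := by
  intro e he f hf v hve hvf
  rw [Finset.mem_filter] at he hf
  by_contra hef
  exact hp e he.1 f hf.1 hef ⟨v, hve, hvf⟩ (he.2.trans hf.2.symm)

/-- All joining edges have the same color. -/
lemma PrismPrecoloring.extends_of_forall_eq (h : PrismPrecoloring E F ∅ c₁ c₂ R m) {a : ℕ}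
    (ha : a < 5) (hR : ∀ v ∈ R, m v = a) (hF : (F.filter (c₁ · ≠ a)).card ≤ 3) :
    PrismExtends E F ∅ c₁ c₂ R m := by
  have hR' : ∀ v ∈ R, v ∉ supp (F.filter (c₁ · = a)) := by
    intro v hv hvs
    obtain ⟨f, hf, hvf⟩ := mem_supp.1 hvs
    rw [Finset.mem_filter] at hf
    exact h.ne₁ f hf.1 v hv hvf (hf.2.trans (hR v hv).symm)
  refine h.glue_symm (N := F.filter (c₁ · = a)) ha
    ((Finset.filter_subset _ _).trans h.subset₁) (matching_color_class h.proper₁ a)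
    (fun f hf => by simp [hf]) (fun v hv => by simp [hR' v hv, hR v hv]) ?_
  intro hpre
  refine hpre.extends_of_card_le_three ?_
  have h1 : R ∩ supp (F.filter (c₁ · = a)) = ∅ := by
    rw [Finset.eq_empty_iff_forall_notMem]
    intro v hv
    exact hR' v (Finset.mem_inter.1 hv).1 (Finset.mem_inter.1 hv).2
  have h2 : F \ F.filter (c₁ · = a) = F.filter (c₁ · ≠ a) := by
    ext f
    simp only [Finset.mem_sdiff, Finset.mem_filter]
    tauto
  rw [h1, h2]
  simpa using hF

/-- Two joining edges of different colors: trying the color of the first one as main color. -/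
lemma PrismPrecoloring.extends_pair_of_main {u v : V}
    (h : PrismPrecoloring E F ∅ c₁ c₂ {u, v} m) (huv : u ≠ v) (hm : m u ≠ m v)
    (hF : F.card ≤ 2) (hv : v ∈ supp (F.filter (c₁ · = m u)) ∨
      ∃ w, s(v, w) ∈ E ∧ w ≠ u ∧ w ∉ supp (F.filter (c₁ · = m u)) ∧ s(v, w) ∉ F) :
    PrismExtends E F ∅ c₁ c₂ {u, v} m := by
  have hu : u ∉ supp (F.filter (c₁ · = m u)) := by
    intro hus
    obtain ⟨f, hf, hvf⟩ := mem_supp.1 hus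
    rw [Finset.mem_filter] at hf
    exact h.ne₁ f hf.1 u (by simp) hvf hf.2
  have hM := matching_color_class h.proper₁ (m u)
  have hME := (Finset.filter_subset (c₁ · = m u) F).trans h.subset₁
  by_cases hvs : v ∈ supp (F.filter (c₁ · = m u))
  · refine h.glue_symm (h.lt u (by simp)) hME hM (fun f hf => by simp [hf]) ?_ ?_
    · intro w hw
      rcases Finset.mem_insert.1 hw with rfl | hw
      · simp [hu]
      · rw [Finset.mem_singleton] at hw
        subst hw
        simp [hvs, hm.symm]
    · intro hpre
      refine hpre.extends_of_card_le_three ?_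
      have h1 : {u, v} ∩ supp (F.filter (c₁ · = m u)) ⊆ {v} := by
        intro w hw
        simp only [Finset.mem_inter, Finset.mem_insert, Finset.mem_singleton] at hw ⊢
        rcases hw.1 with rfl | rfl
        · exact absurd hw.2 hu
        · rfl
      have := Finset.card_le_card h1
      have := Finset.card_le_card (Finset.sdiff_subset (s := F) (t := F.filter (c₁ · = m u)))
      simp only [Finset.card_singleton] at *
      omega
  · obtain ⟨w, hw, hwu, hws, hwF⟩ := hv.resolve_left hvs
    have hu' : u ∉ supp (insert s(v, w) (F.filter (c₁ · = m u))) := by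
      rw [mem_supp_insert]
      simp [huv, hwu.symm, hu]
    refine h.glue_symm (N := insert s(v, w) (F.filter (c₁ · = m u))) (h.lt u (by simp))
      (Finset.insert_subset hw hME) (hM.insert hvs hws) ?_ ?_ ?_
    · intro f hf
      have : f ≠ s(v, w) := fun h => hwF (h ▸ hf)
      simp [hf, this]
    · intro x hx
      rcases Finset.mem_insert.1 hx with rfl | hx
      · simp [hu']
      · rw [Finset.mem_singleton] at hx
        subst hx
        simp [mem_supp_insert, hm.symm]
    · intro hpre
      refine hpre.extends_of_card_le_three ?_
      have h1 : {u, v} ∩ supp (insert s(v, w) (F.filter (c₁ · = m u))) ⊆ {v} := by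
        intro x hx
        simp only [Finset.mem_inter, Finset.mem_insert, Finset.mem_singleton] at hx ⊢
        rcases hx.1 with rfl | rfl
        · exact absurd hx.2 hu'
        · rfl
      have := Finset.card_le_card h1
      have := Finset.card_le_card
        (Finset.sdiff_subset (s := F) (t := insert s(v, w) (F.filter (c₁ · = m u))))
      simp only [Finset.card_singleton] at *
      omega

/-- When neither choice of main color works, the precolored edges have a very special position. -/
lemma PrismPrecoloring.exists_color_of_stuck {u v : V}
    (h : PrismPrecoloring E F ∅ c₁ c₂ {u, v} m) (huv : u ≠ v) (hF : F.card ≤ 2)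
    (hv : ∀ w, s(v, w) ∈ E → w ≠ u → w ∉ supp (F.filter (c₁ · = m u)) → s(v, w) ∈ F)
    (hu : ∀ w, s(u, w) ∈ E → w ≠ v → w ∉ supp (F.filter (c₁ · = m v)) → s(u, w) ∈ F) :
    ∃ f ∈ F, c₁ f = m u := by
  by_contra! hcon
  have hemp : F.filter (c₁ · = m u) = ∅ := Finset.filter_eq_empty_iff.2 (by simpa using hcon)
  rw [hemp] at hv
  have h1 : (inc E v).erase s(u, v) ⊆ inc F v := by
    intro e he
    obtain ⟨hne, he⟩ := Finset.mem_erase.1 he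
    obtain ⟨he, ⟨w, rfl⟩⟩ := mem_inc.1 he
    refine mem_inc.2 ⟨hv w he ?_ (by simp [supp_empty]), by simp⟩
    rintro rfl
    exact hne Sym2.eq_swap
  have h2 := h.degree_eq v (by simp)
  have h3 := Finset.card_le_card h1
  have h4 := Finset.pred_card_le_card_erase (s := inc E v) (a := s(u, v))
  have h5 : inc F v = F := Finset.eq_of_subset_of_card_le (Finset.filter_subset _ _) (by omega)
  have h6 := Finset.eq_of_subset_of_card_le h1 (by rw [h5]; omega)
  have hall : ∀ f ∈ F, v ∈ f ∧ u ∉ f := by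
    intro f hf
    have hvf : v ∈ f := by
      rw [← h5] at hf
      exact (mem_inc.1 hf).2
    refine ⟨hvf, fun huf => ?_⟩
    have := (Sym2.mem_and_mem_iff huv).1 ⟨huf, hvf⟩
    rw [← h5, ← h6] at hf
    exact (Finset.mem_erase.1 hf).1 this
  have hemp' : F.filter (c₁ · = m v) = ∅ :=
    Finset.filter_eq_empty_iff.2 (fun f hf => h.ne₁ f hf v (by simp) (hall f hf).1)
  obtain ⟨w, hw, hwE⟩ := exists_edge_avoiding (E := E) (v := u) (X := {v})
    (by rw [h.degree_eq u (by simp)]; simp)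
  have := hu w hwE (by simpa using hw) (by simp [hemp', supp_empty])
  exact (hall _ this).2 (by simp)

lemma PrismPrecoloring.mem_of_stuck {u v : V}
    (h : PrismPrecoloring E F ∅ c₁ c₂ {u, v} m) {f : Sym2 V}
    (hf : F.filter (c₁ · = m u) = {f}) (hFv : ∀ g ∈ F, v ∉ g)
    (hv : ∀ w, s(v, w) ∈ E → w ≠ u → w ∉ supp (F.filter (c₁ · = m u)) → s(v, w) ∈ F) :
    s(v, u) ∈ E ∧ ∀ w ∈ f, s(v, w) ∈ E := by
  have hfF : f ∈ F := by
    have : f ∈ F.filter (c₁ · = m u) := by simp [hf]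
    exact (Finset.mem_filter.1 this).1
  have hd := h.not_isDiag f (h.subset₁ hfF)
  have hcard := card_filter_mem f hd
  have hsub : inc E v ⊆ (insert u (Finset.univ.filter (· ∈ f))).image (fun w => s(v, w)) := by
    intro e he
    obtain ⟨he, ⟨w, rfl⟩⟩ := mem_inc.1 he
    refine Finset.mem_image_of_mem _ ?_
    rw [Finset.mem_insert, Finset.mem_filter]
    by_contra! hcon
    have hwf := hcon.2 (by simp)
    refine hFv _ (hv w he hcon.1 ?_) (by simp : v ∈ s(v, w))
    rw [hf, mem_supp]
    simpa using hwf
  have h1 := h.degree_eq v (by simp)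
  have h2 := Finset.card_insert_le u (Finset.univ.filter (· ∈ f))
  have h3 := Finset.card_image_le (s := insert u (Finset.univ.filter (· ∈ f)))
    (f := fun w => s(v, w))
  have heq := Finset.eq_of_subset_of_card_le hsub (by omega)
  have key : ∀ w ∈ insert u (Finset.univ.filter (· ∈ f)), s(v, w) ∈ E := by
    intro w hw
    have := Finset.mem_image_of_mem (fun w => s(v, w)) hw
    rw [← heq] at this
    exact (mem_inc.1 this).1
  exact ⟨key u (by simp), fun w hw => key w (by simp [hw])⟩

/-- Two joining edges of different colors. -/
lemma PrismPrecoloring.extends_pair {u v : V}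
    (h : PrismPrecoloring E F ∅ c₁ c₂ {u, v} m) (huv : u ≠ v) (hm : m u ≠ m v)
    (hF : F.card ≤ 2) : PrismExtends E F ∅ c₁ c₂ {u, v} m := by
  by_contra hE
  have h' : PrismPrecoloring E F ∅ c₁ c₂ {v, u} m := Finset.pair_comm u v ▸ h
  have hv : ∀ w, s(v, w) ∈ E → w ≠ u → w ∉ supp (F.filter (c₁ · = m u)) → s(v, w) ∈ F := by
    intro w h1 h2 h3
    by_contra h4
    exact hE (h.extends_pair_of_main huv hm hF (Or.inr ⟨w, h1, h2, h3, h4⟩))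
  have hu : ∀ w, s(u, w) ∈ E → w ≠ v → w ∉ supp (F.filter (c₁ · = m v)) → s(u, w) ∈ F := by
    intro w h1 h2 h3
    by_contra h4
    apply hE
    rw [Finset.pair_comm]
    exact h'.extends_pair_of_main huv.symm hm.symm hF (Or.inr ⟨w, h1, h2, h3, h4⟩)
  have hvs : v ∉ supp (F.filter (c₁ · = m u)) :=
    fun hcon => hE (h.extends_pair_of_main huv hm hF (Or.inl hcon))
  have hus : u ∉ supp (F.filter (c₁ · = m v)) := by
    intro hcon
    apply hE
    rw [Finset.pair_comm]
    exact h'.extends_pair_of_main huv.symm hm.symm hF (Or.inl hcon)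
  obtain ⟨f, hf, hfa⟩ := h.exists_color_of_stuck huv hF hv hu
  obtain ⟨g, hg, hgb⟩ := h'.exists_color_of_stuck huv.symm hF hu hv
  have hfg : f ≠ g := by
    rintro rfl
    exact hm (hfa.symm.trans hgb)
  have hFfg : F = {f, g} := by
    symm
    apply Finset.eq_of_subset_of_card_le
    · intro e he
      rcases Finset.mem_insert.1 he with rfl | he
      · exact hf
      · rwa [Finset.mem_singleton.1 he]
    · rwa [Finset.card_pair hfg]
  have hvf : v ∉ f := fun hcon => hvs (mem_supp.2 ⟨f, by simp [hf, hfa], hcon⟩)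
  have huf : u ∉ f := fun hcon => h.ne₁ f hf u (by simp) hcon hfa
  have hug : u ∉ g := fun hcon => hus (mem_supp.2 ⟨g, by simp [hg, hgb], hcon⟩)
  have hvg : v ∉ g := fun hcon => h.ne₁ g hg v (by simp) hcon hgb
  have hFu : ∀ e ∈ F, u ∉ e := by simp [hFfg, huf, hug]
  have hFv : ∀ e ∈ F, v ∉ e := by simp [hFfg, hvf, hvg]
  have hfa' : F.filter (c₁ · = m u) = {f} := by
    rw [hFfg, Finset.filter_insert, if_pos hfa, Finset.filter_singleton,
      if_neg (by rw [hgb]; exact hm.symm)]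
    rfl
  have hgb' : F.filter (c₁ · = m v) = {g} := by
    rw [hFfg, Finset.filter_insert, if_neg (by rw [hfa]; exact hm), Finset.filter_singleton,
      if_pos hgb]
  obtain ⟨hvu, hvadj⟩ := h.mem_of_stuck hfa' hFv hv
  obtain ⟨-, huadj⟩ := h'.mem_of_stuck hgb' hFu hu
  have hdisj : ∀ x, x ∈ f → x ∉ g := by
    intro x hxf hxg
    have hxu : x ≠ u := fun h => huf (h ▸ hxf)
    have hxv : x ≠ v := fun h => hvf (h ▸ hxf)
    have hsub : ({f, g, s(v, x), s(u, x)} : Finset (Sym2 V)) ⊆ inc E x := by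
      intro e he
      simp only [Finset.mem_insert, Finset.mem_singleton] at he
      rcases he with rfl | rfl | rfl | rfl
      · exact mem_inc.2 ⟨h.subset₁ hf, hxf⟩
      · exact mem_inc.2 ⟨h.subset₁ hg, hxg⟩
      · exact mem_inc.2 ⟨hvadj x hxf, by simp⟩
      · exact mem_inc.2 ⟨huadj x hxg, by simp⟩
    have h1 := Finset.card_le_card hsub
    have h2 := h.degree_le x
    have e1 : f ≠ s(v, x) := fun h => hvf (by simp [h])
    have e2 : f ≠ s(u, x) := fun h => huf (by simp [h])
    have e3 : g ≠ s(v, x) := fun h => hvg (by simp [h])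
    have e4 : g ≠ s(u, x) := fun h => hug (by simp [h])
    have e5 : s(v, x) ≠ s(u, x) := by
      intro h
      have : v ∈ s(u, x) := h ▸ Sym2.mem_mk_left v x
      rcases Sym2.mem_iff.1 this with h | h
      exacts [huv h.symm, hxv h.symm]
    rw [Finset.card_insert_of_notMem (by simp [hfg, e1, e2]),
      Finset.card_insert_of_notMem (by simp [e3, e4]), Finset.card_pair e5] at h1
    omega
  obtain ⟨c, hc, hcF, -, hcR⟩ := exists_unused F ∅ c₁ c₂ {u, v} m (by
    rw [Finset.card_pair huv]
    simp
    omega)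
  have hM : Matching (insert s(u, v) (∅ : Finset (Sym2 V))) :=
    matching_empty.insert (by simp [supp_empty]) (by simp [supp_empty])
  apply hE
  refine h.glue_symm (N := insert s(u, v) ∅) hc (by simpa [Sym2.eq_swap] using hvu) hM ?_ ?_ ?_
  · intro e he
    have : e ≠ s(u, v) := fun h => hFu e he (by simp [h])
    simp [this, hcF e he]
  · intro x hx
    have hxs : x ∈ supp (insert s(u, v) (∅ : Finset (Sym2 V))) := by
      rw [mem_supp_insert]
      simp only [Finset.mem_insert, Finset.mem_singleton] at hx
      tauto
    exact iff_of_true hxs (hcR x hx)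
  · intro hpre
    refine hpre.extends_of_card_forb_le_one fun x _ => ?_
    refine (card_forb_le x).trans ?_
    by_cases hx : x ∈ ({u, v} : Finset V)
    · have : inc (F \ insert s(u, v) ∅) x = ∅ := by
        rw [Finset.eq_empty_iff_forall_notMem]
        intro e he
        obtain ⟨he, hxe⟩ := mem_inc.1 he
        have heF := (Finset.mem_sdiff.1 he).1
        simp only [Finset.mem_insert, Finset.mem_singleton] at hx
        rcases hx with rfl | rfl
        exacts [hFu e heF hxe, hFv e heF hxe]
      rw [this]
      split_ifs <;> simp
    · rw [if_neg (fun hcon => hx (Finset.mem_inter.1 hcon).1), add_zero, Finset.card_le_one]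
      intro e he e' he'
      obtain ⟨he, hxe⟩ := mem_inc.1 he
      obtain ⟨he', hxe'⟩ := mem_inc.1 he'
      have heF := (Finset.mem_sdiff.1 he).1
      have heF' := (Finset.mem_sdiff.1 he').1
      rw [hFfg] at heF heF'
      simp only [Finset.mem_insert, Finset.mem_singleton] at heF heF'
      rcases heF with rfl | rfl <;> rcases heF' with rfl | rfl
      · rfl
      · exact absurd hxe' (hdisj x hxe)
      · exact absurd hxe (hdisj x hxe')
      · rfl

end OneSidedCases

section Covering

variable {V : Type*} [Fintype V] [DecidableEq V]
variable {E F N : Finset (Sym2 V)} {c₁ c₂ : Sym2 V → ℕ} {R : Finset V} {m : V → ℕ}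

/-- A main color that is not used, and a matching covering the joining edges. -/
lemma PrismPrecoloring.glue_of_covering (h : PrismPrecoloring E F ∅ c₁ c₂ R m) {c : ℕ}
    (hc : c < 5) (hcF : ∀ f ∈ F, c₁ f ≠ c) (hcR : ∀ v ∈ R, m v ≠ c) (hNE : N ⊆ E \ F)
    (hN : Matching N) (hRN : R ⊆ supp N)
    (hext : Precoloring (palette c) (E \ N) F c₁ R m → Extends (palette c) (E \ N) F c₁ R m) :
    PrismExtends E F ∅ c₁ c₂ R m := by
  have hFN : ∀ f ∈ F, f ∉ N := fun f hf hfN => (Finset.mem_sdiff.1 (hNE hfN)).2 hf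
  refine h.glue_symm hc (hNE.trans Finset.sdiff_subset) hN
    (fun f hf => by simp [hFN f hf, hcF f hf]) (fun v hv => by simp [hRN hv, hcR v hv]) ?_
  rw [Finset.inter_eq_left.2 hRN, Finset.sdiff_eq_self_of_disjoint (Finset.disjoint_left.2 hFN)]
  exact hext

lemma matching_pair {a b x y : V} (hax : a ≠ x) (hay : a ≠ y) (hbx : b ≠ x) (hby : b ≠ y) :
    Matching ({s(a, b), s(x, y)} : Finset (Sym2 V)) := by
  have h : Matching (insert s(x, y) (∅ : Finset (Sym2 V))) :=
    matching_empty.insert (by simp [supp_empty]) (by simp [supp_empty])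
  exact h.insert (by rw [mem_supp_insert]; simp [supp_empty, hax, hay])
    (by rw [mem_supp_insert]; simp [supp_empty, hbx, hby])

lemma mem_supp_pair {a b x y v : V} : v ∈ supp ({s(a, b), s(x, y)} : Finset (Sym2 V)) ↔
    v = a ∨ v = b ∨ v = x ∨ v = y := by
  rw [mem_supp_insert, ← LawfulSingleton.insert_empty_eq, mem_supp_insert]
  simp [supp_empty]

/-- A matching given by an injective choice of partners. -/
lemma exists_matching_of_injOn {σ : V → V} (hσ : Set.InjOn σ R) (hR : ∀ v ∈ R, σ v ∉ R)
    (hE : ∀ v ∈ R, s(v, σ v) ∈ E) : ∃ N ⊆ E, Matching N ∧ R ⊆ supp N := by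
  refine ⟨R.image fun v => s(v, σ v), ?_, ?_, ?_⟩
  · intro e he
    obtain ⟨v, hv, rfl⟩ := Finset.mem_image.1 he
    exact hE v hv
  · intro e he f hf w hwe hwf
    obtain ⟨v, hv, rfl⟩ := Finset.mem_image.1 he
    obtain ⟨v', hv', rfl⟩ := Finset.mem_image.1 hf
    suffices v = v' by rw [this]
    rcases Sym2.mem_iff.1 hwe with h1 | h1 <;> rcases Sym2.mem_iff.1 hwf with h2 | h2
    · exact h1.symm.trans h2
    · exact absurd (h2 ▸ h1 ▸ hv) (hR v' hv')
    · exact absurd (h1 ▸ h2 ▸ hv') (hR v hv)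
    · exact hσ hv hv' (h1.symm.trans h2)
  · intro v hv
    exact mem_supp.2 ⟨s(v, σ v), Finset.mem_image_of_mem _ hv, by simp⟩

/-- An independent set of vertices of full degree in a graph of maximum degree three is covered
by a matching. -/
lemma exists_matching_of_independent (hd : ∀ v, (inc E v).card ≤ 3)
    (hR : ∀ v ∈ R, (inc E v).card = 3) (hind : ∀ u ∈ R, ∀ v ∈ R, s(u, v) ∉ E) :
    ∃ N ⊆ E, Matching N ∧ R ⊆ supp N := by
  let t : R → Finset V := fun v => Finset.univ.filter fun w => s(v.1, w) ∈ E
  have ht : ∀ v, (inc E v.1).card ≤ (t v).card := by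
    intro v
    have hsub : inc E v.1 ⊆ (t v).image fun w => s(v.1, w) := by
      intro e he
      obtain ⟨he, ⟨w, rfl⟩⟩ := mem_inc.1 he
      exact Finset.mem_image_of_mem _ (by simpa [t] using he)
    exact (Finset.card_le_card hsub).trans Finset.card_image_le
  have hall : ∀ s : Finset R, s.card ≤ (s.biUnion t).card := by
    intro s
    have h1 := Finset.sum_card_bipartiteAbove_eq_sum_card_bipartiteBelow (s := s)
      (t := s.biUnion t) (fun v w => s(v.1, w) ∈ E)
    have h2 : ∑ v ∈ s, 3 ≤ ∑ v ∈ s, ((s.biUnion t).bipartiteAbove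
        (fun (v : R) w => s(v.1, w) ∈ E) v).card := by
      refine Finset.sum_le_sum fun v hv => ?_
      rw [← hR v.1 v.2]
      refine (ht v).trans (Finset.card_le_card fun w hw => ?_)
      simp only [Finset.mem_bipartiteAbove, Finset.mem_biUnion]
      exact ⟨⟨v, hv, hw⟩, by simpa [t] using hw⟩
    have h3 : ∑ w ∈ s.biUnion t, (s.bipartiteBelow (fun (v : R) w => s(v.1, w) ∈ E) w).card ≤
        ∑ w ∈ s.biUnion t, 3 := by
      refine Finset.sum_le_sum fun w _ => le_trans ?_ (hd w)
      refine Finset.card_le_card_of_injOn (fun v => s(v.1, w)) ?_ ?_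
      · intro v hv
        simp only [Finset.coe_bipartiteBelow, Set.mem_ofPred_eq] at hv
        exact mem_inc.2 ⟨hv.2, by simp⟩
      · intro v _ v' _ heq
        replace heq : s(v.1, w) = s(v'.1, w) := heq
        have : v.1 ∈ s(v'.1, w) := heq ▸ Sym2.mem_mk_left _ _
        rcases Sym2.mem_iff.1 this with h | h
        · exact Subtype.ext h
        · have : v'.1 ∈ s(v.1, w) := heq.symm ▸ Sym2.mem_mk_left _ _
          rcases Sym2.mem_iff.1 this with h' | h'
          · exact Subtype.ext h'.symm
          · exact Subtype.ext (h.trans h'.symm)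
    simp only [Finset.sum_const, smul_eq_mul] at h2 h3
    omega
  obtain ⟨τ, hinj, hτ⟩ := (Finset.all_card_le_biUnion_card_iff_exists_injective t).1 hall
  have hτ' : ∀ v : R, s(v.1, τ v) ∈ E := fun v => by simpa [t] using hτ v
  let σ : V → V := fun v => if hv : v ∈ R then τ ⟨v, hv⟩ else v
  have hσ : ∀ v (hv : v ∈ R), σ v = τ ⟨v, hv⟩ := fun v hv => by simp [σ, hv]
  refine exists_matching_of_injOn (σ := σ) ?_ ?_ ?_
  · intro v hv w hw heq
    rw [hσ v hv, hσ w hw] at heq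
    exact congrArg Subtype.val (hinj heq)
  · intro v hv hcon
    have := hτ' ⟨v, hv⟩
    rw [← hσ v hv] at this
    exact hind v hv _ hcon this
  · intro v hv
    have := hτ' ⟨v, hv⟩
    rwa [← hσ v hv] at this

lemma exists_matching_of_edge {u v x y : V} (hE : ∀ e ∈ E, ¬ e.IsDiag) (hx : (inc E x).card = 3)
    (hy : (inc E y).card = 3) (hux : u ≠ x) (huy : u ≠ y) (hvx : v ≠ x) (hvy : v ≠ y)
    (hxy : x ≠ y) (huv : s(u, v) ∈ E) :
    ∃ N ⊆ E, Matching N ∧ ({u, v, x, y} : Finset V) ⊆ supp N := by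
  have huv' := ne_of_not_isDiag (hE _ huv)
  by_cases hxyE : s(x, y) ∈ E
  · refine ⟨{s(u, v), s(x, y)}, ?_, matching_pair hux huy hvx hvy, ?_⟩
    · intro e he
      simp only [Finset.mem_insert, Finset.mem_singleton] at he
      rcases he with rfl | rfl <;> assumption
    · intro w hw
      simpa [mem_supp_pair] using hw
  have three : ∀ x' y', s(x, x') ∈ E → s(y, y') ∈ E → x' ≠ y' → x' ∉ ({u, v} : Finset V) →
      y' ∉ ({u, v} : Finset V) →
      ∃ N ⊆ E, Matching N ∧ ({u, v, x, y} : Finset V) ⊆ supp N := by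
    intro x' y' hx' hy' hne hxuv hyuv
    simp only [Finset.mem_insert, Finset.mem_singleton, not_or] at hxuv hyuv
    have hxx' := ne_of_not_isDiag (hE _ hx')
    have hyy' := ne_of_not_isDiag (hE _ hy')
    have hxy' : x ≠ y' := by
      rintro rfl
      exact hxyE (by rwa [Sym2.eq_swap])
    have hyx' : y ≠ x' := by
      rintro rfl
      exact hxyE hx'
    refine ⟨insert s(u, v) {s(x, x'), s(y, y')}, ?_, ?_, ?_⟩
    · intro e he
      simp only [Finset.mem_insert, Finset.mem_singleton] at he
      rcases he with rfl | rfl | rfl <;> assumption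
    · refine (matching_pair hxy hxy' hyx'.symm hne).insert ?_ ?_
      · rw [mem_supp_pair]
        simp [hux, huy, Ne.symm hxuv.1, Ne.symm hyuv.1]
      · rw [mem_supp_pair]
        simp [hvx, hvy, Ne.symm hxuv.2, Ne.symm hyuv.2]
    · intro w hw
      rw [mem_supp_insert, mem_supp_pair]
      simp only [Finset.mem_insert, Finset.mem_singleton] at hw
      tauto
  have huv2 : ({u, v} : Finset V).card = 2 := Finset.card_pair huv'
  by_cases h1 : ∃ w ∉ ({u, v} : Finset V), ∃ w' ∉ ({u, v} : Finset V), s(x, w) ∈ E ∧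
      s(x, w') ∈ E ∧ w ≠ w'
  · obtain ⟨w, hw, w', hw', hwE, hwE', hne⟩ := h1
    obtain ⟨y', hy', hyE⟩ := exists_edge_avoiding (E := E) (v := y) (X := {u, v}) (by omega)
    by_cases hwy : w = y'
    · exact three w' y' hwE' hyE (fun h => hne (hwy.trans h.symm)) hw' hy'
    · exact three w y' hwE hyE hwy hw hy'
  by_cases h2 : ∃ w ∉ ({u, v} : Finset V), ∃ w' ∉ ({u, v} : Finset V), s(y, w) ∈ E ∧
      s(y, w') ∈ E ∧ w ≠ w'
  · obtain ⟨w, hw, w', hw', hwE, hwE', hne⟩ := h2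
    obtain ⟨x', hx', hxE⟩ := exists_edge_avoiding (E := E) (v := x) (X := {u, v}) (by omega)
    by_cases hwx : x' = w
    · exact three x' w' hxE hwE' (fun h => hne (hwx.symm.trans h)) hx' hw'
    · exact three x' w hxE hwE hwx hx' hw
  have adj : ∀ z, (inc E z).card = 3 → (¬ ∃ w ∉ ({u, v} : Finset V), ∃ w' ∉ ({u, v} : Finset V),
      s(z, w) ∈ E ∧ s(z, w') ∈ E ∧ w ≠ w') → s(z, u) ∈ E ∧ s(z, v) ∈ E := by
    intro z hz hcon
    obtain ⟨w, hw, hwE⟩ := exists_edge_avoiding (E := E) (v := z) (X := {u, v}) (by omega)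
    have key : ∀ a b : V, ({u, v} : Finset V) = {a, b} → s(z, b) ∈ E := by
      intro a b hab
      obtain ⟨w', hw', hwE'⟩ := exists_edge_avoiding (E := E) (v := z) (X := {a, w})
        (by have := Finset.card_le_two (a := a) (b := w); omega)
      by_cases hb : w' = b
      · rwa [← hb]
      · exfalso
        simp only [Finset.mem_insert, Finset.mem_singleton, not_or] at hw'
        exact hcon ⟨w, hw, w', by rw [hab]; simp [hw', hb], hwE, hwE', Ne.symm hw'.2⟩
    exact ⟨key v u (Finset.pair_comm u v), key u v rfl⟩
  obtain ⟨hxu, -⟩ := adj x hx h1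
  obtain ⟨-, hyv⟩ := adj y hy h2
  refine ⟨{s(x, u), s(y, v)}, ?_, matching_pair hxy hvx.symm huy huv', ?_⟩
  · intro e he
    simp only [Finset.mem_insert, Finset.mem_singleton] at he
    rcases he with rfl | rfl <;> assumption
  · intro w hw
    rw [mem_supp_pair]
    simp only [Finset.mem_insert, Finset.mem_singleton] at hw
    tauto

/-- Four joining edges. -/
lemma PrismPrecoloring.extends_of_card_eq_four (h : PrismPrecoloring E ∅ ∅ c₁ c₂ R m)
    (hR : R.card = 4) : PrismExtends E ∅ ∅ c₁ c₂ R m := by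
  obtain ⟨c, hc, -, -, hcR⟩ := exists_unused ∅ ∅ c₁ c₂ R m (by simp [hR])
  obtain ⟨N, hNE, hN, hRN⟩ : ∃ N ⊆ E, Matching N ∧ R ⊆ supp N := by
    by_cases hind : ∀ u ∈ R, ∀ v ∈ R, s(u, v) ∉ E
    · exact exists_matching_of_independent h.degree_le h.degree_eq hind
    · push Not at hind
      obtain ⟨u, hu, v, hv, huv⟩ := hind
      have hne := ne_of_not_isDiag (h.not_isDiag _ huv)
      have hcard : ((R.erase u).erase v).card = 2 := by
        rw [Finset.card_erase_of_mem (Finset.mem_erase.2 ⟨hne.symm, hv⟩),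
          Finset.card_erase_of_mem hu, hR]
      obtain ⟨x, y, hxy, hs⟩ := Finset.card_eq_two.1 hcard
      have hx : x ∈ (R.erase u).erase v := by simp [hs]
      have hy : y ∈ (R.erase u).erase v := by simp [hs]
      simp only [Finset.mem_erase] at hx hy
      obtain ⟨N, h1, h2, h3⟩ := exists_matching_of_edge h.not_isDiag (h.degree_eq x hx.2.2)
        (h.degree_eq y hy.2.2) (Ne.symm hx.2.1) (Ne.symm hy.2.1) (Ne.symm hx.1) (Ne.symm hy.1)
        hxy huv
      refine ⟨N, h1, h2, fun w hw => h3 ?_⟩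
      by_cases hwu : w = u
      · simp [hwu]
      by_cases hwv : w = v
      · simp [hwv]
      have : w ∈ (R.erase u).erase v := by simp [hwu, hwv, hw]
      rw [hs] at this
      simp only [Finset.mem_insert, Finset.mem_singleton] at this ⊢
      tauto
  refine h.glue_of_covering hc (by simp) hcR (by simpa using hNE) hN hRN fun hpre => ?_
  refine hpre.extends_of_card_forb_le_one fun v _ => (card_forb_le v).trans ?_
  have : inc (∅ : Finset (Sym2 V)) v = ∅ := by simp [inc]
  rw [this]
  split_ifs <;> simp

/-- The obstruction with at most one precolored edge does not occur if three joining edges are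
covered suitably. -/
lemma Precoloring.extends_of_card_eq_three {P : Finset ℕ} {c₀ : Sym2 V → ℕ}
    (hpre : Precoloring P (E \ N) F c₀ R m) (hF : F.card ≤ 1) (hR : R.card = 3)
    (hd : ∀ e ∈ E, ¬ e.IsDiag) (hNE : N ⊆ E)
    (hN : (∃ e ∈ N, ∀ v ∈ e, v ∈ R) ∨ ∀ e ∈ E \ F, ¬ ∀ v ∈ e, v ∈ R) :
    Extends P (E \ N) F c₀ R m := by
  by_contra hE
  obtain ⟨f, K, hFf, hK, ⟨k, hk⟩, hKR, hfK, hcard, -⟩ := hpre.obstruction hF hE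
  have hKR' : ∀ e ∈ K, ∀ v ∈ e, v ∈ R := fun e he v hv => hKR (mem_supp.2 ⟨e, he, hv⟩)
  have hKE : ∀ e ∈ K, e ∈ E ∧ e ∉ N ∧ e ∉ F := by
    intro e he
    have := hK he
    simp only [Finset.mem_sdiff] at this
    exact ⟨this.1.1, this.1.2, this.2⟩
  rcases hN with ⟨g, hg, hgR⟩ | hN
  · have hfF : f ∈ F := by simp [hFf]
    have hfA := hpre.subset hfF
    rw [Finset.mem_sdiff] at hfA
    have hfKn : f ∉ K := fun h => (hKE f h).2.2 hfF
    have hgKn : g ∉ insert f K := by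
      rw [Finset.mem_insert]
      rintro (rfl | h)
      exacts [hfA.2 hg, (hKE g h).2.1 hg]
    have h1 : insert f K ⊆ (supp K).offDiag.image (fun p => s(p.1, p.2)) := by
      intro e he
      rcases Finset.mem_insert.1 he with rfl | he
      · exact mem_offDiag_image (hd _ hfA.1) hfK
      · exact mem_offDiag_image (hd _ (hKE e he).1) (fun v hv => mem_supp.2 ⟨e, he, hv⟩)
    have h2 : insert g (insert f K) ⊆ R.offDiag.image (fun p => s(p.1, p.2)) := by
      intro e he
      rcases Finset.mem_insert.1 he with rfl | he
      · exact mem_offDiag_image (hd _ (hNE hg)) hgR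
      · refine Finset.image_mono _ (Finset.offDiag_mono hKR) (h1 he)
    have h3 := Finset.card_le_card h1
    have h4 := Finset.card_le_card h2
    rw [Finset.card_insert_of_notMem hgKn] at h4
    rw [Finset.card_insert_of_notMem hfKn, card_offDiag_image] at h3 h4
    rw [hR] at h4
    have h5 := Finset.card_le_card hKR
    have h6 := Finset.card_pos.2 ⟨k, hk⟩
    have e3 : Nat.choose 3 2 = 3 := rfl
    have e2 : Nat.choose 2 2 = 1 := rfl
    have h7 : (supp K).card = 2 := by omega
    rw [h7] at h3
    omega
  · exact hN k (Finset.mem_sdiff.2 ⟨(hKE k hk).1, (hKE k hk).2.2⟩) (hKR' k hk)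

lemma exists_matching_triple {R : Finset V} (hR : R.card = 3) (hd : ∀ e ∈ E, ¬ e.IsDiag)
    (hdeg : ∀ v ∈ R, (inc E v).card = 3) (hFE : F ⊆ E) (hF : F.card ≤ 1) :
    ∃ N ⊆ E \ F, Matching N ∧ R ⊆ supp N ∧
      ((∃ e ∈ N, ∀ v ∈ e, v ∈ R) ∨ ∀ e ∈ E \ F, ¬ ∀ v ∈ e, v ∈ R) := by
  have hdF : ∀ v ∈ R, (inc F v).card + (inc (E \ F) v).card = 3 :=
    fun v hv => (card_inc_sdiff hFE v).trans (hdeg v hv)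
  have hd' : ∀ e ∈ E \ F, ¬ e.IsDiag := fun e he => hd e (Finset.mem_sdiff.1 he).1
  by_cases hin : ∃ e ∈ E \ F, ∀ v ∈ e, v ∈ R
  · obtain ⟨e, he, heR⟩ := hin
    induction e with | _ u v
    have huv := ne_of_not_isDiag (hd' _ he)
    have hu := heR u (by simp)
    have hv := heR v (by simp)
    obtain ⟨t, ht⟩ : ∃ t, (R.erase u).erase v = {t} := by
      rw [← Finset.card_eq_one, Finset.card_erase_of_mem (Finset.mem_erase.2 ⟨huv.symm, hv⟩),
        Finset.card_erase_of_mem hu, hR]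
    have ht' : t ∈ (R.erase u).erase v := by simp [ht]
    simp only [Finset.mem_erase] at ht'
    obtain ⟨htv, htu, htR⟩ := ht'
    have hRuvt : ∀ w ∈ R, w = u ∨ w = v ∨ w = t := by
      intro w hw
      by_cases hwu : w = u
      · exact Or.inl hwu
      by_cases hwv : w = v
      · exact Or.inr (Or.inl hwv)
      have : w ∈ (R.erase u).erase v := by simp [hwu, hwv, hw]
      rw [ht, Finset.mem_singleton] at this
      exact Or.inr (Or.inr this)
    by_cases h1 : ∃ t' ∉ ({u, v} : Finset V), s(t, t') ∈ E \ F
    · obtain ⟨t', ht', htE⟩ := h1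
      simp only [Finset.mem_insert, Finset.mem_singleton, not_or] at ht'
      refine ⟨{s(u, v), s(t, t')}, ?_,
        matching_pair (Ne.symm htu) (Ne.symm ht'.1) (Ne.symm htv) (Ne.symm ht'.2), ?_,
        Or.inl ⟨s(u, v), by simp, heR⟩⟩
      · intro e he
        simp only [Finset.mem_insert, Finset.mem_singleton] at he
        rcases he with rfl | rfl <;> assumption
      · intro w hw
        rw [mem_supp_pair]
        have := hRuvt w hw
        tauto
    push Not at h1
    have ht2 := hdF t htR
    have hF1 := card_inc_le F t
    have hadj : ∀ a b : V, ({u, v} : Finset V) = {a, b} → s(t, b) ∈ E \ F := by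
      intro a b hab
      obtain ⟨w, hw, hwE⟩ := exists_edge_avoiding (E := E \ F) (v := t) (X := {a})
        (by rw [Finset.card_singleton]; omega)
      by_cases hb : w = b
      · rwa [← hb]
      · refine absurd hwE (h1 w ?_)
        rw [hab]
        simpa [hb] using hw
    have htuE : s(t, u) ∈ E \ F := hadj v u (Finset.pair_comm u v)
    have htvE : s(t, v) ∈ E \ F := hadj u v rfl
    have hFt : (inc F t).card = 1 := by
      have hlt : ¬ ({u, v} : Finset V).card < (inc (E \ F) t).card := by
        intro hlt
        obtain ⟨w, hw, hwE⟩ := exists_edge_avoiding hlt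
        exact h1 w hw hwE
      rw [Finset.card_pair huv] at hlt
      omega
    have hFeq : inc F t = F := Finset.eq_of_subset_of_card_le (Finset.filter_subset _ _) (by omega)
    have hFv : inc F v = ∅ := by
      rw [Finset.eq_empty_iff_forall_notMem]
      intro f hf
      obtain ⟨hf, hvf⟩ := mem_inc.1 hf
      have htf : t ∈ f := by
        rw [← hFeq] at hf
        exact (mem_inc.1 hf).2
      have : f = s(t, v) := (Sym2.mem_and_mem_iff htv).1 ⟨htf, hvf⟩
      exact (Finset.mem_sdiff.1 htvE).2 (this ▸ hf)
    have hv3 := hdF v hv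
    rw [hFv, Finset.card_empty] at hv3
    obtain ⟨v', hv', hvE⟩ := exists_edge_avoiding (E := E \ F) (v := v) (X := {t, u})
      (by rw [Finset.card_pair htu]; omega)
    simp only [Finset.mem_insert, Finset.mem_singleton, not_or] at hv'
    refine ⟨{s(t, u), s(v, v')}, ?_,
      matching_pair htv (Ne.symm hv'.1) huv (Ne.symm hv'.2), ?_,
      Or.inl ⟨s(t, u), by simp, ?_⟩⟩
    · intro e he
      simp only [Finset.mem_insert, Finset.mem_singleton] at he
      rcases he with rfl | rfl <;> assumption
    · intro w hw
      rw [mem_supp_pair]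
      have := hRuvt w hw
      tauto
    · intro w hw
      rcases Sym2.mem_iff.1 hw with rfl | rfl <;> assumption
  push Not at hin
  have hout : ∀ v ∈ R, ∀ w, s(v, w) ∈ E \ F → w ∉ R := by
    intro v hv w hE hw
    obtain ⟨x, hx, hxR⟩ := hin _ hE
    rcases Sym2.mem_iff.1 hx with rfl | rfl
    exacts [hxR hv, hxR hw]
  obtain ⟨d, hdR, hd3⟩ : ∃ d ∈ R, 3 ≤ (inc (E \ F) d).card := by
    by_contra! hcon
    have hall : ∀ v ∈ R, 1 ≤ (inc F v).card := by
      intro v hv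
      have := hcon v hv
      have := hdF v hv
      omega
    have h1 := sum_inc F R
    have h2 := Finset.sum_le_sum hall
    have h3 : ∑ e ∈ F, (R.filter (· ∈ e)).card ≤ ∑ e ∈ F, 2 := by
      refine Finset.sum_le_sum fun e he => ?_
      rw [← card_filter_mem e (hd e (hFE he))]
      exact Finset.card_le_card (Finset.filter_subset_filter _ (Finset.subset_univ _))
    simp only [Finset.sum_const, smul_eq_mul, hR] at h2 h3
    omega
  obtain ⟨a, b, hab, hs⟩ := Finset.card_eq_two.1
    (show (R.erase d).card = 2 by rw [Finset.card_erase_of_mem hdR, hR])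
  have ha : a ∈ R.erase d := by simp [hs]
  have hb : b ∈ R.erase d := by simp [hs]
  rw [Finset.mem_erase] at ha hb
  have hRabd : ∀ w ∈ R, w = a ∨ w = b ∨ w = d := by
    intro w hw
    by_cases hwd : w = d
    · exact Or.inr (Or.inr hwd)
    have : w ∈ R.erase d := by simp [hwd, hw]
    rw [hs] at this
    simp only [Finset.mem_insert, Finset.mem_singleton] at this
    tauto
  have ha2 := hdF a ha.2
  have hb2 := hdF b hb.2
  have hFa := card_inc_le F a
  have hFb := card_inc_le F b
  obtain ⟨a', -, haE⟩ := exists_edge_avoiding (E := E \ F) (v := a) (X := ∅)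
    (by rw [Finset.card_empty]; omega)
  obtain ⟨b', hb', hbE⟩ := exists_edge_avoiding (E := E \ F) (v := b) (X := {a'})
    (by rw [Finset.card_singleton]; omega)
  obtain ⟨d', hd'', hdE⟩ := exists_edge_avoiding (E := E \ F) (v := d) (X := {a', b'})
    (by have := Finset.card_le_two (a := a') (b := b'); omega)
  simp only [Finset.mem_insert, Finset.mem_singleton, not_or] at hb' hd''
  obtain ⟨N, h1, h2, h3⟩ := exists_matching_of_injOn (E := E \ F) (R := R)
    (σ := fun v => if v = a then a' else if v = b then b' else d') (by
      intro v hv w hw heq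
      have h1 := hRabd v hv
      have h2 := hRabd w hw
      have e1 := ha.1
      have e2 := hb.1
      beta_reduce at heq
      rcases h1 with rfl | rfl | rfl <;> rcases h2 with rfl | rfl | rfl <;>
        simp_all [eq_comm]) (by
      intro v hv
      split_ifs
      exacts [hout a ha.2 a' haE, hout b hb.2 b' hbE, hout d hdR d' hdE]) (by
      intro v hv
      have := hRabd v hv
      split_ifs with h h'
      · rwa [h]
      · rwa [h']
      · rwa [(this.resolve_left h).resolve_left h'])
  exact ⟨N, h1, h2, h3, Or.inr fun e he h => by
    obtain ⟨x, hx, hxR⟩ := hin e he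
    exact hxR (h x hx)⟩

/-- Three joining edges. -/
lemma PrismPrecoloring.extends_of_card_eq_three (h : PrismPrecoloring E F ∅ c₁ c₂ R m)
    (hR : R.card = 3) (hF : F.card ≤ 1) : PrismExtends E F ∅ c₁ c₂ R m := by
  obtain ⟨c, hc, hcF, -, hcR⟩ := exists_unused F ∅ c₁ c₂ R m (by simp [hR]; omega)
  obtain ⟨N, hNE, hN, hRN, hor⟩ :=
    exists_matching_triple hR h.not_isDiag h.degree_eq h.subset₁ hF
  exact h.glue_of_covering hc hcF hcR hNE hN hRN fun hpre =>
    hpre.extends_of_card_eq_three hF hR h.not_isDiag (hNE.trans Finset.sdiff_subset) hor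

end Covering

section TwoSidedCases

variable {V : Type*} [Fintype V] [DecidableEq V]

/-- A precolored edge and a perfect matching of forbidden colors on a four-cycle. -/
lemma Precoloring.extends_of_four_cycle {P : Finset ℕ} {A : Finset (Sym2 V)} {g : Sym2 V}
    {c₀ : Sym2 V → ℕ} {S : Finset V} {μ : V → ℕ} {u v x y : V} (h : Precoloring P A {g} c₀ S μ)
    (hS : ∀ w ∈ S, w = u ∨ w = v ∨ w = x ∨ w = y)
    (huv : u ≠ v) (hvx : v ≠ x) (hxy : x ≠ y) (hyu : y ≠ u) (hux' : u ≠ x)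
    (hvy' : v ≠ y) (hux : s(u, x) ∉ A) (hvy : s(v, y) ∉ A)
    (hk : s(u, v) ∉ A ∨ (s(u, v) ≠ g ∧ μ u = μ v) ∨ (s(v, x) ≠ g ∧ μ v = μ x) ∨
      (s(x, y) ≠ g ∧ μ x = μ y) ∨ (s(y, u) ≠ g ∧ μ y = μ u)) :
    Extends P A {g} c₀ S μ := by
  by_contra hE
  obtain ⟨f, K, hfg, hKA, hKne, hKS, hfK, hcard, hμ⟩ := h.obstruction (by simp) hE
  obtain rfl : g = f := Finset.singleton_injective hfg
  have hgK : g ∉ K := fun hg => by simpa using (Finset.mem_sdiff.1 (hKA hg)).2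
  have hgA : g ∈ A := h.subset (by simp)
  have hcard' : (insert g K).card = (supp K).card := by
    rw [Finset.card_insert_of_notMem hgK, hcard]
  have hin : ∀ e ∈ insert g K, ∀ w ∈ e, w ∈ supp K := by
    intro e he w hw
    rcases Finset.mem_insert.1 he with rfl | he
    · exact hfK w hw
    · exact mem_supp.2 ⟨e, he, hw⟩
  have hinA : ∀ e ∈ insert g K, e ∈ A := by
    intro e he
    rcases Finset.mem_insert.1 he with rfl | he
    · exact hgA
    · exact (Finset.mem_sdiff.1 (hKA he)).1
  have hcyc : ∀ e ∈ insert g K, e = s(u, v) ∨ e = s(v, x) ∨ e = s(x, y) ∨ e = s(y, u) := by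
    intro e he
    have heA := hinA e he
    have hd := h.not_isDiag e heA
    have hw := hin e he
    induction e with | _ p q
    have hp := hS p (hKS (hw p (by simp)))
    have hq := hS q (hKS (hw q (by simp)))
    have hxu : s(x, u) ∉ A := by rwa [Sym2.eq_swap]
    have hyv : s(y, v) ∉ A := by rwa [Sym2.eq_swap]
    rcases hp with rfl | rfl | rfl | rfl <;> rcases hq with rfl | rfl | rfl | rfl <;>
      first
        | exact absurd rfl (ne_of_not_isDiag hd)
        | exact absurd heA ‹_›
        | simp [Sym2.eq_swap]
  have key : ∀ a b c d : V, b ≠ c → c ≠ d → d ≠ b → (∀ e ∈ insert g K,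
      e = s(a, b) ∨ e = s(b, c) ∨ e = s(c, d) ∨ e = s(d, a)) → a ∈ supp K := by
    intro a b c d hbc hcd hdb hab
    by_contra ha
    have hsub : insert g K ⊆ {s(b, c), s(c, d)} := by
      intro e he
      rcases hab e he with rfl | rfl | rfl | rfl
      · exact absurd (hin _ he a (by simp)) ha
      · simp
      · simp
      · exact absurd (hin _ he a (by simp)) ha
    have h1 := Finset.card_le_card hsub
    have h2 := Finset.card_le_two (a := s(b, c)) (b := s(c, d))
    have h3 := hKne.card_pos
    have heq := Finset.eq_of_subset_of_card_le hsub (by omega)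
    have hb := hin s(b, c) (by rw [heq]; simp) b (by simp)
    have hc := hin s(b, c) (by rw [heq]; simp) c (by simp)
    have hd := hin s(c, d) (by rw [heq]; simp) d (by simp)
    have h4 : ({b, c, d} : Finset V).card ≤ (supp K).card :=
      Finset.card_le_card (by simp [Finset.insert_subset_iff, hb, hc, hd])
    rw [Finset.card_eq_three.2 ⟨b, c, d, hbc, hdb.symm, hcd, rfl⟩] at h4
    omega
  have hu : u ∈ supp K := key u v x y hvx hxy hvy'.symm hcyc
  have hv : v ∈ supp K := key v x y u hxy hyu hux' fun e he => by
    rcases hcyc e he with h | h | h | h <;> simp [h]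
  have hx : x ∈ supp K := key x y u v hyu huv hvy' fun e he => by
    rcases hcyc e he with h | h | h | h <;> simp [h]
  have hy : y ∈ supp K := key y u v x huv hvx hux'.symm fun e he => by
    rcases hcyc e he with h | h | h | h <;> simp [h]
  have h4 : ({u, v, x, y} : Finset V).card ≤ (supp K).card :=
    Finset.card_le_card (by simp [Finset.insert_subset_iff, hu, hv, hx, hy])
  have h5 : ({u, v, x, y} : Finset V).card = 4 := by
    simp [huv, hvx, hxy, hyu.symm, hux', hvy']
  have heq : insert g K = {s(u, v), s(v, x), s(x, y), s(y, u)} := by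
    refine Finset.eq_of_subset_of_card_le (fun e he => by simpa using hcyc e he) ?_
    exact Finset.card_le_four.trans (by omega)
  have kill : ∀ p q, s(p, q) ∈ insert g K → s(p, q) ≠ g → μ p ≠ μ q := fun p q hpq hne =>
    hμ p q ((Finset.mem_insert.1 hpq).resolve_left hne)
  rcases hk with hk | hk | hk | hk | hk
  · exact hk (hinA _ (by rw [heq]; simp))
  all_goals exact kill _ _ (by rw [heq]; simp) hk.1 hk.2

variable {E F₁ F₂ N : Finset (Sym2 V)} {c₁ c₂ : Sym2 V → ℕ} {R : Finset V} {m μ : V → ℕ} {c : ℕ}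

/-- A main color that is not used, and a matching avoiding all precolored edges. -/
lemma PrismPrecoloring.glue_of_unused (h : PrismPrecoloring E F₁ F₂ c₁ c₂ R m) (hc : c < 5)
    (hcF₁ : ∀ f ∈ F₁, c₁ f ≠ c) (hcF₂ : ∀ f ∈ F₂, c₂ f ≠ c) (hN : Matching N) (hNE : N ⊆ E)
    (hF₁N : ∀ f ∈ F₁, f ∉ N) (hF₂N : ∀ f ∈ F₂, f ∉ N) (hRN : R ⊆ supp N)
    (hμ : ∀ v ∈ supp N, μ v ∈ palette c) (hμR : ∀ v ∈ R, μ v = m v)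
    (hne₁ : ∀ f ∈ F₁, ∀ v ∈ supp N, v ∈ f → c₁ f ≠ μ v)
    (hne₂ : ∀ f ∈ F₂, ∀ v ∈ supp N, v ∈ f → c₂ f ≠ μ v)
    (hext₁ : Precoloring (palette c) (E \ N) F₁ c₁ (supp N) μ →
      Extends (palette c) (E \ N) F₁ c₁ (supp N) μ)
    (hext₂ : Precoloring (palette c) (E \ N) F₂ c₂ (supp N) μ →
      Extends (palette c) (E \ N) F₂ c₂ (supp N) μ) :
    PrismExtends E F₁ F₂ c₁ c₂ R m := by
  have e1 : F₁ \ N = F₁ := Finset.sdiff_eq_self_of_disjoint (Finset.disjoint_left.2 hF₁N)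
  have e2 : F₂ \ N = F₂ := Finset.sdiff_eq_self_of_disjoint (Finset.disjoint_left.2 hF₂N)
  refine h.glue hc hN (fun f hf hfN => absurd hfN (hF₁N f hf))
    (fun f hf hfN => absurd hfN (hF₂N f hf)) hμ (fun v hv _ => hμR v hv)
    (fun v hv hvN => absurd (hRN hv) hvN) ?_ ?_
  · rw [e1]
    refine hext₁ (e1 ▸ h.side hc hNE hN (fun f hf hfc => absurd hfc (hcF₁ f hf)) subset_rfl ?_)
    rwa [e1]
  · rw [e2]
    refine hext₂
      (e2 ▸ h.symm.side hc hNE hN (fun f hf hfc => absurd hfc (hcF₂ f hf)) subset_rfl ?_)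
    rwa [e2]

/-- All joining edges have a color that is not used elsewhere. -/
lemma PrismPrecoloring.extends_of_main (h : PrismPrecoloring E F₁ F₂ c₁ c₂ R m) (hc : c < 5)
    (hcF₁ : ∀ f ∈ F₁, c₁ f ≠ c) (hcF₂ : ∀ f ∈ F₂, c₂ f ≠ c) (hR : ∀ v ∈ R, m v = c)
    (h₁ : F₁.card ≤ 3) (h₂ : F₂.card ≤ 3) : PrismExtends E F₁ F₂ c₁ c₂ R m := by
  refine h.glue (N := ∅) (μ := m) hc matching_empty (by simp) (by simp) (by simp [supp_empty])
    (by simp) (fun v hv _ => hR v hv) ?_ ?_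
  · exact (h.side hc (by simp) matching_empty (fun f hf hfc => absurd hfc (hcF₁ f hf))
      subset_rfl (by simp [supp_empty])).extends_of_card_le_three (by simpa [supp_empty] using h₁)
  · exact (h.symm.side hc (by simp) matching_empty (fun f hf hfc => absurd hfc (hcF₂ f hf))
      subset_rfl (by simp [supp_empty])).extends_of_card_le_three (by simpa [supp_empty] using h₂)

lemma supp_singleton {a b : V} : supp {s(a, b)} = {a, b} := by
  ext v
  rw [← LawfulSingleton.insert_empty_eq, mem_supp_insert]
  simp [supp_empty]

lemma matching_singleton (e : Sym2 V) : Matching {e} := by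
  intro f hf g hg _ _ _
  rw [Finset.mem_singleton.1 hf, Finset.mem_singleton.1 hg]

/-- One joining edge. -/
lemma PrismPrecoloring.extends_single {u : V} (h : PrismPrecoloring E F₁ F₂ c₁ c₂ {u} m)
    (h₁ : F₁.card ≤ 2) (h₂ : F₂.card ≤ 1) : PrismExtends E F₁ F₂ c₁ c₂ {u} m := by
  by_cases hw : ∃ w, s(u, w) ∈ E ∧ s(u, w) ∉ F₁ ∧ s(u, w) ∉ F₂
  · obtain ⟨w, hwE, hw₁, hw₂⟩ := hw
    have huw := ne_of_not_isDiag (h.not_isDiag _ hwE)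
    obtain ⟨c, hc, hcF₁, hcF₂, hcR⟩ := exists_unused F₁ F₂ c₁ c₂ {u} m (by simp; omega)
    have hN := matching_singleton s(u, w)
    have hNE : {s(u, w)} ⊆ E := by simpa using hwE
    have e1 : F₁ \ {s(u, w)} = F₁ := Finset.sdiff_eq_self_of_disjoint (by simpa using hw₁)
    obtain ⟨C, hC, hp, hCF, hCS⟩ := (h.side (S := {u}) (μ := m) hc hNE hN
      (fun f hf hfc => absurd hfc (hcF₁ f hf)) (by simp [supp_singleton])
      (fun f hf => h.ne₁ f (Finset.mem_sdiff.1 hf).1)).extends_of_card_le_three (by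
        rw [e1]; simp; omega)
    obtain ⟨x, hx, hxC⟩ : ∃ x ∈ palette c,
        x ∉ (inc (E \ {s(u, w)}) w).image C ∪ F₂.image c₂ := by
      by_contra! hcon
      have h1 := (Finset.card_le_card hcon).trans (Finset.card_union_le _ _)
      have h2 := card_inc_sdiff_matching h.degree_le hNE hN (v := w) (by simp [supp_singleton])
      have h3 := Finset.card_image_le (s := inc (E \ {s(u, w)}) w) (f := C)
      have h4 := Finset.card_image_le (s := F₂) (f := c₂)
      rw [card_palette hc] at h1
      omega
    simp only [Finset.mem_union, Finset.mem_image, not_or, not_exists, not_and] at hxC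
    have hμu : Function.update m w x u = m u := Function.update_of_ne huw _ _
    have hμw : Function.update m w x w = x := Function.update_self _ _ _
    have hC' : ∀ v ∈ supp {s(u, w)}, ∀ e ∈ E \ {s(u, w)}, v ∈ e →
        C e ≠ Function.update m w x v := by
      intro v hv e he hve
      rw [supp_singleton, Finset.mem_insert, Finset.mem_singleton] at hv
      rcases hv with rfl | rfl
      · rw [hμu]
        exact hCS v (by simp) e he hve
      · rw [hμw]
        exact hxC.1 e (mem_inc.2 ⟨he, hve⟩)
    have hF₁A : ∀ f ∈ F₁, f ∈ E \ {s(u, w)} := fun f hf =>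
      Finset.mem_sdiff.2 ⟨h.subset₁ hf, by rw [← e1] at hf; exact (Finset.mem_sdiff.1 hf).2⟩
    refine h.glue_of_unused (μ := Function.update m w x) hc hcF₁ hcF₂ hN hNE
      (by rintro f hf hf'; exact hw₁ (Finset.mem_singleton.1 hf' ▸ hf))
      (by rintro f hf hf'; exact hw₂ (Finset.mem_singleton.1 hf' ▸ hf))
      (by simp [supp_singleton]) ?_ (by simpa using hμu) ?_ ?_ ?_ ?_
    · intro v hv
      rw [supp_singleton, Finset.mem_insert, Finset.mem_singleton] at hv
      rcases hv with rfl | rfl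
      · rw [hμu]
        exact mem_palette.2 ⟨hcR v (by simp), h.lt v (by simp)⟩
      · rwa [hμw]
    · intro f hf v hv hvf
      rw [← hCF f (by rwa [e1])]
      exact hC' v hv f (hF₁A f hf) hvf
    · intro f hf v hv hvf
      rw [supp_singleton, Finset.mem_insert, Finset.mem_singleton] at hv
      rcases hv with rfl | rfl
      · rw [hμu]
        exact h.ne₂ f hf v (by simp) hvf
      · rw [hμw]
        exact hxC.2 f hf
    · exact fun _ => ⟨C, hC, hp, by rwa [e1] at hCF, hC'⟩
    · refine fun h => h.extends_of_card_le_three ?_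
      rw [supp_singleton, Finset.card_pair huw]
      omega
  · push Not at hw
    have hu := h.degree_eq u (by simp)
    have hinc : inc E u ⊆ inc F₁ u ∪ inc F₂ u := by
      intro e he
      obtain ⟨he, ⟨w, rfl⟩⟩ := mem_inc.1 he
      by_cases hw₁ : s(u, w) ∈ F₁
      · exact Finset.mem_union_left _ (mem_inc.2 ⟨hw₁, by simp⟩)
      · exact Finset.mem_union_right _ (mem_inc.2 ⟨hw w he hw₁, by simp⟩)
    have h3 := (Finset.card_le_card hinc).trans (Finset.card_union_le _ _)
    have h4 := card_inc_le F₁ u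
    have h5 := card_inc_le F₂ u
    have all : ∀ F : Finset (Sym2 V), F.card ≤ (inc F u).card → ∀ f ∈ F, u ∈ f := by
      intro F hF f hf
      rw [← Finset.eq_of_subset_of_card_le (Finset.filter_subset _ _) hF] at hf
      exact (Finset.mem_filter.1 hf).2
    exact h.extends_of_main (h.lt u (by simp))
      (fun f hf => h.ne₁ f hf u (by simp) (all F₁ (by omega) f hf))
      (fun f hf => h.ne₂ f hf u (by simp) (all F₂ (by omega) f hf)) (by simp) (by omega)
      (by omega)

variable {f g : Sym2 V} {u v x y : V} {p q : ℕ}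

/-- Gluing along a matching of two edges with prescribed joining colors. -/
lemma PrismPrecoloring.glue_of_pair (h : PrismPrecoloring E {f} {g} c₁ c₂ {u, v} m) (hc : c < 5)
    (hcf : c₁ f ≠ c) (hcg : c₂ g ≠ c) (hcu : m u ≠ c) (hcv : m v ≠ c)
    (huv : u ≠ v) (hxy : x ≠ y) (hvx : v ≠ x) (hyu : y ≠ u)
    (hux : s(u, x) ∈ E \ {f, g}) (hvy : s(v, y) ∈ E \ {f, g})
    (hp : p ∈ palette c) (hq : q ∈ palette c)
    (hpf : x ∈ f → c₁ f ≠ p) (hpg : x ∈ g → c₂ g ≠ p) (hqf : y ∈ f → c₁ f ≠ q)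
    (hqg : y ∈ g → c₂ g ≠ q)
    (hkf : s(u, v) ∉ E ∨ (s(u, v) ≠ f ∧ m u = m v) ∨ (s(v, x) ≠ f ∧ m v = p) ∨
      (s(x, y) ≠ f ∧ p = q) ∨ (s(y, u) ≠ f ∧ q = m u))
    (hkg : s(u, v) ∉ E ∨ (s(u, v) ≠ g ∧ m u = m v) ∨ (s(v, x) ≠ g ∧ m v = p) ∨
      (s(x, y) ≠ g ∧ p = q) ∨ (s(y, u) ≠ g ∧ q = m u)) :
    PrismExtends E {f} {g} c₁ c₂ {u, v} m := by
  simp only [Finset.mem_sdiff, Finset.mem_insert, Finset.mem_singleton, not_or] at hux hvy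
  have hux' := ne_of_not_isDiag (h.not_isDiag _ hux.1)
  have hvy' := ne_of_not_isDiag (h.not_isDiag _ hvy.1)
  let μ : V → ℕ := fun w => if w = x then p else if w = y then q else m w
  have hμu : μ u = m u := by simp [μ, hux', hyu.symm]
  have hμv : μ v = m v := by simp [μ, hvx, hvy']
  have hμx : μ x = p := by simp [μ]
  have hμy : μ y = q := by simp [μ, hxy.symm]
  have hS : ∀ w ∈ supp {s(u, x), s(v, y)}, w = u ∨ w = v ∨ w = x ∨ w = y := by
    intro w hw
    rcases mem_supp_pair.1 hw with h | h | h | h <;> simp [h]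
  have huxN : s(u, x) ∉ E \ {s(u, x), s(v, y)} := by simp
  have hvyN : s(v, y) ∉ E \ {s(u, x), s(v, y)} := by simp
  have hsub : ∀ e, e ∉ E → e ∉ E \ {s(u, x), s(v, y)} := fun e he he' =>
    he (Finset.mem_sdiff.1 he').1
  refine h.glue_of_unused (N := {s(u, x), s(v, y)}) (μ := μ) hc (by simpa using hcf)
    (by simpa using hcg) (matching_pair huv hyu.symm hvx.symm hxy) ?_ ?_ ?_ ?_ ?_ ?_ ?_ ?_ ?_ ?_
  · simp [Finset.insert_subset_iff, hux.1, hvy.1]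
  · simp [Ne.symm hux.2.1, Ne.symm hvy.2.1]
  · simp [Ne.symm hux.2.2, Ne.symm hvy.2.2]
  · intro w hw
    rw [mem_supp_pair]
    simp only [Finset.mem_insert, Finset.mem_singleton] at hw
    exact hw.imp_right fun h => Or.inr (Or.inl h)
  · intro w hw
    rcases hS w hw with rfl | rfl | rfl | rfl
    · exact hμu ▸ mem_palette.2 ⟨hcu, h.lt _ (by simp)⟩
    · exact hμv ▸ mem_palette.2 ⟨hcv, h.lt _ (by simp)⟩
    · exact hμx ▸ hp
    · exact hμy ▸ hq
  · simp [hμu, hμv]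
  · intro e he w hw hwe
    obtain rfl := Finset.mem_singleton.1 he
    rcases hS w hw with rfl | rfl | rfl | rfl
    · exact hμu ▸ h.ne₁ _ (by simp) _ (by simp) hwe
    · exact hμv ▸ h.ne₁ _ (by simp) _ (by simp) hwe
    · exact hμx ▸ hpf hwe
    · exact hμy ▸ hqf hwe
  · intro e he w hw hwe
    obtain rfl := Finset.mem_singleton.1 he
    rcases hS w hw with rfl | rfl | rfl | rfl
    · exact hμu ▸ h.ne₂ _ (by simp) _ (by simp) hwe
    · exact hμv ▸ h.ne₂ _ (by simp) _ (by simp) hwe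
    · exact hμx ▸ hpg hwe
    · exact hμy ▸ hqg hwe
  · refine fun h => h.extends_of_four_cycle hS huv hvx hxy hyu hux' hvy' huxN hvyN ?_
    rw [hμu, hμv, hμx, hμy]
    exact hkf.imp_left (hsub _)
  · refine fun h => h.extends_of_four_cycle hS huv hvx hxy hyu hux' hvy' huxN hvyN ?_
    rw [hμu, hμv, hμx, hμy]
    exact hkg.imp_left (hsub _)

lemma PrismPrecoloring.extends_of_pair (h : PrismPrecoloring E {f} {g} c₁ c₂ {u, v} m)
    (hc : c < 5) (hcf : c₁ f ≠ c) (hcg : c₂ g ≠ c) (hcu : m u ≠ c) (hcv : m v ≠ c)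
    (huv : u ≠ v) (hxy : x ≠ y) (hvx : v ≠ x) (hyu : y ≠ u)
    (hux : s(u, x) ∈ E \ {f, g}) (hvy : s(v, y) ∈ E \ {f, g})
    (huvE : s(u, v) ∈ E → s(u, v) = f ∨ s(u, v) = g) (hg : s(x, y) = g → s(u, v) ∉ E) :
    PrismExtends E {f} {g} c₁ c₂ {u, v} m := by
  obtain ⟨t, ht, htfg⟩ : ∃ t ∈ palette c, t ∉ ({c₁ f, c₂ g} : Finset ℕ) := by
    by_contra! hcon
    have h1 := (Finset.card_le_card hcon).trans Finset.card_le_two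
    rw [card_palette hc] at h1
    omega
  simp only [Finset.mem_insert, Finset.mem_singleton, not_or] at htfg
  have htf : c₁ f ≠ t := Ne.symm htfg.1
  have htg : c₂ g ≠ t := Ne.symm htfg.2
  have hu : m u ∈ palette c := mem_palette.2 ⟨hcu, h.lt _ (by simp)⟩
  have hv : m v ∈ palette c := mem_palette.2 ⟨hcv, h.lt _ (by simp)⟩
  by_cases hE : s(u, v) ∉ E
  · exact h.glue_of_pair hc hcf hcg hcu hcv huv hxy hvx hyu hux hvy ht ht (fun _ => htf)
      (fun _ => htg) (fun _ => htf) (fun _ => htg) (by simp [hE]) (by simp [hE])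
  rw [not_not] at hE
  replace hg : s(x, y) ≠ g := fun h => hg h hE
  by_cases hf : s(x, y) ≠ f
  · exact h.glue_of_pair hc hcf hcg hcu hcv huv hxy hvx hyu hux hvy ht ht (fun _ => htf)
      (fun _ => htg) (fun _ => htf) (fun _ => htg) (by simp [hf]) (by simp [hg])
  rw [not_not] at hf
  have hux' := ne_of_not_isDiag (h.not_isDiag _ (Finset.mem_sdiff.1 hux).1)
  have hvy' := ne_of_not_isDiag (h.not_isDiag _ (Finset.mem_sdiff.1 hvy).1)
  have huvf : s(u, v) ≠ f := by
    intro heq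
    have : u ∈ s(x, y) := by rw [hf, ← heq]; simp
    rcases Sym2.mem_iff.1 this with h | h
    · exact hux' h
    · exact hyu h.symm
  have huvg : s(u, v) = g := (huvE hE).resolve_left huvf
  by_cases hab : m u = m v
  · exact h.glue_of_pair hc hcf hcg hcu hcv huv hxy hvx hyu hux hvy ht ht (fun _ => htf)
      (fun _ => htg) (fun _ => htf) (fun _ => htg) (by simp [huvf, hab]) (by simp [hg])
  have hxg : x ∉ g := by
    rw [← huvg]
    simp [hux'.symm, hvx.symm]
  have hyg : y ∉ g := by
    rw [← huvg]
    simp [hvy'.symm, hyu]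
  have hvf : v ∉ f := by
    rw [← hf]
    simp [hvx, hvy']
  have huf : u ∉ f := by
    rw [← hf]
    simp [hux', hyu.symm]
  have hvxf : s(v, x) ≠ f := fun h => hvf (h ▸ by simp)
  have hvxg : s(v, x) ≠ g := fun h => hxg (h ▸ by simp)
  have hyuf : s(y, u) ≠ f := fun h => huf (h ▸ by simp)
  have hyug : s(y, u) ≠ g := fun h => hyg (h ▸ by simp)
  by_cases hbf : c₁ f = m v
  · exact h.glue_of_pair hc hcf hcg hcu hcv huv hxy hvx hyu hux hvy ht hu (fun _ => htf)
      (fun _ => htg) (fun _ => hbf ▸ Ne.symm hab) (fun h => absurd h hyg) (by simp [hyuf])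
      (by simp [hyug])
  · exact h.glue_of_pair hc hcf hcg hcu hcv huv hxy hvx hyu hux hvy hv ht (fun _ => hbf)
      (fun h => absurd h hxg) (fun _ => htf) (fun _ => htg) (by simp [hvxf]) (by simp [hvxg])

lemma mem_of_two_le_card_inc {w : V} (h : 2 ≤ (inc {f, g} w).card) : f ≠ g ∧ w ∈ f ∧ w ∈ g := by
  have h1 := Finset.card_le_two (a := f) (b := g)
  have heq : inc {f, g} w = {f, g} :=
    Finset.eq_of_subset_of_card_le (Finset.filter_subset _ _) (by omega)
  refine ⟨?_, ?_, ?_⟩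
  · rintro rfl
    have := card_inc_le {f, f} w
    simp at this
    simp at h
    omega
  · exact (mem_inc.1 (heq.symm ▸ Finset.mem_insert_self f {g} : f ∈ inc {f, g} w)).2
  · exact (mem_inc.1 (heq.symm ▸ by simp : g ∈ inc {f, g} w)).2

/-- Two joining edges, and one precolored edge on each side. -/
lemma PrismPrecoloring.extends_two (h : PrismPrecoloring E {f} {g} c₁ c₂ {u, v} m)
    (huv : u ≠ v) : PrismExtends E {f} {g} c₁ c₂ {u, v} m := by
  obtain ⟨c, hc, hcF₁, hcF₂, hcR⟩ := exists_unused {f} {g} c₁ c₂ {u, v} m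
    (by simp [Finset.card_pair huv])
  have hcf : c₁ f ≠ c := hcF₁ f (by simp)
  have hcg : c₂ g ≠ c := hcF₂ g (by simp)
  have hcu : m u ≠ c := hcR u (by simp)
  have hcv : m v ≠ c := hcR v (by simp)
  by_cases huvE : s(u, v) ∈ E ∧ s(u, v) ≠ f ∧ s(u, v) ≠ g
  · refine h.glue_of_unused (N := {s(u, v)}) (μ := m) hc hcF₁ hcF₂ (matching_singleton _)
      (by simpa using huvE.1) (by simpa using Ne.symm huvE.2.1) (by simpa using Ne.symm huvE.2.2)
      (by rw [supp_singleton]) ?_ (by simp) ?_ ?_ ?_ ?_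
    · intro w hw
      rw [supp_singleton] at hw
      exact mem_palette.2 ⟨hcR w hw, h.lt w hw⟩
    · rw [supp_singleton]
      exact h.ne₁
    · rw [supp_singleton]
      exact h.ne₂
    all_goals
      refine fun h => h.extends_of_card_le_three ?_
      rw [supp_singleton, Finset.card_pair huv]
      simp
  have hsub : {f, g} ⊆ E := by
    simp [Finset.insert_subset_iff, h.subset₁ (Finset.mem_singleton_self f),
      h.subset₂ (Finset.mem_singleton_self g)]
  have huvE' : s(u, v) ∈ E → s(u, v) = f ∨ s(u, v) = g := by tauto
  have huvE₀ : s(u, v) ∉ E \ {f, g} := by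
    simp only [Finset.mem_sdiff, Finset.mem_insert, Finset.mem_singleton]
    tauto
  have hvuE₀ : s(v, u) ∉ E \ {f, g} := by rwa [Sym2.eq_swap]
  have hdu := h.degree_eq u (by simp)
  have hdv := h.degree_eq v (by simp)
  have hcu' := card_inc_sdiff hsub u
  have hcv' := card_inc_sdiff hsub v
  have h2 := Finset.card_le_two (a := f) (b := g)
  have hiu := card_inc_le {f, g} u
  have hiv := card_inc_le {f, g} v
  have hxy : ∃ x y, x ≠ y ∧ s(u, x) ∈ E \ {f, g} ∧ s(v, y) ∈ E \ {f, g} := by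
    by_cases hv2 : 2 ≤ (inc (E \ {f, g}) v).card
    · obtain ⟨x, -, hx⟩ := exists_edge_avoiding (E := E \ {f, g}) (v := u) (X := ∅)
          (by rw [Finset.card_empty]; omega)
      obtain ⟨y, hy, hyE⟩ := exists_edge_avoiding (E := E \ {f, g}) (v := v) (X := {x})
          (by rw [Finset.card_singleton]; omega)
      exact ⟨x, y, by simpa [eq_comm] using hy, hx, hyE⟩
    · by_cases hu2 : 2 ≤ (inc (E \ {f, g}) u).card
      · obtain ⟨y, -, hy⟩ := exists_edge_avoiding (E := E \ {f, g}) (v := v) (X := ∅)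
          (by rw [Finset.card_empty]; omega)
        obtain ⟨x, hx, hxE⟩ := exists_edge_avoiding (E := E \ {f, g}) (v := u) (X := {y})
          (by rw [Finset.card_singleton]; omega)
        exact ⟨x, y, by simpa using hx, hxE, hy⟩
      · obtain ⟨hfg, huf, hug⟩ := mem_of_two_le_card_inc (f := f) (g := g) (w := u) (by omega)
        obtain ⟨-, hvf, hvg⟩ := mem_of_two_le_card_inc (f := f) (g := g) (w := v) (by omega)
        exact absurd (((Sym2.mem_and_mem_iff huv).1 ⟨huf, hvf⟩).trans
          ((Sym2.mem_and_mem_iff huv).1 ⟨hug, hvg⟩).symm) hfg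
  obtain ⟨x, y, hxy, hux, hvy⟩ := hxy
  have hvx : v ≠ x := by
    rintro rfl
    exact huvE₀ hux
  have hyu : y ≠ u := by
    rintro rfl
    exact hvuE₀ hvy
  by_cases hg : s(x, y) ≠ g
  · exact h.extends_of_pair hc hcf hcg hcu hcv huv hxy hvx hyu hux hvy huvE'
      (fun h => absurd h hg)
  refine (h.symm.extends_of_pair hc hcg hcf hcu hcv huv hxy hvx hyu ?_ ?_
    (fun hE => (huvE' hE).symm) fun hf hE => ?_).symm
  · rwa [Finset.pair_comm]
  · rwa [Finset.pair_comm]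
  · have : u ∈ s(x, y) := by
      rcases huvE' hE with h | h
      · rw [hf, ← h]
        simp
      · rw [not_not.1 hg, ← h]
        simp
    rcases Sym2.mem_iff.1 this with hu | hu
    · exact ne_of_not_isDiag (h.not_isDiag _ (Finset.mem_sdiff.1 hux).1) hu
    · exact hyu hu.symm

end TwoSidedCases

section Prism

variable {V : Type*} [Fintype V] [DecidableEq V]
variable {E F₁ F₂ : Finset (Sym2 V)} {c₁ c₂ : Sym2 V → ℕ} {R : Finset V} {m : V → ℕ}

lemma PrismPrecoloring.extends_of_eq_empty (h : PrismPrecoloring E F₁ ∅ c₁ c₂ R m)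
    (hcard : F₁.card + R.card ≤ 4) : PrismExtends E F₁ ∅ c₁ c₂ R m := by
  have hfilter : ∀ a, (F₁.filter (c₁ · ≠ a)).card ≤ F₁.card :=
    fun a => Finset.card_le_card (Finset.filter_subset _ _)
  obtain hR | hR | hR | hR | hR : R.card = 0 ∨ R.card = 1 ∨ R.card = 2 ∨ R.card = 3 ∨
      R.card = 4 := by omega
  · obtain rfl := Finset.card_eq_zero.1 hR
    rcases F₁.eq_empty_or_nonempty with rfl | ⟨f, hf⟩
    · exact h.extends_of_forall_eq (a := 0) (by omega) (by simp) (by simp)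
    · refine h.extends_of_forall_eq (h.lt₁ f hf) (by simp) ?_
      have : (F₁.filter (c₁ · ≠ c₁ f)).card < F₁.card :=
        Finset.card_lt_card (Finset.filter_ssubset.2 ⟨f, hf, by simp⟩)
      omega
  · obtain ⟨u, rfl⟩ := Finset.card_eq_one.1 hR
    exact h.extends_of_forall_eq (h.lt u (by simp)) (by simp) ((hfilter _).trans (by omega))
  · obtain ⟨u, v, huv, rfl⟩ := Finset.card_eq_two.1 hR
    by_cases hm : m u = m v
    · exact h.extends_of_forall_eq (h.lt u (by simp)) (by simp [hm])
        ((hfilter _).trans (by omega))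
    · exact h.extends_pair huv hm (by omega)
  · exact h.extends_of_card_eq_three hR (by omega)
  · obtain rfl := Finset.card_eq_zero.1 (by omega : F₁.card = 0)
    exact h.extends_of_card_eq_four hR

lemma PrismPrecoloring.extends_of_card_le (h : PrismPrecoloring E F₁ F₂ c₁ c₂ R m)
    (hle : F₂.card ≤ F₁.card) (hcard : F₁.card + F₂.card + R.card ≤ 4) :
    PrismExtends E F₁ F₂ c₁ c₂ R m := by
  rcases F₂.eq_empty_or_nonempty with rfl | hne
  · exact h.extends_of_eq_empty (by simpa using hcard)
  have hpos := hne.card_pos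
  obtain hR | hR | hR : R.card = 0 ∨ R.card = 1 ∨ R.card = 2 := by omega
  · obtain rfl := Finset.card_eq_zero.1 hR
    obtain ⟨c, hc, hc₁, hc₂, -⟩ := exists_unused F₁ F₂ c₁ c₂ ∅ m hcard
    exact h.extends_of_main hc hc₁ hc₂ (by simp) (by omega) (by omega)
  · obtain ⟨u, rfl⟩ := Finset.card_eq_one.1 hR
    exact h.extends_single (by omega) (by omega)
  · obtain ⟨u, v, huv, rfl⟩ := Finset.card_eq_two.1 hR
    obtain ⟨f, rfl⟩ := Finset.card_eq_one.1 (by omega : F₁.card = 1)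
    obtain ⟨g, rfl⟩ := Finset.card_eq_one.1 (by omega : F₂.card = 1)
    exact h.extends_two huv

/-- Every precoloring of at most four edges of a prism extends, provided the endpoints of the
precolored joining edges have full degree. -/
theorem PrismPrecoloring.extends_of_degree_eq (h : PrismPrecoloring E F₁ F₂ c₁ c₂ R m)
    (hcard : F₁.card + F₂.card + R.card ≤ 4) : PrismExtends E F₁ F₂ c₁ c₂ R m := by
  rcases le_total F₂.card F₁.card with hle | hle
  · exact h.extends_of_card_le hle hcard
  · exact (h.symm.extends_of_card_le hle (by omega)).symm

end Prism

section Padding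

variable {V : Type*} [Fintype V] [DecidableEq V]

/-- Adding pendant edges makes all the original vertices have degree three. -/
lemma exists_padding {E : Finset (Sym2 V)} (hE : ∀ e ∈ E, ¬ e.IsDiag)
    (hdeg : ∀ v, (inc E v).card ≤ 3) :
    ∃ E' : Finset (Sym2 (V ⊕ V × Fin 3)), (∀ e ∈ E, e.map Sum.inl ∈ E') ∧
      (∀ e ∈ E', ¬ e.IsDiag) ∧ (∀ w, (inc E' w).card ≤ 3) ∧
      ∀ v, (inc E' (Sum.inl v)).card = 3 := by
  let B : Finset (V × Fin 3) := Finset.univ.filter fun p => (inc E p.1).card ≤ p.2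
  let E' : Finset (Sym2 (V ⊕ V × Fin 3)) :=
    E.image (Sym2.map Sum.inl) ∪ B.image fun p => s(Sum.inl p.1, Sum.inr p)
  have hE' : ∀ e, e ∈ E' ↔ (∃ f ∈ E, f.map Sum.inl = e) ∨
      ∃ p, (inc E p.1).card ≤ p.2 ∧ s(Sum.inl p.1, Sum.inr p) = e := by
    intro e
    simp [E', B]
  have hinl : ∀ v, (inc E' (Sum.inl v)).card = 3 := by
    intro v
    have heq : inc E' (Sum.inl v) = (inc E v).image (Sym2.map Sum.inl) ∪
        (Finset.univ.filter fun i : Fin 3 => (inc E v).card ≤ i).image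
          fun i => s(Sum.inl v, Sum.inr (v, i)) := by
      ext e
      simp only [mem_inc, hE', Finset.mem_union, Finset.mem_image, Finset.mem_filter,
        Finset.mem_univ, true_and]
      constructor
      · rintro ⟨⟨f, hf, rfl⟩ | ⟨⟨w, i⟩, hi, rfl⟩, hv⟩
        · obtain ⟨w, hw, hwv⟩ := Sym2.mem_map.1 hv
          exact Or.inl ⟨f, ⟨hf, Sum.inl_injective hwv ▸ hw⟩, rfl⟩
        · obtain rfl : v = w := by simpa using hv
          exact Or.inr ⟨i, hi, rfl⟩
      · rintro (⟨f, ⟨hf, hv⟩, rfl⟩ | ⟨i, hi, rfl⟩)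
        · exact ⟨Or.inl ⟨f, hf, rfl⟩, Sym2.mem_map.2 ⟨v, hv, rfl⟩⟩
        · exact ⟨Or.inr ⟨(v, i), hi, rfl⟩, by simp⟩
    rw [heq, Finset.card_union_of_disjoint, Finset.card_image_of_injective _
      (Sym2.map.injective Sum.inl_injective), Finset.card_image_of_injective]
    · have := hdeg v
      generalize (inc E v).card = d at this
      interval_cases d <;> rfl
    · intro i j hij
      simpa using hij
    · rw [Finset.disjoint_left]
      intro e he he'
      obtain ⟨f, -, rfl⟩ := Finset.mem_image.1 he
      obtain ⟨i, -, hi⟩ := Finset.mem_image.1 he'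
      have : Sum.inr (v, i) ∈ Sym2.map Sum.inl f := by rw [← hi]; simp
      simp [Sym2.mem_map] at this
  refine ⟨E', fun e he => (hE' _).2 (Or.inl ⟨e, he, rfl⟩), ?_, ?_, hinl⟩
  · intro e he
    rcases (hE' e).1 he with ⟨f, hf, rfl⟩ | ⟨p, -, rfl⟩
    · exact fun h => hE f hf ((Sym2.isDiag_map Sum.inl_injective).1 h)
    · simp
  · rintro (v | p)
    · exact (hinl v).le
    · have : inc E' (Sum.inr p) ⊆ {s(Sum.inl p.1, Sum.inr p)} := by
        intro e he
        obtain ⟨he, hp⟩ := mem_inc.1 he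
        rcases (hE' e).1 he with ⟨f, hf, rfl⟩ | ⟨q, -, rfl⟩
        · simp [Sym2.mem_map] at hp
        · obtain rfl : p = q := by simpa using hp
          simp
      exact (Finset.card_le_card this).trans (by simp)

variable {E F₁ F₂ : Finset (Sym2 V)} {c₁ c₂ : Sym2 V → ℕ} {R : Finset V} {m : V → ℕ}

/-- The degree assumption on the endpoints of precolored joining edges can be dropped. -/
theorem PrismPrecoloring.extends_of_padding (h : PrismPrecoloring E F₁ F₂ c₁ c₂ ∅ m)
    (hm : ∀ v ∈ R, m v < 5) (hne₁ : ∀ f ∈ F₁, ∀ v ∈ R, v ∈ f → c₁ f ≠ m v)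
    (hne₂ : ∀ f ∈ F₂, ∀ v ∈ R, v ∈ f → c₂ f ≠ m v)
    (hcard : F₁.card + F₂.card + R.card ≤ 4) : PrismExtends E F₁ F₂ c₁ c₂ R m := by
  obtain ⟨E', hEE', hd, hdeg, hinl⟩ := exists_padding h.not_isDiag h.degree_le
  let ι : Sym2 V → Sym2 (V ⊕ V × Fin 3) := Sym2.map Sum.inl
  let ρ : V ⊕ V × Fin 3 → V := Sum.elim id Prod.fst
  have hι : Function.Injective ι := Sym2.map.injective Sum.inl_injective
  have hρ : ∀ e, (ι e).map ρ = e := by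
    intro e
    simp only [ι, Sym2.map_map]
    exact Sym2.map_id' ▸ rfl
  have hmem : ∀ v e, Sum.inl v ∈ ι e ↔ v ∈ e := by
    intro v e
    simp [ι, Sym2.mem_map]
  have hsub : ∀ F ⊆ E, F.image ι ⊆ E' := by
    intro F hF e he
    obtain ⟨f, hf, rfl⟩ := Finset.mem_image.1 he
    exact hEE' f (hF hf)
  have hlt : ∀ (F : Finset (Sym2 V)) (d : Sym2 V → ℕ), (∀ f ∈ F, d f < 5) →
      ∀ f ∈ F.image ι, d (f.map ρ) < 5 := by
    intro F d hF e he
    obtain ⟨f, hf, rfl⟩ := Finset.mem_image.1 he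
    rw [hρ]
    exact hF f hf
  have hproper : ∀ (F : Finset (Sym2 V)) (d : Sym2 V → ℕ), ProperOn (F : Set (Sym2 V)) d →
      ProperOn (F.image ι : Finset _) fun f => d (f.map ρ) := by
    intro F d hF e' he' f' hf' hef ⟨v, hve, hvf⟩
    obtain ⟨e, he, rfl⟩ := Finset.mem_image.1 he'
    obtain ⟨f, hf, rfl⟩ := Finset.mem_image.1 hf'
    obtain ⟨w, hw, rfl⟩ := Sym2.mem_map.1 hve
    beta_reduce
    rw [hρ, hρ]
    exact hF e he f hf (fun h => hef (congrArg ι h)) ⟨w, hw, (hmem _ _).1 hvf⟩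
  have hne : ∀ (F : Finset (Sym2 V)) (d : Sym2 V → ℕ),
      (∀ f ∈ F, ∀ v ∈ R, v ∈ f → d f ≠ m v) →
      ∀ f ∈ F.image ι, ∀ v ∈ R.image Sum.inl, v ∈ f → d (f.map ρ) ≠ m (ρ v) := by
    intro F d hF f' hf' v' hv' hvf
    obtain ⟨f, hf, rfl⟩ := Finset.mem_image.1 hf'
    obtain ⟨v, hv, rfl⟩ := Finset.mem_image.1 hv'
    rw [hρ]
    exact hF f hf v hv ((hmem _ _).1 hvf)
  have key : PrismPrecoloring E' (F₁.image ι) (F₂.image ι) (fun f => c₁ (f.map ρ))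
      (fun f => c₂ (f.map ρ)) (R.image Sum.inl) (fun v => m (ρ v)) :=
    { not_isDiag := hd
      degree_le := hdeg
      degree_eq := fun v hv => by
        obtain ⟨v, -, rfl⟩ := Finset.mem_image.1 hv
        exact hinl v
      subset₁ := hsub _ h.subset₁
      subset₂ := hsub _ h.subset₂
      lt₁ := hlt _ _ h.lt₁
      lt₂ := hlt _ _ h.lt₂
      lt := fun w hw => by
        obtain ⟨v, hv, rfl⟩ := Finset.mem_image.1 hw
        exact hm v hv
      proper₁ := hproper _ _ h.proper₁
      proper₂ := hproper _ _ h.proper₂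
      ne₁ := hne _ _ hne₁
      ne₂ := hne _ _ hne₂ }
  obtain ⟨C₁, C₂, μ, h1, h2, h3, h4, h5, h6, h7, h8, h9⟩ := key.extends_of_degree_eq (by
    rwa [Finset.card_image_of_injective _ hι, Finset.card_image_of_injective _ hι,
      Finset.card_image_of_injective _ Sum.inl_injective])
  have pull : ∀ C, ProperOn (E' : Set _) C → ProperOn (E : Set (Sym2 V)) (C ∘ ι) :=
    fun C hC e he f hf hef ⟨v, hve, hvf⟩ => hC (ι e) (hEE' e he) (ι f) (hEE' f hf)
      (hι.ne hef) ⟨Sum.inl v, (hmem _ _).2 hve, (hmem _ _).2 hvf⟩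
  refine ⟨C₁ ∘ ι, C₂ ∘ ι, μ ∘ Sum.inl, fun e he => h1 _ (hEE' e he),
    fun e he => h2 _ (hEE' e he), fun v => h3 _, pull _ h4, pull _ h5,
    fun e he v hv => h6 _ (hEE' e he) _ ((hmem _ _).2 hv), fun f hf => ?_, fun f hf => ?_,
    fun v hv => h9 _ (Finset.mem_image_of_mem _ hv)⟩
  · exact (h7 _ (Finset.mem_image_of_mem _ hf)).trans (congrArg c₁ (hρ f))
  · exact (h8 _ (Finset.mem_image_of_mem _ hf)).trans (congrArg c₂ (hρ f))

end Padding

section BoxProd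

variable {V : Type*}

/-- The edge joining the two copies of `v`. -/
def rung (v : V) : Sym2 (V × Fin 2) := s((v, 0), (v, 1))

/-- The copy of the edge `e` in the layer `i`. -/
def layer (i : Fin 2) (e : Sym2 V) : Sym2 (V × Fin 2) := e.map fun v => (v, i)

lemma mem_rung {v : V} {w : V × Fin 2} : w ∈ rung v ↔ w.1 = v := by
  obtain ⟨x, i⟩ := w
  fin_cases i <;> simp [rung]

lemma mem_layer {i : Fin 2} {e : Sym2 V} {w : V × Fin 2} :
    w ∈ layer i e ↔ w.1 ∈ e ∧ w.2 = i := by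
  obtain ⟨x, j⟩ := w
  simp [layer, Sym2.mem_map, eq_comm]

lemma rung_injective : Function.Injective (rung : V → Sym2 (V × Fin 2)) := by
  intro v w h
  exact mem_rung.1 (h ▸ mem_rung.2 rfl : (v, (0 : Fin 2)) ∈ rung w)

lemma layer_injective (i : Fin 2) : Function.Injective (layer i : Sym2 V → _) :=
  Sym2.map.injective fun _ _ h => congrArg Prod.fst h

lemma layer_ne_rung (i : Fin 2) (e : Sym2 V) (v : V) : layer i e ≠ rung v := by
  intro h
  have h0 := (mem_layer.1 (h ▸ mem_rung.2 rfl : (v, (0 : Fin 2)) ∈ layer i e)).2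
  have h1 := (mem_layer.1 (h ▸ mem_rung.2 rfl : (v, (1 : Fin 2)) ∈ layer i e)).2
  exact absurd (h0.trans h1.symm) (by simp)

lemma layer_zero_ne_layer_one (e f : Sym2 V) : layer 0 e ≠ layer 1 f := by
  intro h
  induction e with | _ x y
  have := (mem_layer.1 (h ▸ mem_layer.2 ⟨Sym2.mem_mk_left x y, rfl⟩ :
    (x, (0 : Fin 2)) ∈ layer 1 f)).2
  simp at this

lemma mem_edgeSet_boxProd {G : SimpleGraph V} {e : Sym2 (V × Fin 2)}
    (he : e ∈ (G □ (⊤ : SimpleGraph (Fin 2))).edgeSet) :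
    (∃ f ∈ G.edgeSet, e = layer 0 f) ∨ (∃ f ∈ G.edgeSet, e = layer 1 f) ∨ ∃ v, e = rung v := by
  induction e with | _ x y
  obtain ⟨x, i⟩ := x
  obtain ⟨y, j⟩ := y
  rw [mem_edgeSet, boxProd_adj] at he
  rcases he with ⟨hxy, hij⟩ | ⟨hij, hxy⟩
  · obtain rfl : i = j := hij
    have hxy' : s(x, y) ∈ G.edgeSet := hxy
    fin_cases i
    · exact Or.inl ⟨_, hxy', rfl⟩
    · exact Or.inr (Or.inl ⟨_, hxy', rfl⟩)
  · obtain rfl : x = y := hxy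
    refine Or.inr (Or.inr ⟨x, ?_⟩)
    fin_cases i <;> fin_cases j <;> simp_all [rung, Sym2.eq_swap]

/-- A coloring of the two layers and the rungs. -/
lemma exists_coloring (C₁ C₂ : Sym2 V → ℕ) (μ : V → ℕ) :
    ∃ C : Sym2 (V × Fin 2) → ℕ, (∀ e, C (layer 0 e) = C₁ e) ∧ (∀ e, C (layer 1 e) = C₂ e) ∧
      ∀ v, C (rung v) = μ v := by
  classical
  let C : Sym2 (V × Fin 2) → ℕ := fun e =>
    if h : ∃ v, e = rung v then μ h.choose
    else if ∃ f, e = layer 0 f then C₁ (e.map Prod.fst) else C₂ (e.map Prod.fst)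
  have hfst : ∀ i (e : Sym2 V), (layer i e).map Prod.fst = e := by
    intro i e
    rw [layer, Sym2.map_map]
    exact Sym2.map_id' ▸ rfl
  refine ⟨C, fun e => ?_, fun e => ?_, fun v => ?_⟩
  · have h1 : ¬ ∃ v, layer 0 e = rung v := fun ⟨v, hv⟩ => layer_ne_rung _ _ _ hv
    simp [C, h1, hfst]
  · have h1 : ¬ ∃ v, layer 1 e = rung v := fun ⟨v, hv⟩ => layer_ne_rung _ _ _ hv
    have h2 : ¬ ∃ f, layer 1 e = layer 0 f := fun ⟨f, hf⟩ => layer_zero_ne_layer_one _ _ hf.symm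
    simp [C, h1, h2, hfst]
  · have h1 : ∃ w, rung v = rung w := ⟨v, rfl⟩
    simp only [C, dif_pos h1]
    rw [← rung_injective h1.choose_spec]

end BoxProd

/-- **Theorem (subcubic Cartesian).** If `G` is subcubic, then every proper precoloring of at
most four edges of `G □ K₂` extends to a proper 5-edge-coloring of `G □ K₂`. -/
theorem stmt_9 {V : Type*} [Fintype V] (G : SimpleGraph V) [DecidableRel G.Adj]
    (hsub : ∀ v : V, G.degree v ≤ 3) :
    PrecoloringExtendable (G □ (⊤ : SimpleGraph (Fin 2))) 4 5 := by
  classical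
  intro E₀ hE₀ hcard c₀ hc₀ hp₀
  let E := G.edgeFinset
  let F : Fin 2 → Finset (Sym2 V) := fun i => E.filter fun e => layer i e ∈ E₀
  let R : Finset V := Finset.univ.filter fun v => rung v ∈ E₀
  have hF : ∀ {i e}, e ∈ F i ↔ e ∈ G.edgeSet ∧ layer i e ∈ E₀ := by simp [F, E]
  have hR : ∀ {v}, v ∈ R ↔ rung v ∈ E₀ := by simp [R]
  have hmem : ∀ {e}, e ∈ E ↔ e ∈ G.edgeSet := by simp [E]
  have hsum : (F 0).card + (F 1).card + R.card ≤ 4 := by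
    have h1 : Disjoint ((F 0).image (layer 0)) ((F 1).image (layer 1)) := by
      rw [Finset.disjoint_left]
      intro e he he'
      obtain ⟨f, -, rfl⟩ := Finset.mem_image.1 he
      obtain ⟨g, -, hg⟩ := Finset.mem_image.1 he'
      exact layer_zero_ne_layer_one _ _ hg.symm
    have h2 : Disjoint ((F 0).image (layer 0) ∪ (F 1).image (layer 1)) (R.image rung) := by
      rw [Finset.disjoint_left]
      intro e he he'
      obtain ⟨v, -, rfl⟩ := Finset.mem_image.1 he'
      rcases Finset.mem_union.1 he with he | he <;> obtain ⟨f, -, hf⟩ := Finset.mem_image.1 he <;>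
        exact layer_ne_rung _ _ _ hf
    rw [← Finset.card_image_of_injective (F 0) (layer_injective 0),
      ← Finset.card_image_of_injective (F 1) (layer_injective 1),
      ← Finset.card_image_of_injective R rung_injective, ← Finset.card_union_of_disjoint h1,
      ← Finset.card_union_of_disjoint h2, ← Set.ncard_coe_finset]
    refine (Set.ncard_le_ncard ?_ (Set.toFinite E₀)).trans hcard
    intro e he
    simp only [Finset.coe_union, Finset.coe_image, Set.mem_union, Set.mem_image,
      Finset.mem_coe] at he
    rcases he with (⟨f, hf, rfl⟩ | ⟨f, hf, rfl⟩) | ⟨v, hv, rfl⟩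
    exacts [(hF.1 hf).2, (hF.1 hf).2, hR.1 hv]
  have hproper : ∀ i, ProperOn (F i : Set (Sym2 V)) (c₀ ∘ layer i) :=
    fun i e he f hf hef ⟨v, hve, hvf⟩ => hp₀ _ (hF.1 he).2 _ (hF.1 hf).2
      ((layer_injective i).ne hef) ⟨(v, i), mem_layer.2 ⟨hve, rfl⟩, mem_layer.2 ⟨hvf, rfl⟩⟩
  have hne : ∀ i, ∀ f ∈ F i, ∀ v ∈ R, v ∈ f → (c₀ ∘ layer i) f ≠ (c₀ ∘ rung) v :=
    fun i f hf v hv hvf => hp₀ _ (hF.1 hf).2 _ (hR.1 hv) (layer_ne_rung _ _ _)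
      ⟨(v, i), mem_layer.2 ⟨hvf, rfl⟩, mem_rung.2 rfl⟩
  have hpre : PrismPrecoloring E (F 0) (F 1) (c₀ ∘ layer 0) (c₀ ∘ layer 1) ∅ (c₀ ∘ rung) :=
    { not_isDiag := fun e he => G.not_isDiag_of_mem_edgeSet (hmem.1 he)
      degree_le := fun v => by
        refine le_trans (le_of_eq ?_) (hsub v)
        rw [← G.card_incidenceFinset_eq_degree, G.incidenceFinset_eq_filter]
        rfl
      degree_eq := by simp
      subset₁ := Finset.filter_subset _ _
      subset₂ := Finset.filter_subset _ _
      lt₁ := fun f hf => hc₀ _ (hF.1 hf).2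
      lt₂ := fun f hf => hc₀ _ (hF.1 hf).2
      lt := by simp
      proper₁ := hproper 0
      proper₂ := hproper 1
      ne₁ := by simp
      ne₂ := by simp }
  obtain ⟨C₁, C₂, μ, h1, h2, h3, h4, h5, h6, h7, h8, h9⟩ := hpre.extends_of_padding
    (fun v hv => hc₀ _ (hR.1 hv)) (hne 0) (hne 1) hsum
  obtain ⟨C, hC₁, hC₂, hCμ⟩ := exists_coloring C₁ C₂ μ
  refine ⟨C, ?_, ?_, ?_⟩
  · intro e he
    rcases mem_edgeSet_boxProd he with ⟨f, hf, rfl⟩ | ⟨f, hf, rfl⟩ | ⟨v, rfl⟩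
    · exact hC₁ f ▸ h1 f (hmem.2 hf)
    · exact hC₂ f ▸ h2 f (hmem.2 hf)
    · exact hCμ v ▸ h3 v
  · intro e he f hf hef ⟨w, hwe, hwf⟩
    rcases mem_edgeSet_boxProd he with ⟨e, he', rfl⟩ | ⟨e, he', rfl⟩ | ⟨v, rfl⟩ <;>
      rcases mem_edgeSet_boxProd hf with ⟨f, hf', rfl⟩ | ⟨f, hf', rfl⟩ | ⟨u, rfl⟩ <;>
      simp only [mem_layer, mem_rung] at hwe hwf <;> simp only [hC₁, hC₂, hCμ]
    · exact h4 e (hmem.2 he') f (hmem.2 hf') (fun h => hef (h ▸ rfl)) ⟨w.1, hwe.1, hwf.1⟩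
    · exact absurd (hwe.2.symm.trans hwf.2) (by simp)
    · exact (h6 e (hmem.2 he') u (hwf ▸ hwe.1)).1
    · exact absurd (hwf.2.symm.trans hwe.2) (by simp)
    · exact h5 e (hmem.2 he') f (hmem.2 hf') (fun h => hef (h ▸ rfl)) ⟨w.1, hwe.1, hwf.1⟩
    · exact (h6 e (hmem.2 he') u (hwf ▸ hwe.1)).2
    · exact (h6 f (hmem.2 hf') v (hwe ▸ hwf.1)).1.symm
    · exact (h6 f (hmem.2 hf') v (hwe ▸ hwf.1)).2.symm
    · exact absurd (congrArg rung (hwe.symm.trans hwf)) hef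
  · intro e he
    rcases mem_edgeSet_boxProd (hE₀ he) with ⟨f, hf, rfl⟩ | ⟨f, hf, rfl⟩ | ⟨v, rfl⟩
    · rw [hC₁, h7 f (hF.2 ⟨hf, he⟩), Function.comp_apply]
    · rw [hC₂, h8 f (hF.2 ⟨hf, he⟩), Function.comp_apply]
    · rw [hCμ, h9 v (hR.2 he), Function.comp_apply]
end

section
/- In the complete graph K₅ on five vertices {v₁, v₂, v₃, v₄, v₅}, the proper edge-precoloring that assigns colors 1, 2, 3 to the three edges v₁v₂, v₂v₃, v₃v₁ of a triangle and color 4 to the edge v₄v₅ (which is vertex-disjoint from the triangle) cannot be extended to a proper edge-coloring of K₅ with 5 colors. -/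
open SimpleGraph

/-- **Non-extendability in `K₅`.** The precoloring of `K₅` assigning colors `1, 2, 3` to the
triangle `v₁v₂, v₂v₃, v₃v₁` and color `4` to the disjoint edge `v₄v₅` does not extend to a
proper 5-edge-coloring of `K₅` (colors `0,…,4`). -/
theorem stmt_11 :
    ¬ ∃ C : Sym2 (Fin 5) → ℕ,
        (∀ e ∈ (⊤ : SimpleGraph (Fin 5)).edgeSet, C e < 5) ∧
        ProperOn (⊤ : SimpleGraph (Fin 5)).edgeSet C ∧
        C s(0, 1) = 1 ∧ C s(1, 2) = 2 ∧ C s(2, 0) = 3 ∧ C s(3, 4) = 4 := by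
  rintro ⟨C, hlt, hproper, h01, h12, h20, h34⟩
  have lt : ∀ a b : Fin 5, a ≠ b → C s(a, b) < 5 := fun a b hab =>
    hlt _ (by simpa using hab)
  have ne : ∀ a b c : Fin 5, a ≠ b → a ≠ c → b ≠ c → C s(a, b) ≠ C s(a, c) :=
    fun a b c hab hac hbc =>
      hproper _ (by simpa using hab) _ (by simpa using hac) (by simpa [hab, hac] using hbc)
        ⟨a, by simp, by simp⟩
  -- Every edge joining the triangle to `{3, 4}` avoids color `4` and two of the triangle's colors,
  -- so each triangle vertex sends an edge of color `0` to `3` or `4`.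
  have avoids : ∀ a b c : Fin 5, ∀ u v : Fin 5, [a, b, c, u, v].Nodup → C s(u, v) = 4 →
      C s(a, u) ≠ C s(a, b) ∧ C s(a, u) ≠ C s(a, c) ∧ C s(a, u) < 4 := by
    intro a b c u v hnodup huv
    simp only [List.nodup_cons, List.mem_cons, List.not_mem_nil, or_false, not_or] at hnodup
    obtain ⟨⟨hab, hac, hau, hav⟩, ⟨-, hbu, -⟩, ⟨hcu, -⟩, huv', -⟩ := hnodup
    have hne := ne u a v (Ne.symm hau) huv' hav
    rw [Sym2.eq_swap, huv] at hne
    have hlt := lt a u hau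
    exact ⟨ne a u b hau hab (Ne.symm hbu), ne a u c hau hac (Ne.symm hcu), by omega⟩
  have h43 : C s(4, 3) = 4 := by rwa [Sym2.eq_swap]
  have h10 : C s(1, 0) = 1 := by rwa [Sym2.eq_swap]
  have h21 : C s(2, 1) = 2 := by rwa [Sym2.eq_swap]
  have h02 : C s(0, 2) = 3 := by rwa [Sym2.eq_swap]
  have a03 := avoids 0 1 2 3 4 (by decide) h34
  have a04 := avoids 0 1 2 4 3 (by decide) h43
  have a13 := avoids 1 0 2 3 4 (by decide) h34
  have a14 := avoids 1 0 2 4 3 (by decide) h43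
  have a23 := avoids 2 0 1 3 4 (by decide) h34
  have a24 := avoids 2 0 1 4 3 (by decide) h43
  have n0 := ne 0 3 4 (by decide) (by decide) (by decide)
  have n1 := ne 1 3 4 (by decide) (by decide) (by decide)
  have n2 := ne 2 3 4 (by decide) (by decide) (by decide)
  have zero0 : C s(0, 3) = 0 ∨ C s(0, 4) = 0 := by omega
  have zero1 : C s(1, 3) = 0 ∨ C s(1, 4) = 0 := by omega
  have zero2 : C s(2, 3) = 0 ∨ C s(2, 4) = 0 := by omega
  -- Two of these three edges of color `0` share an endpoint.
  have disjoint : ∀ a b u : Fin 5, a ≠ u → b ≠ u → a ≠ b → C s(a, u) ≠ C s(b, u) := by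
    intro a b u hau hbu hab
    rw [Sym2.eq_swap (a := a), Sym2.eq_swap (a := b)]
    exact ne u a b (Ne.symm hau) (Ne.symm hbu) hab
  have d013 := disjoint 0 1 3 (by decide) (by decide) (by decide)
  have d014 := disjoint 0 1 4 (by decide) (by decide) (by decide)
  have d023 := disjoint 0 2 3 (by decide) (by decide) (by decide)
  have d024 := disjoint 0 2 4 (by decide) (by decide) (by decide)
  have d123 := disjoint 1 2 3 (by decide) (by decide) (by decide)
  have d124 := disjoint 1 2 4 (by decide) (by decide) (by decide)
  omega
end

section
/- Let G be a subcubic simple graph, let e = uv be an edge of G, let w be a vertex of G of degree exactly 3 with w ∉ {u, v}, and let c be one of 4 available colors. Then there exists a proper edge-coloring φ of G with 4 colors such that φ(e) = c and at least one edge incident to w is also colored c. -/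
open SimpleGraph

/-- A symmetric function of two vertices giving distinct colors to distinct edges at a vertex. -/
def IsArcColoring {V κ : Type*} (H : SimpleGraph V) (C : V → V → κ) : Prop :=
  (∀ a b, C a b = C b a) ∧ ∀ v a b, H.Adj v a → H.Adj v b → a ≠ b → C v a ≠ C v b

/-- A connected component of a graph of maximum degree two has at most two vertices of degree
at most one. -/
theorem not_reachable_of_three_ends {V : Type*} [Finite V] (K : SimpleGraph V)
    (hK : ∀ a, (K.neighborSet a).ncard ≤ 2) {x y z : V} (hxy : x ≠ y) (hxz : x ≠ z) (hyz : y ≠ z)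
    (hx : (K.neighborSet x).ncard ≤ 1) (hy : (K.neighborSet y).ncard ≤ 1)
    (hz : (K.neighborSet z).ncard ≤ 1) (hrxy : K.Reachable x y) : ¬ K.Reachable x z := by
  classical
  intro hrxz
  have := Fintype.ofFinite V
  let S := (K.connectedComponentMk x).supp
  have hconn : (K.induce S).Connected := (K.connectedComponentMk x).connected_toSimpleGraph
  have hcount := hconn.card_vert_le_card_edgeSet_add_one
  have hsum := (K.induce S).sum_degrees_eq_twice_card_edges
  rw [Nat.card_eq_fintype_card, Nat.card_eq_fintype_card, ← edgeFinset_card] at hcount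
  have hdeg : ∀ a : S, (K.induce S).degree a ≤ (K.neighborSet a).ncard := by
    intro a
    rw [← card_neighborSet_eq_degree, ← Nat.card_eq_fintype_card, Nat.card_coe_set_eq]
    refine Set.ncard_le_ncard_of_injOn (fun b => (b : V)) ?_ Subtype.val_injective.injOn
    intro b hb
    exact hb
  let T : Finset S := {⟨x, rfl⟩, ⟨y, ConnectedComponent.sound hrxy.symm⟩,
    ⟨z, ConnectedComponent.sound hrxz.symm⟩}
  have hT : T.card = 3 := by
    apply Finset.card_eq_three.2
    exact ⟨_, _, _,
      Subtype.coe_ne_coe.1 hxy, Subtype.coe_ne_coe.1 hxz, Subtype.coe_ne_coe.1 hyz, rfl⟩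
  have hle : ∑ a : S, ((K.induce S).degree a + if a ∈ T then 1 else 0) ≤ ∑ _a : S, 2 := by
    refine Finset.sum_le_sum fun a _ => ?_
    have h1 := hdeg a
    split_ifs with h
    · simp only [T, Finset.mem_insert, Finset.mem_singleton] at h
      rcases h with rfl | rfl | rfl <;> simp only at h1 <;> omega
    · exact h1.trans (hK a)
  rw [Finset.sum_add_distrib, hsum] at hle
  simp only [Finset.sum_ite_mem, Finset.univ_inter, Finset.sum_const, smul_eq_mul, mul_one,
    Finset.card_univ, hT] at hle
  omega

/-- Exchanging two colors on a set of vertices closed under the edges of these colors keeps a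
coloring proper. -/
theorem IsArcColoring.kempe {V κ : Type*} [DecidableEq κ] {H : SimpleGraph V} {C : V → V → κ}
    (hC : IsArcColoring H C) (α β : κ) (S : Set V) [DecidablePred (· ∈ S)]
    (hS : ∀ a b, H.Adj a b → (C a b = α ∨ C a b = β) → a ∈ S → b ∈ S) :
    ∃ C' : V → V → κ, IsArcColoring H C' ∧
      ∀ a b, H.Adj a b → C' a b = if a ∈ S then Equiv.swap α β (C a b) else C a b := by
  have key : ∀ a b, H.Adj a b →
      (if a ∈ S ∨ b ∈ S then Equiv.swap α β (C a b) else C a b) =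
        if a ∈ S then Equiv.swap α β (C a b) else C a b := by
    intro a b hab
    by_cases hc : C a b = α ∨ C a b = β
    · have h1 := hS a b hab hc
      have h2 := hS b a hab.symm (by rwa [hC.1 b a])
      by_cases ha : a ∈ S <;> by_cases hb : b ∈ S <;> simp_all
    · push Not at hc
      simp [Equiv.swap_apply_of_ne_of_ne hc.1 hc.2]
  refine ⟨fun a b => if a ∈ S ∨ b ∈ S then Equiv.swap α β (C a b) else C a b, ⟨?_, ?_⟩, key⟩
  · intro a b
    simp only [hC.1 a b, or_comm]
  · intro v a b ha hb hab
    have := hC.2 v a b ha hb hab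
    simp only [key v a ha, key v b hb]
    split_ifs
    · exact fun h => this ((Equiv.swap α β).injective h)
    · exact this

/-- At most three vertices, each with one forbidden color out of three, can be colored injectively
unless there are three of them with the same forbidden color. -/
theorem exists_injOn_ne {V : Type*} (N : Set V) [Finite N] (hN : N.ncard ≤ 3) (F : V → Fin 3)
    (hF : N.ncard = 3 → ∃ a ∈ N, ∃ b ∈ N, F a ≠ F b) :
    ∃ g : V → Fin 3, Set.InjOn g N ∧ ∀ y ∈ N, g y ≠ F y := by
  classical
  have hNf : N.Finite := Set.toFinite N
  have h3 : ∀ p q r : Fin 3, ¬ (p = q ∧ p = r) →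
      ∃ i j k : Fin 3, i ≠ j ∧ i ≠ k ∧ j ≠ k ∧ i ≠ p ∧ j ≠ q ∧ k ≠ r := by decide
  have h2 : ∀ p q : Fin 3, ∃ i j : Fin 3, i ≠ j ∧ i ≠ p ∧ j ≠ q := by decide
  have h1 : ∀ p : Fin 3, ∃ i : Fin 3, i ≠ p := by decide
  obtain h | h | h | h : N.ncard = 0 ∨ N.ncard = 1 ∨ N.ncard = 2 ∨ N.ncard = 3 := by omega
  · rw [Set.ncard_eq_zero hNf] at h
    subst h
    exact ⟨F, by simp, by simp⟩
  · obtain ⟨a, rfl⟩ := Set.ncard_eq_one.1 h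
    obtain ⟨i, hi⟩ := h1 (F a)
    exact ⟨fun _ => i, by simp, by simpa using hi⟩
  · obtain ⟨a, b, hab, rfl⟩ := Set.ncard_eq_two.1 h
    obtain ⟨i, j, hij, hi, hj⟩ := h2 (F a) (F b)
    refine ⟨fun y => if y = a then i else j, ?_, ?_⟩
    · simp [Set.InjOn, hab.symm, hij, hij.symm]
    · simp [hab.symm, hi, hj]
  · obtain ⟨a, b, d, hab, had, hbd, rfl⟩ := Set.ncard_eq_three.1 h
    obtain ⟨i, j, k, hij, hik, hjk, hi, hj, hk⟩ := h3 (F a) (F b) (F d) (by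
      rintro ⟨h₁, h₂⟩
      obtain ⟨s, hs, t, ht, hst⟩ := hF h
      simp only [Set.mem_insert_iff, Set.mem_singleton_iff] at hs ht
      rcases hs with rfl | rfl | rfl <;> rcases ht with rfl | rfl | rfl <;> simp_all)
    refine ⟨fun y => if y = a then i else if y = b then j else k, ?_, ?_⟩
    · simp [Set.InjOn, hab.symm, had.symm, hbd.symm, hij, hij.symm, hik, hik.symm, hjk, hjk.symm]
    · simp [hab.symm, had.symm, hbd.symm, hi, hj, hk]

/-- A coloring of `H` in which the vertices of `N` have at most one neighbor can be chosen such
that three vertices of `N` do not all see the same color. -/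
theorem exists_coloring_forbidden {V : Type*} [Finite V] {H : SimpleGraph V}
    {C : V → V → Fin 3} (hC : IsArcColoring H C) (N : Set V)
    (hN : ∀ y ∈ N, (H.neighborSet y).ncard ≤ 1) :
    ∃ (C' : V → V → Fin 3) (F : V → Fin 3), IsArcColoring H C' ∧
      (∀ y ∈ N, ∀ b, H.Adj y b → C' y b = F y) ∧
      (N.ncard = 3 → ∃ a ∈ N, ∃ b ∈ N, F a ≠ F b) := by
  classical
  obtain ⟨F, hF⟩ : ∃ F : V → Fin 3, ∀ y ∈ N, ∀ b, H.Adj y b → C y b = F y := by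
    refine ⟨fun y => if h : ∃ b, H.Adj y b then C y h.choose else 0, fun y hy b hb => ?_⟩
    have h : ∃ b, H.Adj y b := ⟨b, hb⟩
    simp only [dif_pos h]
    congr 1
    exact (Set.ncard_le_one (Set.toFinite _)).1 (hN y hy) _ hb _ h.choose_spec
  by_cases hne : N.ncard = 3 → ∃ a ∈ N, ∃ b ∈ N, F a ≠ F b
  · exact ⟨C, F, hC, hF, hne⟩
  push Not at hne
  obtain ⟨hcard, hconst⟩ := hne
  obtain ⟨x, y, z, hxy, hxz, hyz, rfl⟩ := Set.ncard_eq_three.1 hcard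
  obtain ⟨β, hβ⟩ := exists_ne (F x)
  let K : SimpleGraph V :=
    { Adj := fun a b => H.Adj a b ∧ (C a b = F x ∨ C a b = β)
      symm := ⟨fun a b h => ⟨h.1.symm, by rw [hC.1 b a]; exact h.2⟩⟩
      loopless := ⟨fun a h => H.loopless.irrefl a h.1⟩ }
  have hK2 : ∀ a, (K.neighborSet a).ncard ≤ 2 := by
    intro a
    refine (Set.ncard_le_ncard_of_injOn (t := {F x, β}) (C a) (fun b hb => hb.2) ?_).trans
      ((Set.ncard_insert_le _ _).trans (by rw [Set.ncard_singleton]))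
    intro b hb d hd hbd
    by_contra hne
    exact hC.2 a b d hb.1 hd.1 hne hbd
  have hK1 : ∀ a ∈ ({x, y, z} : Set V), (K.neighborSet a).ncard ≤ 1 := fun a ha =>
    (Set.ncard_le_ncard (fun b hb => hb.1)).trans (hN a ha)
  have hx : x ∈ ({x, y, z} : Set V) := by simp
  have hy : y ∈ ({x, y, z} : Set V) := by simp
  have hz : z ∈ ({x, y, z} : Set V) := by simp
  obtain ⟨C', hC', hCeq⟩ := hC.kempe (F x) β {a | K.Reachable x a}
    (fun a b hab hc ha => Reachable.trans ha (Adj.reachable (G := K) ⟨hab, hc⟩))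
  refine ⟨C', fun a => if K.Reachable x a then Equiv.swap (F x) β (F a) else F a, hC', ?_, ?_⟩
  · intro a ha b hab
    rw [hCeq a b hab, hF a ha b hab]
    rfl
  · intro _
    by_cases hr : K.Reachable x y
    · refine ⟨x, hx, z, hz, ?_⟩
      have := not_reachable_of_three_ends K hK2 hxy hxz hyz (hK1 x hx) (hK1 y hy) (hK1 z hz) hr
      simpa [this, hconst z hz x hx] using hβ
    · refine ⟨x, hx, y, hy, ?_⟩
      simpa [hr, hconst y hy x hx] using hβ

/-- A subcubic graph whose vertices of degree three are independent is 3-edge-colorable. -/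
theorem exists_three_coloring {V : Type*} [Finite V] (H : SimpleGraph V)
    (h3 : ∀ a, (H.neighborSet a).ncard ≤ 3)
    (hind : ∀ a b, H.Adj a b → (H.neighborSet a).ncard = 3 → (H.neighborSet b).ncard ≤ 2) :
    ∃ C : V → V → Fin 3, IsArcColoring H C := by
  classical
  induction H using WellFoundedLT.induction with
  | ind H ih =>
  by_cases hbot : H = ⊥
  · subst hbot
    exact ⟨fun _ _ => 0, fun _ _ => rfl, fun v a b h => h.elim⟩
  obtain ⟨x, ⟨y, hxy⟩, hx⟩ : ∃ x, (∃ y, H.Adj x y) ∧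
      ∀ y, H.Adj x y → (H.neighborSet y).ncard ≤ 2 := by
    by_cases h : ∃ x, (H.neighborSet x).ncard = 3
    · obtain ⟨x, hx⟩ := h
      have : (H.neighborSet x).Nonempty := Set.nonempty_of_ncard_ne_zero (by omega)
      exact ⟨x, this, fun y hy => hind x y hy hx⟩
    · push Not at h
      obtain ⟨a, b, hab⟩ := ne_bot_iff_exists_adj.1 hbot
      exact ⟨a, ⟨b, hab⟩, fun y _ => by have := h y; have := h3 y; omega⟩
  let H' : SimpleGraph V :=
    { Adj := fun a b => H.Adj a b ∧ a ≠ x ∧ b ≠ x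
      symm := ⟨fun a b h => ⟨h.1.symm, h.2.2, h.2.1⟩⟩
      loopless := ⟨fun a h => H.loopless.irrefl a h.1⟩ }
  have hle : H' ≤ H := fun a b h => h.1
  have hlt : H' < H := lt_of_le_of_ne hle fun h => by
    have : H'.Adj x y := h ▸ hxy
    exact this.2.1 rfl
  have hmono : ∀ a, (H'.neighborSet a).ncard ≤ (H.neighborSet a).ncard := fun a =>
    Set.ncard_le_ncard fun b hb => hb.1
  obtain ⟨C₀, hC₀⟩ := ih H' hlt (fun a => (hmono a).trans (h3 a)) fun a b hab ha =>
    (hmono b).trans (hind a b hab.1 (le_antisymm (h3 a) (ha ▸ hmono a)))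
  obtain ⟨C, F, hC, hF, hne⟩ := exists_coloring_forbidden hC₀ (H.neighborSet x) (by
    intro y hy
    have h1 : (H'.neighborSet y).ncard ≤ (H.neighborSet y \ {x}).ncard :=
      Set.ncard_le_ncard fun b hb => ⟨hb.1, hb.2.2⟩
    have hxy : x ∈ H.neighborSet y := H.symm.symm _ _ hy
    rw [Set.ncard_sdiff_singleton_of_mem hxy] at h1
    have := hx y hy
    omega)
  obtain ⟨g, hg, hgF⟩ := exists_injOn_ne _ (h3 x) F hne
  have hgC : ∀ v b, v ≠ x → b ≠ x → H.Adj v x → H.Adj v b → g v ≠ C v b := by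
    intro v b hv hb hvx hvb
    rw [hF v hvx.symm b ⟨hvb, hv, hb⟩]
    exact hgF v hvx.symm
  refine ⟨fun a b => if a = x then g b else if b = x then g a else C a b, ?_, ?_⟩
  · intro a b
    have := hC.1 a b
    dsimp only
    split_ifs <;> simp_all
  · intro v a b ha hb hab
    dsimp only
    by_cases hv : v = x
    · subst hv
      simpa using fun h => hab (hg ha hb h)
    by_cases hax : a = x
    · subst hax
      simpa [hv, hab.symm] using hgC v b hv hab.symm ha hb
    by_cases hbx : b = x
    · subst hbx
      simpa [hv, hab] using (hgC v a hv hab hb ha).symm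
    simpa [hv, hax, hbx] using hC.2 v a b ⟨ha, hv, hax⟩ ⟨hb, hv, hbx⟩ hab

/-- Every matching of a subcubic graph extends to a matching `M` such that `G \ M` is
3-edge-colorable. -/
theorem exists_matching_three_coloring {V : Type*} [Finite V] {G M₀ : SimpleGraph V}
    (h3 : ∀ a, (G.neighborSet a).ncard ≤ 3) (hM₀ : M₀ ≤ G)
    (hmatch : ∀ v a b, M₀.Adj v a → M₀.Adj v b → a = b) :
    ∃ M, M₀ ≤ M ∧ (∀ v a b, M.Adj v a → M.Adj v b → a = b) ∧
      ∃ C : V → V → Fin 3, IsArcColoring (G \ M) C := by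
  obtain ⟨M, hle, hmax⟩ := (Set.toFinite
    {M : SimpleGraph V | M ≤ G ∧ ∀ v a b, M.Adj v a → M.Adj v b → a = b}).exists_le_maximal
      ⟨hM₀, hmatch⟩
  obtain ⟨hMG, hM⟩ := hmax.prop
  refine ⟨M, hle, hM, ?_⟩
  have hsub : ∀ a, (G \ M).neighborSet a ⊆ G.neighborSet a := fun a b hb => hb.1
  have hfree : ∀ a, ((G \ M).neighborSet a).ncard = 3 → ∀ b, ¬ M.Adj a b := by
    intro a ha b hab
    have heq := Set.eq_of_subset_of_ncard_le (hsub a) (ha ▸ h3 a)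
    have hb : b ∈ (G \ M).neighborSet a := heq ▸ hMG hab
    exact hb.2 hab
  have hle3 : ∀ a, ((G \ M).neighborSet a).ncard ≤ 3 := fun a =>
    (Set.ncard_le_ncard (hsub a)).trans (h3 a)
  refine exists_three_coloring _ hle3 ?_
  intro a b hab ha
  by_contra hb
  have hfa := hfree a ha
  have hfb := hfree b (by have := hle3 b; omega)
  have hmem : M ⊔ edge a b ∈
      {M : SimpleGraph V | M ≤ G ∧ ∀ v a b, M.Adj v a → M.Adj v b → a = b} := by
    refine ⟨sup_le hMG ((edge_le_iff _).2 (Or.inr hab.1)), ?_⟩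
    intro v p q hp hq
    rw [sup_adj, edge_adj] at hp hq
    rcases hp with hp | hp <;> rcases hq with hq | hq
    · exact hM v p q hp hq
    · rcases hq.1 with ⟨rfl, rfl⟩ | ⟨rfl, rfl⟩
      exacts [(hfa _ hp).elim, (hfb _ hp).elim]
    · rcases hp.1 with ⟨rfl, rfl⟩ | ⟨rfl, rfl⟩
      exacts [(hfa _ hq).elim, (hfb _ hq).elim]
    · grind
  have := hmax.le_of_ge hmem le_sup_left
  exact hfa b (this (Or.inr ((edge_adj ..).2 ⟨Or.inl ⟨rfl, rfl⟩, hab.ne⟩)))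

/-- Let `G` be subcubic, `e = uv ∈ E(G)`, `w ∉ {u, v}` a vertex of degree exactly 3 and `c`
one of 4 colors. Then `G` has a proper 4-edge-coloring `φ` with `φ(e) = c` in which some edge
incident to `w` is also colored `c`. -/
theorem stmt_12 {V : Type*} [Fintype V] (G : SimpleGraph V) [DecidableRel G.Adj]
    (hsub : ∀ x : V, G.degree x ≤ 3)
    (u v w : V) (huv : G.Adj u v) (hw : G.degree w = 3) (hwu : w ≠ u) (hwv : w ≠ v)
    (c : ℕ) (hc : c < 4) :
    ∃ C : Sym2 V → ℕ,
      (∀ e ∈ G.edgeSet, C e < 4) ∧ ProperOn G.edgeSet C ∧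
      C s(u, v) = c ∧ ∃ x : V, G.Adj w x ∧ C s(w, x) = c := by
  classical
  have h3 : ∀ a, (G.neighborSet a).ncard ≤ 3 := by
    intro a
    rw [← coe_neighborFinset, Set.ncard_coe_finset]
    exact hsub a
  obtain ⟨x, hx, hxuv⟩ : ∃ x ∈ G.neighborFinset w, x ∉ ({u, v} : Finset V) :=
    Finset.exists_mem_notMem_of_card_lt_card (by
      rw [card_neighborFinset_eq_degree, hw]
      exact Finset.card_le_two.trans_lt (by norm_num))
  rw [mem_neighborFinset] at hx
  simp only [Finset.mem_insert, Finset.mem_singleton, not_or] at hxuv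
  obtain ⟨M, hle, hM, C, hC⟩ := exists_matching_three_coloring (M₀ := edge u v ⊔ edge w x) h3
    (sup_le ((edge_le_iff _).2 (Or.inr huv)) ((edge_le_iff _).2 (Or.inr hx))) (by
      intro p a b ha hb
      rw [sup_adj, edge_adj, edge_adj] at ha hb
      grind)
  have hMuv : M.Adj u v := hle (Or.inl ((edge_adj ..).2 ⟨Or.inl ⟨rfl, rfl⟩, huv.ne⟩))
  have hMwx : M.Adj w x := hle (Or.inr ((edge_adj ..).2 ⟨Or.inl ⟨rfl, rfl⟩, hx.ne⟩))
  let D : V → V → ℕ := fun a b => Equiv.swap 3 c (if M.Adj a b then 3 else (C a b : ℕ))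
  have hD : ∀ a b, D a b = D b a := fun a b => by simp only [D, hC.1 a b, M.adj_comm a b]
  refine ⟨Sym2.lift ⟨D, hD⟩, ?_, ?_, ?_, x, hx, ?_⟩
  · intro e _
    induction e with | _ a b =>
    have := (C a b).isLt
    simp only [Sym2.lift_mk, D, Equiv.swap_apply_def]
    split_ifs <;> omega
  · rintro e he f hf hef ⟨p, hpe, hpf⟩
    obtain ⟨a, rfl⟩ := hpe
    obtain ⟨b, rfl⟩ := hpf
    have hab : a ≠ b := fun h => hef (h ▸ rfl)
    rw [mem_edgeSet] at he hf
    simp only [Sym2.lift_mk, D, ne_eq, EmbeddingLike.apply_eq_iff_eq]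
    have hCa := (C p a).isLt
    have hCb := (C p b).isLt
    split_ifs with ha hb hb
    · exact fun _ => hab (hM p a b ha hb)
    · omega
    · omega
    · exact fun h => hC.2 p a b ⟨he, ha⟩ ⟨hf, hb⟩ hab (Fin.ext h)
  · simp [D, hMuv]
  · simp [D, hMwx]
end
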